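/- There exists a positive integer N such that for every non-Brjuno number α ∈ Irr_N, the quadratic polynomial P_α(z) = e^{2πiα}z + z² is not linearizable at its fixed point 0. -/

import Mathlib

open MeasureTheory Filter

/-- The quadratic polynomial `P_α(z) = e^{2πiα} z + z²`. -/
noncomputable def Pa (α : ℝ) (z : ℂ) : ℂ :=
  Complex.exp (2 * Real.pi * Complex.I * α) * z + z ^ 2

/-- The Gauss map orbit of `α`: `x₀ = α`, `x_{n+1} = {1/x_n}`. -/
noncomputable def gaussIter (α : ℝ) : ℕ → ℝ
  | 0 => α
  | n + 1 => Int.fract (1 / gaussIter α n)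

/-- `cfa α n` is the partial quotient `a_{n+1}` of the regular continued fraction of `α`. -/
noncomputable def cfa (α : ℝ) (n : ℕ) : ℤ := ⌊1 / gaussIter α n⌋

/-- `cfq α n = qₙ`, the denominator of the `n`-th convergent of the regular continued
fraction of `α`: `q₀ = 1`, `q₁ = a₁`, `q_{n+1} = a_{n+1} qₙ + q_{n-1}`. -/
noncomputable def cfq (α : ℝ) : ℕ → ℤ
  | 0 => 1
  | 1 => cfa α 0
  | n + 2 => cfa α (n + 1) * cfq α (n + 1) + cfq α n

/-- `α` is a Brjuno number if `∑ (log q_{n+1})/qₙ` converges. -/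
def IsBrjuno (α : ℝ) : Prop :=
  Summable fun n : ℕ => Real.log ((cfq α (n + 1) : ℝ)) / ((cfq α n : ℝ))

/-- `Irr_N`: irrational numbers in `(0,1)` whose partial quotients are all at least `N`. -/
def IrrN (N : ℕ) : Set ℝ :=
  {α | α ∈ Set.Ioo (0 : ℝ) 1 ∧ Irrational α ∧ ∀ n : ℕ, (N : ℤ) ≤ cfa α n}

/-- `f`, holomorphic on `dom` with fixed point 0 of multiplier `e^{2πiα}`, is linearizable
at `0`: there are `r > 0` and an injective holomorphic `ψ` on `D(0,r)` with `ψ(0) = 0`,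
image contained in `dom`, conjugating the rotation `z ↦ e^{2πiα} z` to `f`. -/
def LinearizableAt (f : ℂ → ℂ) (dom : Set ℂ) (α : ℝ) : Prop :=
  ∃ r : ℝ, 0 < r ∧ ∃ ψ : ℂ → ℂ,
    DifferentiableOn ℂ ψ (Metric.ball 0 r) ∧
    Set.InjOn ψ (Metric.ball 0 r) ∧
    ψ 0 = 0 ∧
    ψ '' Metric.ball 0 r ⊆ dom ∧
    ∀ z ∈ Metric.ball (0 : ℂ) r, f (ψ z) = ψ (Complex.exp (2 * Real.pi * Complex.I * α) * z)

namespace QL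

noncomputable def linP (μ : ℂ) (h : Polynomial ℂ) : ℕ → PowerSeries ℂ
  | 0 => PowerSeries.X
  | k+1 => linP μ h k + PowerSeries.C (PowerSeries.coeff (k+2) (Polynomial.aeval (linP μ h k) h) /
      (μ^(k+2) - μ)) * PowerSeries.X^(k+2)

noncomputable def lin (μ : ℂ) (h : Polynomial ℂ) : PowerSeries ℂ :=
  PowerSeries.mk fun k => PowerSeries.coeff k (linP μ h k)

lemma aeval_sub_dvd (φ ψ : PowerSeries ℂ) (g : Polynomial ℂ) :
    φ - ψ ∣ Polynomial.aeval φ g - Polynomial.aeval ψ g := by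
  rw [Polynomial.aeval_def, Polynomial.aeval_def, Polynomial.eval₂_eq_eval_map,
    Polynomial.eval₂_eq_eval_map]
  exact Polynomial.sub_dvd_eval_sub _ _ _

lemma aeval_congr {φ ψ : PowerSeries ℂ} {k : ℕ} (h : Polynomial ℂ) (hh : Polynomial.X^2 ∣ h)
    (hφ : PowerSeries.X ∣ φ) (hψ : PowerSeries.X ∣ ψ) (hd : PowerSeries.X^k ∣ φ - ψ) :
    PowerSeries.X^(k+1) ∣ Polynomial.aeval φ h - Polynomial.aeval ψ h := by
  obtain ⟨g, rfl⟩ := hh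
  simp only [map_mul, map_pow, Polynomial.aeval_X]
  have e : φ^2 * Polynomial.aeval φ g - ψ^2 * Polynomial.aeval ψ g =
    ((φ - ψ) * (φ + ψ)) * Polynomial.aeval φ g +
      (Polynomial.aeval φ g - Polynomial.aeval ψ g) * ψ * ψ := by ring
  rw [e]
  apply dvd_add
  · apply Dvd.dvd.mul_right
    rw [pow_succ]
    exact mul_dvd_mul hd (dvd_add hφ hψ)
  · apply Dvd.dvd.mul_right
    rw [pow_succ]
    exact mul_dvd_mul (hd.trans (aeval_sub_dvd _ _ _)) hψ

lemma linP_stable (μ : ℂ) (h : Polynomial ℂ) (n j m : ℕ) (hm : m ≤ n + 1) :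
    PowerSeries.coeff m (linP μ h (n+j)) = PowerSeries.coeff m (linP μ h n) := by
  induction j with
  | zero => rfl
  | succ j ih =>
    rw [← add_assoc, linP, map_add, ih, PowerSeries.coeff_C_mul, PowerSeries.coeff_X_pow,
      if_neg (by omega)]
    simp

lemma coeff_lin (μ : ℂ) (h : Polynomial ℂ) (n m : ℕ) (hm : m ≤ n + 1) :
    PowerSeries.coeff m (lin μ h) = PowerSeries.coeff m (linP μ h n) := by
  rw [lin, PowerSeries.coeff_mk]
  rcases le_total m n with h1 | h1
  · obtain ⟨j, rfl⟩ := Nat.exists_eq_add_of_le h1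
    rw [linP_stable _ _ _ _ _ (by omega)]
  · obtain ⟨j, rfl⟩ := Nat.exists_eq_add_of_le h1
    rw [linP_stable _ _ _ _ _ (by omega)]

lemma coeff_linP_big (μ : ℂ) (h : Polynomial ℂ) (n m : ℕ) (hm : n + 1 < m) :
    PowerSeries.coeff m (linP μ h n) = 0 := by
  induction n with
  | zero => rw [linP, PowerSeries.coeff_X, if_neg (by omega)]
  | succ n ih => rw [linP, map_add, ih (by omega), PowerSeries.coeff_C_mul,
      PowerSeries.coeff_X_pow, if_neg (by omega)]; simp

lemma lin_zero (μ : ℂ) (h : Polynomial ℂ) : PowerSeries.coeff 0 (lin μ h) = 0 := by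
  rw [coeff_lin μ h 0 0 (by omega), linP]; simp

lemma lin_one (μ : ℂ) (h : Polynomial ℂ) : PowerSeries.coeff 1 (lin μ h) = 1 := by
  rw [coeff_lin μ h 0 1 (by omega), linP]; simp

lemma X_dvd_lin (μ : ℂ) (h : Polynomial ℂ) : PowerSeries.X ∣ lin μ h := by
  rw [PowerSeries.X_dvd_iff, ← PowerSeries.coeff_zero_eq_constantCoeff_apply]; exact lin_zero μ h

lemma X_dvd_linP (μ : ℂ) (h : Polynomial ℂ) (n : ℕ) : PowerSeries.X ∣ linP μ h n := by
  rw [PowerSeries.X_dvd_iff, ← PowerSeries.coeff_zero_eq_constantCoeff_apply,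
    ← coeff_lin μ h n 0 (by omega)]; exact lin_zero μ h

lemma lin_spec_linP (μ : ℂ) (h : Polynomial ℂ) (m : ℕ) :
    PowerSeries.coeff (m+2) (lin μ h) =
      PowerSeries.coeff (m+2) (Polynomial.aeval (linP μ h m) h) / (μ^(m+2) - μ) := by
  rw [coeff_lin μ h (m+1) (m+2) (by omega), linP, map_add, coeff_linP_big _ _ _ _ (by omega)]
  simp [PowerSeries.coeff_X_pow]

lemma lin_spec (μ : ℂ) (h : Polynomial ℂ) (hh : Polynomial.X^2 ∣ h) (m : ℕ) :
    PowerSeries.coeff (m+2) (lin μ h) =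
      PowerSeries.coeff (m+2) (Polynomial.aeval (lin μ h) h) / (μ^(m+2) - μ) := by
  rw [lin_spec_linP]
  congr 1
  have := aeval_congr (k := m+2) h hh (X_dvd_linP μ h m) (X_dvd_lin μ h) (by
    rw [PowerSeries.X_pow_dvd_iff]
    intro i hi
    rw [map_sub, coeff_lin μ h m i (by omega), sub_self])
  rw [PowerSeries.X_pow_dvd_iff] at this
  have := this (m+2) (by omega)
  rw [map_sub, sub_eq_zero] at this
  exact this

/-- nonresonance -/
def NR (μ : ℂ) : Prop := ∀ m : ℕ, μ^(m+2) - μ ≠ 0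

lemma X2_dvd_aeval {φ : PowerSeries ℂ} {h : Polynomial ℂ} (hh : Polynomial.X^2 ∣ h)
    (hφ : PowerSeries.X ∣ φ) : PowerSeries.X^2 ∣ Polynomial.aeval φ h := by
  obtain ⟨g, rfl⟩ := hh
  simp only [map_mul, map_pow, Polynomial.aeval_X]
  exact Dvd.dvd.mul_right (pow_dvd_pow_of_dvd hφ 2) _

lemma coeff_rescale' (μ : ℂ) (φ : PowerSeries ℂ) (n : ℕ) :
    PowerSeries.coeff n (PowerSeries.rescale μ φ) = μ^n * PowerSeries.coeff n φ := by
  rw [PowerSeries.coeff_rescale]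

lemma lin_eq (μ : ℂ) (hμ : NR μ) (h : Polynomial ℂ) (hh : Polynomial.X^2 ∣ h) :
    PowerSeries.rescale μ (lin μ h) = PowerSeries.C μ * lin μ h + Polynomial.aeval (lin μ h) h := by
  have h2 := X2_dvd_aeval hh (X_dvd_lin μ h)
  rw [PowerSeries.X_pow_dvd_iff] at h2
  ext k
  rw [coeff_rescale', map_add, PowerSeries.coeff_C_mul]
  match k with
  | 0 => rw [h2 0 (by norm_num), lin_zero]; simp
  | 1 => rw [h2 1 (by norm_num)]; simp
  | m+2 =>
    have := lin_spec μ h hh m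
    rw [eq_div_iff (hμ m)] at this
    linear_combination this

lemma lin_eq' (μ : ℂ) (hμ : NR μ) (h : Polynomial ℂ) (hh : Polynomial.X^2 ∣ h) :
    PowerSeries.rescale μ (lin μ h) =
      Polynomial.aeval (lin μ h) (Polynomial.C μ * Polynomial.X + h) := by
  rw [lin_eq μ hμ h hh]
  simp only [map_add, map_mul, Polynomial.aeval_X, Polynomial.aeval_C]
  rfl

lemma lin_unique (μ : ℂ) (hμ : NR μ) (h : Polynomial ℂ) (hh : Polynomial.X^2 ∣ h)
    (φ : PowerSeries ℂ) (h0 : PowerSeries.coeff 0 φ = 0) (h1 : PowerSeries.coeff 1 φ = 1)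
    (heq : PowerSeries.rescale μ φ = PowerSeries.C μ * φ + Polynomial.aeval φ h) :
    φ = lin μ h := by
  have hφ : PowerSeries.X ∣ φ := by
    rw [PowerSeries.X_dvd_iff, ← PowerSeries.coeff_zero_eq_constantCoeff_apply]; exact h0
  have key : ∀ k, PowerSeries.X^(k+2) ∣ φ - lin μ h := by
    intro k
    induction k with
    | zero =>
      rw [PowerSeries.X_pow_dvd_iff]
      intro m hm
      interval_cases m
      · rw [map_sub, h0, lin_zero, sub_zero]
      · rw [map_sub, h1, lin_one, sub_self]
    | succ k ih =>
      rw [PowerSeries.X_pow_dvd_iff] at ih ⊢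
      intro m hm
      rcases Nat.lt_succ_iff_lt_or_eq.mp hm with h' | rfl
      · exact ih m h'
      have := aeval_congr h hh hφ (X_dvd_lin μ h) (PowerSeries.X_pow_dvd_iff.mpr ih)
      rw [PowerSeries.X_pow_dvd_iff] at this
      have h3 := this (k+2) (by omega)
      rw [map_sub, sub_eq_zero] at h3
      have e1 := congrArg (PowerSeries.coeff (k+2)) heq
      have e2 := congrArg (PowerSeries.coeff (k+2)) (lin_eq μ hμ h hh)
      simp only [coeff_rescale', map_add, PowerSeries.coeff_C_mul] at e1 e2
      rw [map_sub]
      apply mul_left_cancel₀ (hμ k)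
      linear_combination e1 - e2 + h3
  ext k
  have := key k
  rw [PowerSeries.X_pow_dvd_iff] at this
  have := this k (by omega)
  rwa [map_sub, sub_eq_zero] at this

lemma linear_unique (μ : ℂ) (hμ : NR μ) (u D₁ D₂ Y : PowerSeries ℂ) (hu : PowerSeries.X ∣ u)
    (a0 : PowerSeries.coeff 0 D₁ = PowerSeries.coeff 0 D₂)
    (a1 : PowerSeries.coeff 1 D₁ = PowerSeries.coeff 1 D₂)
    (e1 : PowerSeries.rescale μ D₁ = PowerSeries.C μ * D₁ + u * D₁ + Y)
    (e2 : PowerSeries.rescale μ D₂ = PowerSeries.C μ * D₂ + u * D₂ + Y) : D₁ = D₂ := by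
  have key : ∀ k, PowerSeries.X^(k+2) ∣ D₁ - D₂ := by
    intro k
    induction k with
    | zero =>
      rw [PowerSeries.X_pow_dvd_iff]
      intro m hm
      interval_cases m
      · rw [map_sub, a0, sub_self]
      · rw [map_sub, a1, sub_self]
    | succ k ih =>
      have hh : PowerSeries.X^(k+3) ∣ u * (D₁ - D₂) := by
        rw [pow_succ, mul_comm]; exact mul_dvd_mul hu ih
      rw [PowerSeries.X_pow_dvd_iff] at ih hh ⊢
      intro m hm
      rcases Nat.lt_succ_iff_lt_or_eq.mp hm with h' | rfl
      · exact ih m h'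
      have h3 := hh (k+2) (by omega)
      have e1 := congrArg (PowerSeries.coeff (k+2)) e1
      have e2 := congrArg (PowerSeries.coeff (k+2)) e2
      simp only [coeff_rescale', map_add, PowerSeries.coeff_C_mul] at e1 e2
      rw [mul_sub, map_sub] at h3
      rw [map_sub]
      apply mul_left_cancel₀ (hμ k)
      linear_combination e1 - e2 + h3
  ext k
  have := key k
  rw [PowerSeries.X_pow_dvd_iff] at this
  have := this k (by omega)
  rwa [map_sub, sub_eq_zero] at this

/-! parameter dependence -/

lemma coeff_aeval {φ : PowerSeries ℂ} (hφ : PowerSeries.X ∣ φ) (h : Polynomial ℂ) (k : ℕ) :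
    PowerSeries.coeff k (Polynomial.aeval φ h) =
      ∑ j ∈ Finset.range (k+1), h.coeff j * PowerSeries.coeff k (φ^j) := by
  have hz : ∀ j, k < j → PowerSeries.coeff k (φ^j) = 0 := by
    intro j hj
    have := pow_dvd_pow_of_dvd hφ j
    rw [PowerSeries.X_pow_dvd_iff] at this
    exact this k hj
  have h1 : Polynomial.aeval φ h = ∑ j ∈ Finset.range (max (h.natDegree+1) (k+1)),
      h.coeff j • φ^j := by
    rw [Polynomial.aeval_eq_sum_range' (lt_of_lt_of_le (Nat.lt_succ_self _) (le_max_left _ _))]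
  rw [h1, map_sum]
  symm
  have : ∀ j, PowerSeries.coeff k (h.coeff j • φ^j) = h.coeff j * PowerSeries.coeff k (φ^j) := by
    intro j; simp
  simp only [this]
  apply Finset.sum_subset
  · intro j hj; simp at hj ⊢; right; omega
  · intro j _ hj; simp at hj; rw [hz j (by omega), mul_zero]

section param
variable {T : Type*} (A : Subalgebra ℂ (T → ℂ))

def CF (φ : T → PowerSeries ℂ) : Prop := ∀ k, (fun t => PowerSeries.coeff k (φ t)) ∈ A

variable {A}
lemma CF.mul {φ ψ : T → PowerSeries ℂ} (h1 : CF A φ) (h2 : CF A ψ) :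
    CF A (fun t => φ t * ψ t) := by
  intro k
  have : (fun t => PowerSeries.coeff k (φ t * ψ t)) = ∑ p ∈ Finset.HasAntidiagonal.antidiagonal k,
      (fun t => PowerSeries.coeff p.1 (φ t)) * (fun t => PowerSeries.coeff p.2 (ψ t)) := by
    ext t; simp [PowerSeries.coeff_mul]
  rw [this]
  exact A.sum_mem fun p _ => A.mul_mem (h1 _) (h2 _)

lemma CF.const (φ : PowerSeries ℂ) : CF A (fun _ => φ) := by
  intro k
  exact A.algebraMap_mem (PowerSeries.coeff k φ)

lemma CF.pow {φ : T → PowerSeries ℂ} (h1 : CF A φ) (j : ℕ) : CF A (fun t => φ t ^ j) := by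
  induction j with
  | zero => simpa using CF.const 1
  | succ j ih => simp only [pow_succ]; exact ih.mul h1

lemma CF.aeval {φ : T → PowerSeries ℂ} (h1 : CF A φ) (hX : ∀ t, PowerSeries.X ∣ φ t)
    (h : T → Polynomial ℂ) (hh : ∀ j, (fun t => (h t).coeff j) ∈ A) :
    CF A (fun t => Polynomial.aeval (φ t) (h t)) := by
  intro k
  have : (fun t => PowerSeries.coeff k (Polynomial.aeval (φ t) (h t))) =
      ∑ j ∈ Finset.range (k+1), (fun t => (h t).coeff j) *
        (fun t => PowerSeries.coeff k (φ t ^ j)) := by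
    ext t; rw [coeff_aeval (hX t)]; simp
  rw [this]
  exact A.sum_mem fun p _ => A.mul_mem (hh _) (h1.pow _ _)

lemma CF.linP (μ : T → ℂ) (hμ : ∀ m : ℕ, (fun t => (μ t^(m+2) - μ t)⁻¹) ∈ A)
    (h : T → Polynomial ℂ) (hh : ∀ j, (fun t => (h t).coeff j) ∈ A) (n : ℕ) :
    CF A (fun t => linP (μ t) (h t) n) := by
  induction n with
  | zero => simp only [QL.linP]; exact CF.const _
  | succ n ih =>
    intro k
    have := ih.aeval (fun t => X_dvd_linP _ _ _) h hh (n+2)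
    have e : (fun t => PowerSeries.coeff k (QL.linP (μ t) (h t) (n+1))) =
      (fun t => PowerSeries.coeff k (QL.linP (μ t) (h t) n)) +
      (PowerSeries.coeff k (PowerSeries.X^(n+2) : PowerSeries ℂ)) •
      ((fun t => PowerSeries.coeff (n+2) (Polynomial.aeval (QL.linP (μ t) (h t) n) (h t))) *
        (fun t => (μ t^(n+2) - μ t)⁻¹)) := by
      ext t
      simp only [QL.linP, map_add, PowerSeries.coeff_C_mul, Pi.add_apply, Pi.smul_apply,
        Pi.mul_apply, smul_eq_mul]
      ring
    rw [e]
    exact A.add_mem (ih k) (A.smul_mem (A.mul_mem this (hμ n)) _)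

lemma CF.lin (μ : T → ℂ) (hμ : ∀ m : ℕ, (fun t => (μ t^(m+2) - μ t)⁻¹) ∈ A)
    (h : T → Polynomial ℂ) (hh : ∀ j, (fun t => (h t).coeff j) ∈ A) :
    CF A (fun t => lin (μ t) (h t)) := by
  intro k
  have := CF.linP μ hμ h hh k k
  simpa only [QL.lin, PowerSeries.coeff_mk] using this

end param

/-- differentiable functions as a subalgebra -/
def diffAlg : Subalgebra ℂ (ℂ → ℂ) where
  carrier := {g | Differentiable ℂ g}
  mul_mem' := fun ha hb => Differentiable.mul ha hb
  add_mem' := fun ha hb => Differentiable.add ha hb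
  algebraMap_mem' := fun r => differentiable_const r

/-- functions continuous at a point -/
def contAlg (x : ℝ) : Subalgebra ℂ (ℝ → ℂ) where
  carrier := {g | ContinuousAt g x}
  mul_mem' := fun ha hb => ContinuousAt.mul ha hb
  add_mem' := fun ha hb => ContinuousAt.add ha hb
  algebraMap_mem' := fun r => (continuous_const (y := r)).continuousAt

/-! coefficientwise derivative at zero -/
def HD (φ : ℂ → PowerSeries ℂ) (D : PowerSeries ℂ) : Prop :=
  ∀ k, HasDerivAt (fun t => PowerSeries.coeff k (φ t)) (PowerSeries.coeff k D) 0

lemma HD.mul {φ ψ D E} (h1 : HD φ D) (h2 : HD ψ E) :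
    HD (fun t => φ t * ψ t) (D * ψ 0 + φ 0 * E) := by
  intro k
  simp only [PowerSeries.coeff_mul, map_add]
  rw [← Finset.sum_add_distrib]
  apply HasDerivAt.fun_sum
  intro p _
  exact (h1 _).mul (h2 _)

lemma HD.const (φ : PowerSeries ℂ) : HD (fun _ => φ) 0 := by
  intro k
  simpa using hasDerivAt_const (0:ℂ) (PowerSeries.coeff k φ)

lemma HD.add {φ ψ D E} (h1 : HD φ D) (h2 : HD ψ E) :
    HD (fun t => φ t + ψ t) (D + E) := by
  intro k
  simp only [map_add]
  exact (h1 k).add (h2 k)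

lemma HD.aeval {φ D} (h1 : HD φ D) (h : Polynomial ℂ) :
    HD (fun t => Polynomial.aeval (φ t) h) (Polynomial.aeval (φ 0) h.derivative * D) := by
  induction h using Polynomial.induction_on' with
  | add p q hp hq =>
    simp only [map_add, add_mul]
    exact hp.add hq
  | monomial n a =>
    induction n generalizing a with
    | zero => simpa using HD.const _
    | succ n ih =>
      have := (ih a).mul h1
      have e : ∀ ψ : PowerSeries ℂ, Polynomial.aeval ψ (Polynomial.monomial (n+1) a) =
        Polynomial.aeval ψ (Polynomial.monomial n a) * ψ := by
        intro ψ; simp [Polynomial.aeval_monomial, pow_succ, mul_assoc]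
      simp only [e]
      convert this using 1
      have : (Polynomial.monomial (n+1) a) = Polynomial.monomial n a * Polynomial.X := by
        simp [Polynomial.monomial_mul_X]
      rw [this, Polynomial.derivative_mul]
      simp
      ring

lemma HD.unique {φ D E} (h1 : HD φ D) (h2 : HD φ E) : D = E := by
  ext k; exact (h1 k).unique (h2 k)

lemma HD.rescale {φ D} (h1 : HD φ D) (μ : ℂ) :
    HD (fun t => PowerSeries.rescale μ (φ t)) (PowerSeries.rescale μ D) := by
  intro k
  simp only [coeff_rescale']
  exact (h1 k).const_mul _

/-- derivative of the linearization -/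
noncomputable def dlin (μ : ℂ) (h Y : Polynomial ℂ) : PowerSeries ℂ :=
  PowerSeries.mk fun k => deriv (fun t : ℂ => PowerSeries.coeff k (lin μ (h + Polynomial.C t * Y))) 0

lemma lin_diff (μ : ℂ) (h Y : Polynomial ℂ) (k : ℕ) :
    Differentiable ℂ (fun t : ℂ => PowerSeries.coeff k (lin μ (h + Polynomial.C t * Y))) := by
  have := CF.lin (A := diffAlg) (fun _ => μ) (fun m => diffAlg.algebraMap_mem _)
    (fun t : ℂ => h + Polynomial.C t * Y) (fun j => by
      show Differentiable ℂ _
      simp only [Polynomial.coeff_add, Polynomial.coeff_C_mul]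
      fun_prop)
  exact this k

lemma dlin_eq (μ : ℂ) (hμ : NR μ) (h Y : Polynomial ℂ) (hh : Polynomial.X^2 ∣ h)
    (hY : Polynomial.X^2 ∣ Y) :
    PowerSeries.rescale μ (dlin μ h Y) = PowerSeries.C μ * dlin μ h Y +
      Polynomial.aeval (lin μ h) h.derivative * dlin μ h Y + Polynomial.aeval (lin μ h) Y := by
  have hD : HD (fun t => lin μ (h + Polynomial.C t * Y)) (dlin μ h Y) := by
    intro k
    rw [dlin, PowerSeries.coeff_mk]
    exact (lin_diff μ h Y k 0).hasDerivAt
  have e0 : lin μ (h + Polynomial.C (0:ℂ) * Y) = lin μ h := by simp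
  have ht : HD (fun t => PowerSeries.C t) (1 : PowerSeries ℂ) := by
    intro k
    simp only [PowerSeries.coeff_C, PowerSeries.coeff_one]
    split_ifs
    · exact hasDerivAt_id 0
    · exact hasDerivAt_const _ _
  have h1 := ((HD.const (PowerSeries.C μ)).mul hD).add
    ((hD.aeval h).add (ht.mul (hD.aeval Y)))
  have h2 := hD.rescale μ
  have e : (fun t => PowerSeries.rescale μ (lin μ (h + Polynomial.C t * Y))) = 
    fun t => (PowerSeries.C μ * lin μ (h + Polynomial.C t * Y) +
      (Polynomial.aeval (lin μ (h + Polynomial.C t * Y)) h + PowerSeries.C t * 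
        Polynomial.aeval (lin μ (h + Polynomial.C t * Y)) Y)) := by
    ext1 t
    rw [lin_eq μ hμ _ (dvd_add hh (Dvd.dvd.mul_left hY _))]
    congr 1
    rw [map_add, map_mul, Polynomial.aeval_C]
    rfl
  rw [e] at h2
  rw [h2.unique h1]
  simp only [e0]
  simp
  ring

lemma dlin_coeff0 (μ : ℂ) (h Y : Polynomial ℂ) : PowerSeries.coeff 0 (dlin μ h Y) = 0 := by
  rw [dlin, PowerSeries.coeff_mk]
  simp only [lin_zero]; simp

lemma dlin_coeff1 (μ : ℂ) (h Y : Polynomial ℂ) : PowerSeries.coeff 1 (dlin μ h Y) = 0 := by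
  rw [dlin, PowerSeries.coeff_mk]
  simp only [lin_one]; simp

lemma X_dvd_aeval_deriv (μ : ℂ) (h : Polynomial ℂ) (hh : Polynomial.X^2 ∣ h) :
    PowerSeries.X ∣ Polynomial.aeval (lin μ h) h.derivative := by
  obtain ⟨g, rfl⟩ := hh
  rw [Polynomial.derivative_mul]
  simp only [Polynomial.derivative_X_pow, map_add, map_mul, map_pow, Polynomial.aeval_X]
  apply dvd_add
  · apply Dvd.dvd.mul_right
    apply Dvd.dvd.mul_left
    simpa using X_dvd_lin μ _
  · apply Dvd.dvd.mul_right
    exact dvd_pow (X_dvd_lin μ _) (by norm_num)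

lemma dlin_unique (μ : ℂ) (hμ : NR μ) (h Y : Polynomial ℂ) (hh : Polynomial.X^2 ∣ h)
    (hY : Polynomial.X^2 ∣ Y) (D : PowerSeries ℂ) (h0 : PowerSeries.coeff 0 D = 0)
    (h1 : PowerSeries.coeff 1 D = 0)
    (e : PowerSeries.rescale μ D = PowerSeries.C μ * D +
      Polynomial.aeval (lin μ h) h.derivative * D + Polynomial.aeval (lin μ h) Y) :
    D = dlin μ h Y := by
  apply linear_unique μ hμ _ _ _ _ (X_dvd_aeval_deriv μ h hh) _ _ e (dlin_eq μ hμ h Y hh hY)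
  · rw [h0, dlin_coeff0]
  · rw [h1, dlin_coeff1]

lemma dlin_add (μ : ℂ) (hμ : NR μ) (h Y Z : Polynomial ℂ) (hh : Polynomial.X^2 ∣ h)
    (hY : Polynomial.X^2 ∣ Y) (hZ : Polynomial.X^2 ∣ Z) :
    dlin μ h (Y + Z) = dlin μ h Y + dlin μ h Z := by
  symm
  apply dlin_unique μ hμ _ _ hh (dvd_add hY hZ)
  · rw [map_add, dlin_coeff0, dlin_coeff0, add_zero]
  · rw [map_add, dlin_coeff1, dlin_coeff1, add_zero]
  · rw [map_add, map_add, dlin_eq μ hμ h Y hh hY, dlin_eq μ hμ h Z hh hZ]; ring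

lemma dlin_smul (μ : ℂ) (hμ : NR μ) (h Y : Polynomial ℂ) (c : ℂ) (hh : Polynomial.X^2 ∣ h)
    (hY : Polynomial.X^2 ∣ Y) :
    dlin μ h (Polynomial.C c * Y) = PowerSeries.C c * dlin μ h Y := by
  symm
  apply dlin_unique μ hμ _ _ hh (Dvd.dvd.mul_left hY _)
  · rw [PowerSeries.coeff_C_mul, dlin_coeff0, mul_zero]
  · rw [PowerSeries.coeff_C_mul, dlin_coeff1, mul_zero]
  · rw [map_mul, dlin_eq μ hμ h Y hh hY, map_mul, Polynomial.aeval_C]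
    have : PowerSeries.rescale μ (PowerSeries.C c) = PowerSeries.C c := by
      ext k; rw [coeff_rescale', PowerSeries.coeff_C]; split_ifs with hk
      · subst hk; simp
      · simp
    rw [this]
    have : (algebraMap ℂ (PowerSeries ℂ)) c = PowerSeries.C c := rfl
    rw [this]
    ring

lemma rescale_C (μ c : ℂ) : PowerSeries.rescale μ (PowerSeries.C c) = PowerSeries.C c := by
  ext k; rw [coeff_rescale', PowerSeries.coeff_C]; split_ifs with hk
  · subst hk; simp
  · simp

lemma rescale_aeval (μ : ℂ) (φ : PowerSeries ℂ) (Y : Polynomial ℂ) :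
    PowerSeries.rescale μ (Polynomial.aeval φ Y) =
      Polynomial.aeval (PowerSeries.rescale μ φ) Y := by
  induction Y using Polynomial.induction_on' with
  | add p q hp hq => rw [map_add, map_add, hp, hq, map_add]
  | monomial n a =>
    rw [Polynomial.aeval_monomial, Polynomial.aeval_monomial, map_mul, map_pow]
    congr 1
    exact rescale_C μ a

/-- key identity: `L(Y∘f - f' Y) = M(Y)` -/
lemma dlin_comp (μ : ℂ) (hμ : NR μ) (h Y : Polynomial ℂ) (hh : Polynomial.X^2 ∣ h)
    (hY : Polynomial.X^2 ∣ Y) :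
    dlin μ h (Y.comp (Polynomial.C μ * Polynomial.X + h) -
      (Polynomial.C μ * Polynomial.X + h).derivative * Y) = Polynomial.aeval (lin μ h) Y := by
  have h2 := X2_dvd_aeval hY (X_dvd_lin μ h)
  rw [PowerSeries.X_pow_dvd_iff] at h2
  symm
  apply dlin_unique μ hμ _ _ hh
  · apply dvd_sub
    · obtain ⟨g, rfl⟩ := hY
      rw [Polynomial.mul_comp, Polynomial.X_pow_comp]
      apply Dvd.dvd.mul_right
      apply pow_dvd_pow_of_dvd
      apply dvd_add (Dvd.intro_left _ rfl)
      exact (Dvd.intro_left (Polynomial.X) (by ring)).trans hh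
    · exact Dvd.dvd.mul_left hY _
  · exact h2 0 (by norm_num)
  · exact h2 1 (by norm_num)
  · have e := lin_eq' μ hμ h hh
    rw [rescale_aeval, e, map_sub, map_mul, Polynomial.aeval_comp]
    simp
    ring

lemma dlin_order (μ : ℂ) (hμ : NR μ) (h Y : Polynomial ℂ) (m : ℕ) (hh : Polynomial.X^2 ∣ h)
    (hY : Polynomial.X^(m+2) ∣ Y) : PowerSeries.X^(m+2) ∣ dlin μ h Y ∧
    (μ^(m+2) - μ) * PowerSeries.coeff (m+2) (dlin μ h Y) =
      PowerSeries.coeff (m+2) (Polynomial.aeval (lin μ h) Y) := by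
  have hY2 : Polynomial.X^2 ∣ Y := (pow_dvd_pow _ (by omega)).trans hY
  have hYs : PowerSeries.X^(m+2) ∣ Polynomial.aeval (lin μ h) Y := by
    obtain ⟨g, rfl⟩ := hY
    simp only [map_mul, map_pow, Polynomial.aeval_X]
    exact Dvd.dvd.mul_right (pow_dvd_pow_of_dvd (X_dvd_lin μ h) _) _
  rw [PowerSeries.X_pow_dvd_iff] at hYs
  have he := dlin_eq μ hμ h Y hh hY2
  have step : ∀ k, PowerSeries.X^(k+2) ∣ dlin μ h Y →
      (μ^(k+2) - μ) * PowerSeries.coeff (k+2) (dlin μ h Y) =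
      PowerSeries.coeff (k+2) (Polynomial.aeval (lin μ h) Y) := by
    intro k hk
    have h1 : PowerSeries.X^(k+3) ∣ Polynomial.aeval (lin μ h) h.derivative * dlin μ h Y := by
      rw [pow_succ, mul_comm]; exact mul_dvd_mul (X_dvd_aeval_deriv μ h hh) hk
    rw [PowerSeries.X_pow_dvd_iff] at h1
    have h2 := h1 (k+2) (by omega)
    have e1 := congrArg (PowerSeries.coeff (k+2)) he
    simp only [coeff_rescale', map_add, PowerSeries.coeff_C_mul, h2] at e1
    linear_combination e1
  have key : ∀ k, k ≤ m → PowerSeries.X^(k+2) ∣ dlin μ h Y := by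
    intro k
    induction k with
    | zero =>
      intro _
      rw [PowerSeries.X_pow_dvd_iff]
      intro i hi
      interval_cases i
      · exact dlin_coeff0 μ h Y
      · exact dlin_coeff1 μ h Y
    | succ k ih =>
      intro hk
      have h1 := ih (by omega)
      have h2 := step k h1
      rw [hYs (k+2) (by omega)] at h2
      rw [PowerSeries.X_pow_dvd_iff] at h1 ⊢
      intro i hi
      rcases Nat.lt_succ_iff_lt_or_eq.mp hi with h' | rfl
      · exact h1 i h'
      · exact (mul_eq_zero.mp h2).resolve_left (hμ k)
  exact ⟨key m le_rfl, step m (key m le_rfl)⟩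

lemma coeff_pow_self {φ : PowerSeries ℂ} (h0 : PowerSeries.X ∣ φ)
    (h1 : PowerSeries.coeff 1 φ = 1) (n : ℕ) : PowerSeries.coeff n (φ^n) = 1 := by
  obtain ⟨g, rfl⟩ := h0
  rw [mul_pow, PowerSeries.coeff_X_pow_mul', if_pos le_rfl, Nat.sub_self,
    PowerSeries.coeff_zero_eq_constantCoeff_apply, map_pow]
  have : PowerSeries.coeff 1 (PowerSeries.X * g) = PowerSeries.constantCoeff g := by
    rw [show (1:ℕ) = 0 + 1 from rfl, PowerSeries.coeff_succ_X_mul,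
      PowerSeries.coeff_zero_eq_constantCoeff_apply]
  rw [← this, h1, one_pow]
end QL

namespace QL

/-- `F` has convergent power series `c` at zero. -/
def HT (F : ℂ → ℂ) (c : ℕ → ℂ) : Prop :=
  ∀ᶠ z in nhds (0:ℂ), HasSum (fun k => c k * z^k) (F z)

lemma HT.hasF {F : ℂ → ℂ} {c : ℕ → ℂ} (h : HT F c) :
    HasFPowerSeriesAt F (FormalMultilinearSeries.ofScalars ℂ c) 0 := by
  rw [hasFPowerSeriesAt_iff]
  filter_upwards [h] with z hz
  simpa [FormalMultilinearSeries.coeff_ofScalars, mul_comm] using hz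

lemma HT.unique {F : ℂ → ℂ} {c d : ℕ → ℂ} (h : HT F c) (h' : HT F d) : c = d := by
  have := h.hasF.eq_formalMultilinearSeries h'.hasF
  ext k
  have h2 := congrArg (fun p => FormalMultilinearSeries.coeff p k) this
  simpa [FormalMultilinearSeries.coeff_ofScalars] using h2

noncomputable def tc (F : ℂ → ℂ) (k : ℕ) : ℂ := iteratedDeriv k F 0 / (k.factorial : ℂ)

lemma ht_tc {F : ℂ → ℂ} (h : AnalyticAt ℂ F 0) : HT F (tc F) := by
  have := h.hasFPowerSeriesAt
  rw [hasFPowerSeriesAt_iff] at this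
  filter_upwards [this] with z hz
  simpa [FormalMultilinearSeries.coeff_ofScalars, mul_comm, tc] using hz

lemma HT.tc_eq {F : ℂ → ℂ} {c : ℕ → ℂ} (h : HT F c) : tc F = c :=
  (ht_tc h.hasF.analyticAt).unique h

lemma HT.add {F G : ℂ → ℂ} {c d : ℕ → ℂ} (h : HT F c) (h' : HT G d) :
    HT (fun z => F z + G z) (fun k => c k + d k) := by
  filter_upwards [h, h'] with z h1 h2
  simpa [add_mul] using h1.add h2

lemma HT.sub {F G : ℂ → ℂ} {c d : ℕ → ℂ} (h : HT F c) (h' : HT G d) :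
    HT (fun z => F z - G z) (fun k => c k - d k) := by
  filter_upwards [h, h'] with z h1 h2
  simpa [sub_mul] using h1.sub h2

lemma HT.cmul {F : ℂ → ℂ} {c : ℕ → ℂ} (h : HT F c) (a : ℂ) :
    HT (fun z => a * F z) (fun k => a * c k) := by
  filter_upwards [h] with z h1
  simpa [mul_assoc] using h1.mul_left a

lemma HT.shift {F : ℂ → ℂ} {c : ℕ → ℂ} (h : HT F c) (m : ℕ) :
    HT (fun z => z^m * F z) (fun k => if k < m then 0 else c (k - m)) := by
  filter_upwards [h] with z h1
  have h2 := h1.mul_left (z^m)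
  have h3 := (hasSum_nat_add_iff (f := fun k => (if k < m then 0 else c (k - m)) * z^k)
    (g := z^m * F z) m).mp (by
      refine Eq.mp (congrArg (fun u => HasSum u _) (funext fun k => ?_)) h2
      rw [if_neg (by omega), Nat.add_sub_cancel, pow_add]; ring)
  rw [Finset.sum_eq_zero (fun i hi => by rw [if_pos (Finset.mem_range.mp hi), zero_mul]),
    add_zero] at h3
  exact h3

lemma HT.poly (p : Polynomial ℂ) : HT (fun z => p.eval z) (fun k => p.coeff k) := by
  refine Eventually.of_forall fun z => ?_
  simp only [Polynomial.eval_eq_sum_range]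
  apply hasSum_sum_of_ne_finset_zero
  intro k hk
  rw [Polynomial.coeff_eq_zero_of_natDegree_lt (by simpa using hk), zero_mul]

lemma tc_poly (p : Polynomial ℂ) (k : ℕ) : tc (fun z => p.eval z) k = p.coeff k := by
  rw [(HT.poly p).tc_eq]

lemma analytic_poly (p : Polynomial ℂ) (x : ℂ) : AnalyticAt ℂ (fun z => p.eval z) x :=
  p.differentiable.analyticAt x

lemma tc_add {F G : ℂ → ℂ} (h : AnalyticAt ℂ F 0) (h' : AnalyticAt ℂ G 0) (k : ℕ) :
    tc (fun z => F z + G z) k = tc F k + tc G k := by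
  rw [((ht_tc h).add (ht_tc h')).tc_eq]

lemma tc_sub {F G : ℂ → ℂ} (h : AnalyticAt ℂ F 0) (h' : AnalyticAt ℂ G 0) (k : ℕ) :
    tc (fun z => F z - G z) k = tc F k - tc G k := by
  rw [((ht_tc h).sub (ht_tc h')).tc_eq]

lemma tc_cmul {F : ℂ → ℂ} (h : AnalyticAt ℂ F 0) (a : ℂ) (k : ℕ) :
    tc (fun z => a * F z) k = a * tc F k := by
  rw [((ht_tc h).cmul a).tc_eq]

lemma tc_shift {F : ℂ → ℂ} (h : AnalyticAt ℂ F 0) {k m : ℕ} (hk : k < m) :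
    tc (fun z => z^m * F z) k = 0 := by
  rw [((ht_tc h).shift m).tc_eq]; simp [hk]

lemma tc_congr {F G : ℂ → ℂ} (h : F =ᶠ[nhds 0] G) : tc F = tc G := by
  ext k; rw [tc, tc, h.iteratedDeriv_eq]

lemma tc_norm_le {F : ℂ → ℂ} {R C : ℝ} (hR : 0 < R) (hF : DiffContOnCl ℂ F (Metric.ball 0 R))
    (hC : ∀ z ∈ Metric.sphere (0:ℂ) R, ‖F z‖ ≤ C) (k : ℕ) : ‖tc F k‖ ≤ C / R^k := by
  have := Complex.norm_iteratedDeriv_le_of_forall_mem_sphere_norm_le k hR hF hC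
  have hk : (0:ℝ) < k.factorial := by exact_mod_cast Nat.factorial_pos k
  rw [tc, norm_div, Complex.norm_natCast, div_le_iff₀ hk]
  calc _ ≤ _ := this
    _ = _ := by ring

/-- version on the open ball -/
lemma tc_norm_le' {F : ℂ → ℂ} {R C : ℝ} (hR : 0 < R) (hF : DifferentiableOn ℂ F (Metric.ball 0 R))
    (hC : ∀ z ∈ Metric.ball (0:ℂ) R, ‖F z‖ ≤ C) (k : ℕ) : ‖tc F k‖ ≤ C / R^k := by
  have key : ∀ r ∈ Set.Ioo 0 R, ‖tc F k‖ * r^k ≤ C := by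
    intro r hr
    rw [← le_div_iff₀ (pow_pos hr.1 k)]
    refine tc_norm_le hr.1 ?_ ?_ k
    · apply DifferentiableOn.diffContOnCl
      rw [closure_ball _ hr.1.ne']
      exact hF.mono (Metric.closedBall_subset_ball hr.2)
    · intro z hz
      apply hC
      rw [mem_ball_zero_iff, mem_sphere_zero_iff_norm.mp hz]; exact hr.2
  rw [le_div_iff₀ (pow_pos hR k)]
  have hc : Tendsto (fun r : ℝ => ‖tc F k‖ * r^k) (nhdsWithin R (Set.Iio R))
      (nhds (‖tc F k‖ * R^k)) := by
    apply Tendsto.mono_left _ nhdsWithin_le_nhds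
    apply Continuous.tendsto; fun_prop
  apply le_of_tendsto hc
  filter_upwards [Ioo_mem_nhdsLT hR] with r hr using key r hr

lemma poly_coeff_le (p : Polynomial ℂ) {R C : ℝ} (hR : 0 < R)
    (hC : ∀ z ∈ Metric.sphere (0:ℂ) R, ‖p.eval z‖ ≤ C) (k : ℕ) : ‖p.coeff k‖ ≤ C / R^k := by
  rw [← tc_poly]
  exact tc_norm_le hR p.differentiable.diffContOnCl hC k

lemma tc_hasSum {F : ℂ → ℂ} {R : ℝ} (hF : DifferentiableOn ℂ F (Metric.ball 0 R)) {z : ℂ}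
    (hz : ‖z‖ < R) : HasSum (fun k => tc F k * z^k) (F z) := by
  have := Complex.hasSum_taylorSeries_on_ball hF (z := z) (by simpa using hz)
  refine Eq.mp (congrArg (fun u => HasSum u _) (funext fun k => ?_)) this
  simp only [tc, smul_eq_mul, sub_zero]; ring

/-! evaluation of formal series -/
def AS (ψ : PowerSeries ℂ) (r : ℝ) : Prop := Summable fun k => ‖PowerSeries.coeff k ψ‖ * r^k

noncomputable def ev (ψ : PowerSeries ℂ) (z : ℂ) : ℂ := ∑' k, PowerSeries.coeff k ψ * z^k

lemma AS.norm {ψ : PowerSeries ℂ} {r : ℝ} (h : AS ψ r) {z : ℂ} (hz : ‖z‖ ≤ r) :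
    Summable fun k => ‖PowerSeries.coeff k ψ * z^k‖ := by
  apply Summable.of_nonneg_of_le (fun _ => norm_nonneg _) _ h
  intro k
  rw [norm_mul, norm_pow]
  gcongr

lemma AS.mono {ψ : PowerSeries ℂ} {r s : ℝ} (h : AS ψ r) (hs : 0 ≤ s) (hsr : s ≤ r) : AS ψ s := by
  apply Summable.of_nonneg_of_le (fun _ => by positivity) _ h
  intro k
  gcongr

lemma AS.of_norm {ψ : PowerSeries ℂ} {r : ℝ} (hr : 0 ≤ r)
    (h : Summable fun k => ‖PowerSeries.coeff k ψ * (r:ℂ)^k‖) : AS ψ r := by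
  simpa [AS, norm_mul, norm_pow, abs_of_nonneg hr] using h

lemma AS.hasSum {ψ : PowerSeries ℂ} {r : ℝ} (h : AS ψ r) {z : ℂ} (hz : ‖z‖ ≤ r) :
    HasSum (fun k => PowerSeries.coeff k ψ * z^k) (ev ψ z) :=
  (h.norm hz).of_norm.hasSum

lemma coeff_mul_term (φ ψ : PowerSeries ℂ) (z : ℂ) (n : ℕ) :
    PowerSeries.coeff n (φ * ψ) * z^n = ∑ kl ∈ Finset.HasAntidiagonal.antidiagonal n,
      (PowerSeries.coeff kl.1 φ * z^kl.1) * (PowerSeries.coeff kl.2 ψ * z^kl.2) := by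
  rw [PowerSeries.coeff_mul, Finset.sum_mul]
  apply Finset.sum_congr rfl
  intro p hp
  rw [← Finset.HasAntidiagonal.mem_antidiagonal.mp hp, pow_add]; ring

lemma AS.mul {φ ψ : PowerSeries ℂ} {r : ℝ} (hr : 0 ≤ r) (h1 : AS φ r) (h2 : AS ψ r) :
    AS (φ * ψ) r := by
  apply AS.of_norm hr
  have hz : ‖(r:ℂ)‖ ≤ r := by simp [abs_of_nonneg hr]
  have := summable_norm_sum_mul_antidiagonal_of_summable_norm (h1.norm hz) (h2.norm hz)
  refine this.congr fun n => ?_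
  rw [coeff_mul_term]

lemma ev_mul {φ ψ : PowerSeries ℂ} {r : ℝ} (h1 : AS φ r) (h2 : AS ψ r) {z : ℂ}
    (hz : ‖z‖ ≤ r) : ev (φ * ψ) z = ev φ z * ev ψ z := by
  rw [ev, ev, ev, tsum_mul_tsum_eq_tsum_sum_antidiagonal_of_summable_norm (h1.norm hz) (h2.norm hz)]
  simp only [coeff_mul_term]

lemma AS.add {φ ψ : PowerSeries ℂ} {r : ℝ} (hr : 0 ≤ r) (h1 : AS φ r) (h2 : AS ψ r) :
    AS (φ + ψ) r := by
  apply Summable.of_nonneg_of_le (fun _ => by positivity) _ (Summable.add h1 h2)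
  intro k
  rw [map_add, ← add_mul]
  gcongr
  exact norm_add_le _ _

lemma ev_add {φ ψ : PowerSeries ℂ} {r : ℝ} (h1 : AS φ r) (h2 : AS ψ r) {z : ℂ}
    (hz : ‖z‖ ≤ r) : ev (φ + ψ) z = ev φ z + ev ψ z := by
  rw [ev, ev, ev, ← (h1.norm hz).of_norm.tsum_add (h2.norm hz).of_norm]
  simp only [map_add, add_mul]

lemma AS.C (c : ℂ) (r : ℝ) : AS (PowerSeries.C c) r := by
  apply summable_of_ne_finset_zero (s := {0})
  intro k hk
  rw [PowerSeries.coeff_C, if_neg (by simpa using hk)]; simp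

lemma ev_C (c z : ℂ) : ev (PowerSeries.C c) z = c := by
  rw [ev, tsum_eq_single 0]
  · simp
  · intro k hk
    rw [PowerSeries.coeff_C, if_neg hk]; simp

lemma AS_ev_aeval {ψ : PowerSeries ℂ} {r : ℝ} (hr : 0 ≤ r) (h : AS ψ r) (f : Polynomial ℂ) :
    AS (Polynomial.aeval ψ f) r ∧ ∀ z : ℂ, ‖z‖ ≤ r → ev (Polynomial.aeval ψ f) z = f.eval (ev ψ z) := by
  induction f using Polynomial.induction_on with
  | C a =>
    rw [Polynomial.aeval_C]
    refine ⟨AS.C a r, fun z _ => ?_⟩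
    rw [Polynomial.eval_C]; exact ev_C a z
  | add p q hp hq =>
    rw [map_add]
    refine ⟨hp.1.add hr hq.1, fun z hz => ?_⟩
    rw [ev_add hp.1 hq.1 hz, hp.2 z hz, hq.2 z hz, Polynomial.eval_add]
  | monomial n a ih =>
    rw [pow_succ, ← mul_assoc, map_mul, Polynomial.aeval_X]
    refine ⟨ih.1.mul hr h, fun z hz => ?_⟩
    rw [ev_mul ih.1 h hz, ih.2 z hz, Polynomial.eval_mul_X]

lemma ev_rescale (ψ : PowerSeries ℂ) (μ z : ℂ) : ev (PowerSeries.rescale μ ψ) z = ev ψ (μ * z) := by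
  rw [ev, ev]
  congr 1; ext k
  rw [coeff_rescale', mul_pow]; ring

lemma lin_func (μ : ℂ) (hμ : NR μ) (h : Polynomial ℂ) (hh : Polynomial.X^2 ∣ h) {r : ℝ}
    (hr : 0 ≤ r) (hA : AS (lin μ h) r) {z : ℂ} (hz : ‖z‖ ≤ r) :
    ev (lin μ h) (μ * z) = (Polynomial.C μ * Polynomial.X + h).eval (ev (lin μ h) z) := by
  rw [← ev_rescale, lin_eq' μ hμ h hh, (AS_ev_aeval hr hA _).2 z hz]

lemma ev_zero (ψ : PowerSeries ℂ) : ev ψ 0 = PowerSeries.coeff 0 ψ := by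
  rw [ev, tsum_eq_single 0]
  · simp
  · intro k hk; simp [hk]

lemma AS.ht {ψ : PowerSeries ℂ} {r : ℝ} (hr : 0 < r) (h : AS ψ r) :
    HT (ev ψ) (fun k => PowerSeries.coeff k ψ) := by
  filter_upwards [Metric.ball_mem_nhds (0:ℂ) hr] with z hz
  exact h.hasSum (by simpa using (mem_ball_zero_iff.mp hz).le)

lemma AS_of_holo {ψ : PowerSeries ℂ} {F : ℂ → ℂ} {R : ℝ}
    (hF : DifferentiableOn ℂ F (Metric.ball 0 R)) (hc : ∀ k, tc F k = PowerSeries.coeff k ψ) {r : ℝ}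
    (hr : 0 ≤ r) (hrR : r < R) : AS ψ r := by
  obtain ⟨s, hrs, hsR⟩ := exists_between hrR
  have hs : 0 < s := lt_of_le_of_lt hr hrs
  have hsum := (tc_hasSum hF (z := (s:ℂ)) (by simpa [abs_of_pos hs] using hsR)).summable
  obtain ⟨C, hC⟩ := hsum.tendsto_atTop_zero.norm.bddAbove_range
  have hb : ∀ k, ‖PowerSeries.coeff k ψ‖ * s^k ≤ C := by
    intro k
    have := hC ⟨k, rfl⟩
    simp only at this
    rwa [norm_mul, norm_pow, Complex.norm_real, Real.norm_eq_abs, abs_of_pos hs, hc] at this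
  apply Summable.of_nonneg_of_le (fun k => by positivity) (fun k => ?_)
    ((summable_geometric_of_lt_one (by positivity : 0 ≤ r/s) ((div_lt_one hs).mpr hrs)).mul_left C)
  calc ‖PowerSeries.coeff k ψ‖ * r^k = (‖PowerSeries.coeff k ψ‖ * s^k) * (r/s)^k := by
        rw [div_pow]; field_simp
    _ ≤ C * (r/s)^k := by gcongr; exact hb k

lemma AS_of_bound {ψ : PowerSeries ℂ} {C r : ℝ} (hC : 0 < C)
    (hb : ∀ k, ‖PowerSeries.coeff k ψ‖ ≤ C^k) (hr : 0 ≤ r) (hrC : r * C < 1) : AS ψ r := by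
  apply Summable.of_nonneg_of_le (fun k => by positivity) (fun k => ?_)
    (summable_geometric_of_lt_one (by positivity) hrC)
  calc ‖PowerSeries.coeff k ψ‖ * r^k ≤ C^k * r^k := by gcongr; exact hb k
    _ = _ := by rw [mul_pow, mul_comm]

lemma ev_differentiableOn {ψ : PowerSeries ℂ} {R : ℝ} (h : ∀ r, 0 ≤ r → r < R → AS ψ r) :
    DifferentiableOn ℂ (ev ψ) (Metric.ball 0 R) := by
  intro z hz
  have hz' : ‖z‖ < R := by simpa using hz
  obtain ⟨s, hzs, hsR⟩ := exists_between hz'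
  have hs : 0 < s := lt_of_le_of_lt (norm_nonneg z) hzs
  have hd : DifferentiableOn ℂ (ev ψ) (Metric.ball 0 s) := by
    apply Complex.differentiableOn_tsum_of_summable_norm (u := fun k => ‖PowerSeries.coeff k ψ‖ * s^k)
      (h s hs.le hsR) (fun k => by fun_prop) Metric.isOpen_ball
    intro k w hw
    rw [norm_mul, norm_pow]
    have : ‖w‖ < s := by simpa using hw
    gcongr
  exact (hd.differentiableAt (Metric.isOpen_ball.mem_nhds (by simpa using hzs))).differentiableWithinAt
end QL

namespace QL

lemma gauss_mem {α : ℝ} (hα : α ∈ IrrN 2) (n : ℕ) :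
    gaussIter α n ∈ Set.Ioo (0:ℝ) 1 ∧ Irrational (gaussIter α n) := by
  induction n with
  | zero => exact ⟨hα.1, hα.2.1⟩
  | succ n ih =>
    have hi : Irrational (1 / gaussIter α n) := by
      rw [one_div]; exact ih.2.inv
    have hf : Irrational (Int.fract (1 / gaussIter α n)) := by
      rw [Int.fract]; exact hi.sub_intCast _
    refine ⟨⟨?_, Int.fract_lt_one _⟩, hf⟩
    rcases (Int.fract_nonneg (1 / gaussIter α n)).lt_or_eq with h | h
    · exact h
    · exfalso; apply hf.ne_zero; exact h.symm

noncomputable def cfp (α : ℝ) : ℕ → ℤ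
  | 0 => 0
  | 1 => 1
  | n + 2 => cfa α (n + 1) * cfp α (n + 1) + cfp α n

noncomputable def cfb (α : ℝ) : ℕ → ℝ
  | 0 => α
  | n + 1 => cfb α n * gaussIter α (n+1)

lemma gauss_succ {α : ℝ} (hα : α ∈ IrrN 2) (n : ℕ) :
    gaussIter α n * gaussIter α (n+1) = 1 - cfa α n * gaussIter α n := by
  have h := (gauss_mem hα n).1.1
  rw [gaussIter, Int.fract, cfa]
  field_simp

lemma cfb_rec {α : ℝ} (hα : α ∈ IrrN 2) (n : ℕ) :
    cfb α (n+2) = cfb α n - cfa α (n+1) * cfb α (n+1) := by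
  have := gauss_succ hα (n+1)
  rw [cfb, cfb]
  linear_combination (cfb α n) * this

lemma cfb_pos {α : ℝ} (hα : α ∈ IrrN 2) (n : ℕ) : 0 < cfb α n := by
  induction n with
  | zero => exact hα.1.1
  | succ n ih => exact mul_pos ih (gauss_mem hα _).1.1

lemma cfb_anti {α : ℝ} (hα : α ∈ IrrN 2) (n : ℕ) : cfb α (n+1) ≤ cfb α n := by
  rw [cfb]
  exact mul_le_of_le_one_right (cfb_pos hα n).le (gauss_mem hα _).1.2.le

lemma cfq_pair {α : ℝ} (hα : α ∈ IrrN 2) (n : ℕ) :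
    1 ≤ cfq α n ∧ 2 * cfq α n ≤ cfq α (n+1) := by
  induction n with
  | zero => 
    have := hα.2.2 0
    simp only [cfq]; push_cast at this; omega
  | succ n ih =>
    have := hα.2.2 (n+1)
    push_cast at this
    refine ⟨by omega, ?_⟩
    rw [cfq]
    nlinarith

lemma cf_main {α : ℝ} (hα : α ∈ IrrN 2) (n : ℕ) :
    ((cfq α n : ℝ) * α - cfp α n = (-1)^n * cfb α n) ∧
    ((cfq α (n+1) : ℝ) * α - cfp α (n+1) = (-1)^(n+1) * cfb α (n+1)) ∧
    ((cfq α (n+1) : ℝ) * cfb α n + cfq α n * cfb α (n+1) = 1) ∧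
    (cfp α (n+1) * cfq α n - cfp α n * cfq α (n+1) = (-1)^n) := by
  induction n with
  | zero =>
    have := gauss_succ hα 0
    simp only [gaussIter] at this
    refine ⟨?_, ?_, ?_, ?_⟩
    · simp [cfq, cfp, cfb]
    · simp only [cfq, cfp, cfb, zero_add, gaussIter]; push_cast; linear_combination this
    · simp only [cfq, cfb, zero_add, gaussIter]; push_cast; linear_combination this
    · simp [cfq, cfp]
  | succ n ih =>
    obtain ⟨h1, h2, h3, h4⟩ := ih
    have := cfb_rec hα n
    refine ⟨h2, ?_, ?_, ?_⟩
    · rw [this, cfq, cfp]; push_cast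
      linear_combination (cfa α (n+1)) * h2 + h1
    · rw [this, cfq]; push_cast
      linear_combination h3
    · rw [cfq, cfp]
      linear_combination -h4

lemma cf_facts {α : ℝ} (hα : α ∈ IrrN 2) : ∃ q : ℕ → ℕ, ∃ p : ℕ → ℤ,
    (∀ k, (q k : ℤ) = cfq α k) ∧ (∀ k, 2^k ≤ q k) ∧ (∀ k, 2 * q k ≤ q (k+1)) ∧
    (∀ k, IsCoprime (p k) (q k)) ∧
    (∀ k, |q k * α - p k| ≤ 1 / q (k+1)) ∧ (∀ k, 1 / (2 * q (k+1)) ≤ |q k * α - p k|) := by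
  have hq : ∀ k, ((cfq α k).toNat : ℤ) = cfq α k := fun k =>
    Int.toNat_of_nonneg (by have := (cfq_pair hα k).1; omega)
  have hqr : ∀ k, ((cfq α k).toNat : ℝ) = cfq α k := fun k => by
    rw [← Int.cast_natCast, hq]
  have h2 : ∀ k, 2 * (cfq α k).toNat ≤ (cfq α (k+1)).toNat := by
    intro k
    have := (cfq_pair hα k).2
    have := hq k; have := hq (k+1); omega
  have hpos : ∀ k, (0:ℝ) < cfq α k := fun k => by
    have := (cfq_pair hα k).1
    exact_mod_cast (by omega : (0:ℤ) < cfq α k)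
  have habs : ∀ k, |(cfq α k : ℝ) * α - cfp α k| = cfb α k := by
    intro k
    rw [(cf_main hα k).1, abs_mul, abs_pow, abs_neg, abs_one, one_pow, one_mul,
      abs_of_pos (cfb_pos hα k)]
  refine ⟨fun k => (cfq α k).toNat, cfp α, hq, ?_, h2, ?_, ?_, ?_⟩
  · intro k
    induction k with
    | zero => simp [cfq]
    | succ k ih => have := h2 k; rw [pow_succ]; simp only at ih ⊢; omega
  · intro k
    rw [hq]
    have := (cf_main hα k).2.2.2
    have h1 : ((-1:ℤ)^k) * (-1)^k = 1 := by rw [← mul_pow]; simp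
    refine ⟨-(-1)^k * cfq α (k+1), (-1)^k * cfp α (k+1), ?_⟩
    linear_combination (-1)^k * this + h1
  · intro k
    rw [hqr, hqr, habs, le_div_iff₀ (hpos _)]
    have := (cf_main hα k).2.2.1
    nlinarith [mul_pos (hpos k) (cfb_pos hα (k+1))]
  · intro k
    rw [hqr, hqr, habs, div_le_iff₀ (by have := hpos (k+1); positivity)]
    have := (cf_main hα k).2.2.1
    have h5 : (cfq α k : ℝ) ≤ cfq α (k+1) := by
      have := (cfq_pair hα k); exact_mod_cast (by omega : cfq α k ≤ cfq α (k+1))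
    nlinarith [mul_le_mul h5 (cfb_anti hα k) (cfb_pos hα (k+1)).le (hpos (k+1)).le]
end QL

namespace QL

noncomputable def lam (α : ℝ) : ℂ := Complex.exp (2 * Real.pi * Complex.I * α)

lemma lam_norm (α : ℝ) : ‖lam α‖ = 1 := by
  rw [lam, show (2 * Real.pi * Complex.I * α : ℂ) = Complex.I * ((2 * Real.pi * α : ℝ) : ℂ) by
    push_cast; ring]
  exact Complex.norm_exp_I_mul_ofReal _

lemma lam_pow_norm (α : ℝ) (n : ℕ) : ‖lam α ^ n‖ = 1 := by
  rw [norm_pow, lam_norm, one_pow]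

lemma lam_add (α β : ℝ) : lam (α + β) = lam α * lam β := by
  rw [lam, lam, lam, ← Complex.exp_add]; push_cast; ring_nf

lemma lam_int (n : ℤ) : lam n = 1 := by
  rw [lam, Complex.exp_eq_one_iff]
  exact ⟨n, by push_cast; ring⟩

lemma lam_pow (α : ℝ) (n : ℕ) : lam α ^ n = lam (n * α) := by
  rw [lam, lam, ← Complex.exp_nat_mul]; push_cast; ring_nf

lemma lam_sub_int (α : ℝ) (n : ℤ) : lam (α - n) = lam α := by
  have := lam_add (α - n) n
  rw [lam_int, mul_one, sub_add_cancel] at this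
  exact this.symm

lemma lam_sub_one_le (x : ℝ) : ‖lam x - 1‖ ≤ 2 * Real.pi * |x| := by
  rw [lam, show (2 * Real.pi * Complex.I * x : ℂ) = Complex.I * ((2 * Real.pi * x : ℝ) : ℂ) by
    push_cast; ring]
  refine Real.norm_exp_I_mul_ofReal_sub_one_le.trans ?_
  rw [Real.norm_eq_abs, abs_mul, abs_of_pos (by positivity : 0 < 2 * Real.pi)]

lemma lam_sub_one_ge (x : ℝ) (hx : |x| ≤ 1/2) : 4 * |x| ≤ ‖lam x - 1‖ := by
  rw [lam, show (2 * Real.pi * Complex.I * x : ℂ) = Complex.I * ((2 * Real.pi * x : ℝ) : ℂ) by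
    push_cast; ring]
  rw [Complex.norm_exp_I_mul_ofReal_sub_one, norm_mul, Real.norm_eq_abs, Real.norm_eq_abs]
  rw [show 2 * Real.pi * x / 2 = Real.pi * x by ring]
  have h1 : |Real.sin (Real.pi * x)| = |Real.sin (Real.pi * |x|)| := by
    rcases abs_cases x with ⟨h, _⟩ | ⟨h, _⟩ <;> rw [h]
    rw [mul_neg, Real.sin_neg, abs_neg]
  have h2 := Real.mul_le_sin (x := Real.pi * |x|) (by positivity)
    (by nlinarith [Real.pi_pos])
  have h3 : 2 / Real.pi * (Real.pi * |x|) = 2 * |x| := by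
    have := Real.pi_ne_zero; field_simp
  rw [h1, abs_two]
  have := le_abs_self (Real.sin (Real.pi * |x|))
  linarith

lemma lam_diff_le (x y : ℝ) : ‖lam x - lam y‖ ≤ 2 * Real.pi * |x - y| := by
  have h : lam x - lam y = (lam (x - y) - 1) * lam y := by
    rw [sub_mul, ← lam_add]; simp
  rw [h, norm_mul, lam_norm, mul_one]
  exact lam_sub_one_le _

lemma lam_NR {α : ℝ} (hα : Irrational α) (m : ℕ) : lam α^(m+2) - lam α ≠ 0 := by
  intro h
  rw [pow_succ, sub_eq_zero] at h
  have h1 : lam α ^ (m+1) = 1 := by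
    have h0 : lam α ≠ 0 := Complex.exp_ne_zero _
    apply mul_right_cancel₀ h0
    rw [h, one_mul]
  rw [lam_pow, lam, Complex.exp_eq_one_iff] at h1
  obtain ⟨n, hn⟩ := h1
  have h2 : (((m+1:ℕ):ℝ) * α : ℂ) = n := by
    have : (2 * Real.pi * Complex.I : ℂ) ≠ 0 := Complex.two_pi_I_ne_zero
    apply mul_left_cancel₀ this
    rw [← Complex.ofReal_mul, hn]; ring
  have h3 : ((m+1:ℕ):ℝ) * α = n := by exact_mod_cast h2
  have h4 := hα.natCast_mul (m := m+1) (by omega)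
  exact h4.ne_int n h3

section approx
variable {α : ℝ} {q q' : ℕ} {p : ℤ}

lemma lam_pow_q_le (h1 : |q * α - p| ≤ 1 / q') : ‖lam α^q - 1‖ ≤ 2 * Real.pi / q' := by
  rw [lam_pow, ← lam_sub_int _ p]
  refine (lam_sub_one_le _).trans ?_
  calc _ ≤ 2 * Real.pi * (1/q') := by gcongr
    _ = _ := by ring

lemma lam_pow_qT_ge (h1 : |q * α - p| ≤ 1 / q') (h2 : 1/(2*q') ≤ |q * α - p|) (T : ℕ)
    (hq' : 0 < q') (hT : 2 * T ≤ q') : 2 * T / (q':ℝ) ≤ ‖lam α^(q*T) - 1‖ := by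
  have hq'' : (0:ℝ) < q' := by exact_mod_cast hq'
  rw [lam_pow, ← lam_sub_int _ (T * p)]
  have e : ((q*T:ℕ):ℝ) * α - ((T * p : ℤ):ℝ) = T * (q * α - p) := by push_cast; ring
  rw [e]
  have hTr : 2 * (T:ℝ) ≤ q' := by exact_mod_cast hT
  refine le_trans ?_ (lam_sub_one_ge _ ?_)
  · rw [abs_mul, Nat.abs_cast]
    calc 2 * T / (q':ℝ) = 4 * (T * (1/(2*q'))) := by field_simp; ring
      _ ≤ _ := by gcongr
  · rw [abs_mul, Nat.abs_cast]
    calc _ ≤ T * (1/(q':ℝ)) := by gcongr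
      _ ≤ 1/2 := by rw [mul_one_div, div_le_iff₀ hq'']; linarith

lemma lam_sub_root (h1 : |q * α - p| ≤ 1 / q') (hq : 0 < q) (m : ℕ) (hm : m ≤ q) :
    ‖lam α^m - (lam (p/q))^m‖ ≤ 2 * Real.pi / q' := by
  have hq1 : (0:ℝ) < q := by exact_mod_cast hq
  rw [lam_pow, lam_pow]
  refine (lam_diff_le _ _).trans ?_
  have e : (m:ℝ) * α - m * (p/q) = (m/q) * (q * α - p) := by field_simp
  have : (m:ℝ)/q ≤ 1 := by rw [div_le_one hq1]; exact_mod_cast hm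
  rw [e, abs_mul, abs_of_nonneg (by positivity : (0:ℝ) ≤ m/q)]
  calc _ ≤ 2 * Real.pi * (1 * (1/q')) := by gcongr
    _ = _ := by ring

lemma prim_root (hq : 0 < q) (hc : IsCoprime p (q:ℤ)) : IsPrimitiveRoot (lam (p/q)) q := by
  have := Complex.isPrimitiveRoot_exp_of_isCoprime p q (by omega) hc
  rw [lam]; push_cast; exact this

lemma root_sub_one_ge (hq : 0 < q) (hc : IsCoprime p (q:ℤ)) (d : ℕ) (hd : 0 < d) (hdq : d < q) :
    4 / (q:ℝ) ≤ ‖lam (p/q)^d - 1‖ := by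
  have hq1 : (0:ℝ) < q := by exact_mod_cast hq
  rw [lam_pow, ← lam_sub_int _ (round ((d:ℝ) * (p/q)))]
  refine le_trans ?_ (lam_sub_one_ge _ (abs_sub_round _))
  have e : (d:ℝ) * (p/q) - round ((d:ℝ) * (p/q)) =
      ((d * p - q * round ((d:ℝ) * (p/q)) : ℤ) : ℝ) / q := by push_cast; field_simp
  rw [e, abs_div, abs_of_pos hq1, ← mul_div_assoc]
  gcongr
  have hne : (d * p - q * round ((d:ℝ) * (p/q)) : ℤ) ≠ 0 := by
    intro h
    have h2 : (q:ℤ) ∣ d * p := ⟨_, by linarith [h]⟩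
    have h3 : (q:ℤ) ∣ d := hc.symm.dvd_of_dvd_mul_right h2
    have := Nat.le_of_dvd hd (Int.natCast_dvd_natCast.mp h3)
    omega
  have : (1:ℝ) ≤ |((d * p - q * round ((d:ℝ) * (p/q)) : ℤ) : ℝ)| := by
    rw [← Int.cast_abs]; exact_mod_cast Int.one_le_abs hne
  linarith

lemma prod_lam_ge (h1 : |q * α - p| ≤ 1 / q') (hq : 0 < q) (hc : IsCoprime p (q:ℤ))
    (hq' : 8 * q^2 ≤ q') :
    (q:ℝ)/2 ≤ ∏ i ∈ Finset.range (q-1), ‖lam α^(i+1) - 1‖ := by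
  have hq1 : (1:ℝ) ≤ q := by exact_mod_cast hq
  have hq2 : 8 * (q:ℝ)^2 ≤ q' := by exact_mod_cast hq'
  have hq3 : (0:ℝ) < q' := by nlinarith
  have hpr := prim_root hq hc
  obtain ⟨s, rfl⟩ : ∃ s, q = s + 1 := ⟨q-1, by omega⟩
  have hprod := hpr.prod_one_sub_pow_eq_order
  have hn : ∏ i ∈ Finset.range s, ‖lam (p/((s+1:ℕ):ℝ))^(i+1) - 1‖ = s + 1 := by
    rw [← norm_prod]
    have := congrArg norm hprod
    rw [norm_prod] at this
    simp only [norm_sub_rev (1:ℂ)] at this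
    rw [norm_prod, this]
    exact_mod_cast Complex.norm_natCast (s+1)
  set Q : ℝ := ((s+1:ℕ):ℝ) with hQ
  have hfac : ∀ i ∈ Finset.range s, (1 - 2*Q/q') * ‖lam (p/Q)^(i+1) - 1‖ ≤ ‖lam α^(i+1) - 1‖ := by
    intro i hi
    have hi := Finset.mem_range.mp hi
    have a := lam_sub_root h1 hq (i+1) (by omega)
    have b := root_sub_one_ge hq hc (i+1) (by omega) (by omega)
    have c : ‖lam (p/Q)^(i+1) - 1‖ ≤ ‖lam α^(i+1) - 1‖ + ‖lam α^(i+1) - lam (p/Q)^(i+1)‖ := by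
      have := norm_sub_le (lam α^(i+1) - 1) (lam α^(i+1) - lam (p/Q)^(i+1))
      simpa using this
    have d : 2 * Real.pi / q' ≤ 2*Q/q' * (4/Q) := by
      rw [show 2*Q/(q':ℝ) * (4/Q) = 8/q' by have : Q ≠ 0 := by positivity
                                            field_simp; norm_num]
      gcongr
      linarith [Real.pi_le_four]
    have e : 2*Q/q' * (4/Q) ≤ 2*Q/q' * ‖lam (p/Q)^(i+1) - 1‖ := by gcongr
    linarith
  have hsmall : 2*Q/q' ≤ 1/(4*Q) := by
    rw [div_le_div_iff₀ hq3 (by positivity)]; nlinarith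
  have h01 : 1/(4*Q) ≤ 1/4 := by
    apply one_div_le_one_div_of_le <;> linarith
  have hge : 0 ≤ 1 - 2*Q/q' := by linarith
  have := Finset.prod_le_prod (s := Finset.range s) (fun i _ => mul_nonneg hge (norm_nonneg _)) hfac
  rw [Finset.prod_mul_distrib, hn, Finset.prod_const, Finset.card_range] at this
  have hb : 1 + s * (-(2*Q/q')) ≤ (1 + (-(2*Q/q')))^s := by
    apply one_add_mul_le_pow; linarith
  have hsQ : (s:ℝ) ≤ Q := by rw [hQ]; push_cast; linarith
  have : (s:ℝ) * (2*Q/q') ≤ Q * (1/(4*Q)) := by gcongr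
  have h4 : Q * (1/(4*Q)) = 1/4 := by have : Q ≠ 0 := by positivity
                                      field_simp
  have hsum : (s:ℝ) + 1 = Q := by rw [hQ]; push_cast; ring
  simp only [Nat.add_sub_cancel]
  refine le_trans ?_ ‹(1 - 2*Q/q')^s * ((s:ℝ) + 1) ≤ _›
  rw [hsum]
  have h5 : 1/2 ≤ (1 - 2*Q/q')^s := by rw [sub_eq_add_neg]; linarith
  nlinarith

lemma prod_x_le (h1 : |q * α - p| ≤ 1 / q') (hq : 0 < q) (hc : IsCoprime p (q:ℤ))
    (hq' : 8 * q^2 ≤ q') (x : ℂ) (hx : ‖x‖ = 1 + 1/q) :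
    ‖∏ i ∈ Finset.range (q-1), (x - lam α^(i+2))‖ ≤ 16 * q := by
  have hq1 : (1:ℝ) ≤ q := by exact_mod_cast hq
  have hq2 : 8 * (q:ℝ)^2 ≤ q' := by exact_mod_cast hq'
  have hq3 : (0:ℝ) < q' := by nlinarith
  have hpr := prim_root hq hc
  have hge : ∀ n : ℕ, 1/(q:ℝ) ≤ ‖x - lam (p/q)^n‖ := by
    intro n
    have := norm_sub_norm_le x (lam (p/q)^n)
    rw [lam_pow_norm, hx] at this; linarith
  have hpoly := X_pow_sub_C_eq_prod hpr hq (α := lam (p/q)) (a := 1) hpr.pow_eq_one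
  have hev := congrArg (Polynomial.eval x) hpoly
  simp only [Polynomial.eval_sub, Polynomial.eval_pow, Polynomial.eval_X, Polynomial.eval_C,
    Polynomial.eval_prod] at hev
  have hxq : ‖x^q - 1‖ ≤ 4 := by
    refine (norm_sub_le _ _).trans ?_
    rw [norm_pow, hx, norm_one]
    have : (1 + 1/(q:ℝ))^q ≤ Real.exp 1 := by
      calc (1 + 1/(q:ℝ))^q ≤ (Real.exp (1/q))^q := by
            gcongr; linarith [Real.add_one_le_exp (1/(q:ℝ))]
        _ = Real.exp 1 := by rw [← Real.exp_nat_mul]; congr 1; field_simp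
    linarith [Real.exp_one_lt_d9]
  obtain ⟨s, rfl⟩ : ∃ s, q = s + 1 := ⟨q-1, by omega⟩
  rw [Finset.prod_range_succ'] at hev
  simp only [← pow_succ, pow_zero, one_mul] at hev
  set Q : ℝ := ((s+1:ℕ):ℝ) with hQ
  have hP : ‖∏ i ∈ Finset.range s, (x - lam (p/Q)^(i+2))‖ ≤ 4 * Q := by
    have h2 := congrArg norm hev
    rw [norm_mul] at h2
    have h3 := hge 1
    rw [pow_one] at h3
    have h4 : ‖∏ i ∈ Finset.range s, (x - lam (p/Q)^(i+2))‖ * (1/Q) ≤ 4 := by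
      calc _ ≤ ‖∏ i ∈ Finset.range s, (x - lam (p/Q)^(i+2))‖ * ‖x - lam (p/Q)‖ := by gcongr
        _ = _ := h2.symm
        _ ≤ 4 := hxq
    rwa [mul_one_div, div_le_iff₀ (by linarith)] at h4
  have hfac : ∀ i ∈ Finset.range s, ‖x - lam α^(i+2)‖ ≤ (1 + 8 * Q/q') * ‖x - lam (p/Q)^(i+2)‖ := by
    intro i hi
    have hi := Finset.mem_range.mp hi
    have a := lam_sub_root h1 hq (i+2) (by omega)
    have c : ‖x - lam α^(i+2)‖ ≤ ‖x - lam (p/Q)^(i+2)‖ + ‖lam α^(i+2) - lam (p/Q)^(i+2)‖ := by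
      have := norm_sub_le (x - lam (p/Q)^(i+2)) (lam α^(i+2) - lam (p/Q)^(i+2))
      simpa using this
    have d : 2 * Real.pi / q' ≤ 8*Q/q' * (1/Q) := by
      rw [show 8*Q/(q':ℝ) * (1/Q) = 8/q' by have : Q ≠ 0 := by positivity
                                            field_simp]
      gcongr
      linarith [Real.pi_le_four]
    have e : 8*Q/q' * (1/Q) ≤ 8*Q/q' * ‖x - lam (p/Q)^(i+2)‖ := by gcongr; exact hge _
    linarith
  simp only [Nat.add_sub_cancel]
  have := Finset.prod_le_prod (s := Finset.range s) (fun i _ => norm_nonneg _) hfac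
  rw [Finset.prod_mul_distrib, Finset.prod_const, Finset.card_range, ← norm_prod, ← norm_prod] at this
  have hexp : (1 + 8*Q/q')^s ≤ Real.exp 1 := by
    calc (1 + 8*Q/q')^s ≤ (Real.exp (8*Q/q'))^s := by
          gcongr; linarith [Real.add_one_le_exp (8*Q/(q':ℝ))]
      _ = Real.exp (s * (8*Q/q')) := by rw [← Real.exp_nat_mul]
      _ ≤ Real.exp 1 := by
        apply Real.exp_le_exp.mpr
        have hsQ : (s:ℝ) ≤ Q := by rw [hQ]; push_cast; linarith
        calc (s:ℝ) * (8*Q/q') ≤ Q * (8*Q/q') := by gcongr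
          _ = 8 * Q^2 / q' := by ring
          _ ≤ 1 := by rw [div_le_one hq3]; exact hq2
  refine this.trans ?_
  calc _ ≤ 4 * (4 * Q) := by
        gcongr
        linarith [Real.exp_one_lt_d9]
    _ = _ := by ring
end approx
end QL

namespace QL

lemma interp {α : ℝ} {q q' : ℕ} {p : ℤ} (h1 : |q * α - p| ≤ 1 / q')
    (h2 : 1/(2*q') ≤ |q * α - p|) (hq : 2 ≤ q) (hc : IsCoprime p (q:ℤ)) (hq' : 8 * q^6 ≤ q') :
    ∃ c : ℕ → ℂ, ∑ j ∈ Finset.range (q + q'/q^6), ‖c j‖ ≤ 64 * (q:ℝ)^7 ∧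
      (∀ m, 1 ≤ m → m ≤ q → ∑ j ∈ Finset.range (q + q'/q^6), c j * lam α^(m*j) = 0) ∧
      ∑ j ∈ Finset.range (q + q'/q^6), c j * lam α^((q+1)*j) = 1 := by
  set T := q'/q^6 with hT
  set l := lam α with hl
  have hq0 : 0 < q := by omega
  have hq6 : q^2 ≤ q^6 := Nat.pow_le_pow_right hq0 (by norm_num)
  have hq8 : 8 * q^2 ≤ q' := by omega
  have hq64 : 2^6 ≤ q^6 := Nat.pow_le_pow_left hq 6
  have hq'0 : 0 < q' := by omega
  have hqr : (2:ℝ) ≤ q := by exact_mod_cast hq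
  have hq'r : (0:ℝ) < q' := by exact_mod_cast hq'0
  have hT2 : 2 * T ≤ q' := by
    have : T ≤ q'/2 := Nat.div_le_div_left (by omega) (by norm_num)
    omega
  have hTge : 1/(2*(q:ℝ)^6) ≤ T / q' := by
    have hd := Nat.div_add_mod q' (q^6)
    have hm := Nat.mod_lt q' (show 0 < q^6 by positivity)
    have hT1 : 1 ≤ T := by
      rw [hT, Nat.one_le_div_iff (by positivity)]; omega
    have : q' ≤ 2 * q^6 * T := by nlinarith
    rw [div_le_div_iff₀ (by positivity) hq'r]
    have : (q':ℝ) ≤ 2 * q^6 * T := by exact_mod_cast this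
    linarith
  have hA := lam_pow_qT_ge h1 h2 T hq'0 hT2
  have hB := prod_lam_ge h1 hq0 hc hq8
  set A : Polynomial ℂ := ∏ i ∈ Finset.range (q-1), (Polynomial.X - Polynomial.C (l^(i+2))) with hAdef
  have hAev : ∀ x, A.eval x = ∏ i ∈ Finset.range (q-1), (x - l^(i+2)) := by
    intro x; rw [hAdef, Polynomial.eval_prod]; simp
  have hAdeg : A.natDegree < q := by
    rw [hAdef, Polynomial.natDegree_prod_of_monic _ _ (fun i _ => Polynomial.monic_X_sub_C _)]
    simp only [Polynomial.natDegree_X_sub_C]; simp; omega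
  have hAc : ∀ k, ‖A.coeff k‖ ≤ 16 * q := by
    intro k
    have hR : (0:ℝ) < 1 + 1/q := by positivity
    refine (poly_coeff_le A hR (C := 16 * q) ?_ k).trans ?_
    · intro z hz
      rw [hAev]
      exact prod_x_le h1 hq0 hc hq8 z (by simpa using hz)
    · apply div_le_self (by positivity)
      apply one_le_pow₀
      have : (0:ℝ) ≤ 1/q := by positivity
      linarith
  set den : ℂ := A.eval (l^(q+1)) * ((l^(q+1))^T - l^T) with hden
  have hdn : (q:ℝ)/2 * (1/(q:ℝ)^6) ≤ ‖den‖ := by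
    rw [hden, norm_mul]
    have e1 : ‖(l^(q+1))^T - l^T‖ = ‖l^(q*T) - 1‖ := by
      rw [show (l^(q+1))^T - l^T = (l^(q*T) - 1) * l^T by rw [← pow_mul]; ring]
      rw [norm_mul, lam_pow_norm, mul_one]
    have e2 : ‖A.eval (l^(q+1))‖ = ∏ i ∈ Finset.range (q-1), ‖l^(i+1) - 1‖ := by
      rw [hAev, norm_prod, ← Finset.prod_range_reflect]
      apply Finset.prod_congr rfl
      intro i hi
      have hi := Finset.mem_range.mp hi
      rw [show l^(q+1) - l^(q-1-1-i+2) = (l^(i+1) - 1) * l^(q-1-1-i+2) by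
        rw [sub_mul, ← pow_add, one_mul]; congr 2; omega]
      rw [norm_mul, lam_pow_norm, mul_one]
    rw [e1, e2]
    have : 1/(q:ℝ)^6 ≤ ‖l^(q*T) - 1‖ := by
      refine le_trans ?_ hA
      calc 1/(q:ℝ)^6 = 2 * (1/(2*(q:ℝ)^6)) := by field_simp
        _ ≤ 2 * ((T:ℝ)/(q':ℝ)) := by gcongr
        _ = _ := by ring
    gcongr
  have hdpos : 0 < ‖den‖ := lt_of_lt_of_le (by positivity) hdn
  have hd0 : den ≠ 0 := norm_pos_iff.mp hdpos
  set a1 : ℕ → ℂ := fun j => if T ≤ j then A.coeff (j - T) else 0 with ha1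
  have s1 : ∀ g : ℕ → ℂ, ∑ j ∈ Finset.range (q + T), a1 j * g j =
      ∑ j ∈ Finset.range q, A.coeff j * g (T + j) := by
    intro g
    rw [add_comm q T, Finset.sum_range_add, Finset.sum_eq_zero, zero_add]
    · apply Finset.sum_congr rfl
      intro j _; simp [ha1]
    · intro j hj; have := Finset.mem_range.mp hj
      simp [ha1, not_le.mpr this]
  have s2 : ∀ g : ℕ → ℂ, ∑ j ∈ Finset.range (q + T), A.coeff j * g j =
      ∑ j ∈ Finset.range q, A.coeff j * g j := by
    intro g
    rw [Finset.sum_range_add, add_eq_left]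
    apply Finset.sum_eq_zero
    intro j _
    rw [Polynomial.coeff_eq_zero_of_natDegree_lt (by omega), zero_mul]
  have hval : ∀ m, ∑ j ∈ Finset.range (q + T), ((a1 j - l^T * A.coeff j) / den) * l^(m*j) =
      A.eval (l^m) * ((l^m)^T - l^T) / den := by
    intro m
    have : ∀ j, ((a1 j - l^T * A.coeff j) / den) * l^(m*j) =
      (a1 j * l^(m*j) - l^T * (A.coeff j * l^(m*j))) / den := by intro j; ring
    simp only [this]
    rw [← Finset.sum_div, Finset.sum_sub_distrib, ← Finset.mul_sum, s1, s2]
    congr 1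
    rw [Polynomial.eval_eq_sum_range' hAdeg, mul_sub, Finset.sum_mul]
    congr 1
    · apply Finset.sum_congr rfl
      intro j _; rw [mul_add, pow_add, pow_mul, pow_mul]; ring
    · rw [mul_comm]; congr 1
      apply Finset.sum_congr rfl
      intro j _; rw [pow_mul]
  refine ⟨fun j => (a1 j - l^T * A.coeff j) / den, ?_, ?_, ?_⟩
  · have n1 : ∑ j ∈ Finset.range (q + T), ‖a1 j‖ = ∑ j ∈ Finset.range q, ‖A.coeff j‖ := by
      rw [add_comm q T, Finset.sum_range_add, Finset.sum_eq_zero, zero_add]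
      · apply Finset.sum_congr rfl
        intro j _; simp [ha1]
      · intro j hj; have := Finset.mem_range.mp hj
        simp [ha1, not_le.mpr this]
    have n2 : ∑ j ∈ Finset.range (q + T), ‖A.coeff j‖ = ∑ j ∈ Finset.range q, ‖A.coeff j‖ := by
      rw [Finset.sum_range_add, add_eq_left]
      apply Finset.sum_eq_zero
      intro j _
      rw [Polynomial.coeff_eq_zero_of_natDegree_lt (by omega), norm_zero]
    have n3 : ∑ j ∈ Finset.range q, ‖A.coeff j‖ ≤ q * (16 * q) := by
      refine (Finset.sum_le_card_nsmul _ _ _ fun j _ => hAc j).trans ?_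
      simp
    have n4 : ∀ j, ‖(a1 j - l^T * A.coeff j) / den‖ ≤ (‖a1 j‖ + ‖A.coeff j‖) / ‖den‖ := by
      intro j
      rw [norm_div]
      gcongr
      refine (norm_sub_le _ _).trans ?_
      rw [norm_mul, lam_pow_norm, one_mul]
    refine (Finset.sum_le_sum fun j _ => n4 j).trans ?_
    rw [← Finset.sum_div, Finset.sum_add_distrib, n1, n2, div_le_iff₀ hdpos]
    calc _ ≤ (q:ℝ) * (16 * q) + q * (16 * q) := by gcongr
      _ = 64 * (q:ℝ)^7 * (q/2 * (1/q^6)) := by field_simp; ring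
      _ ≤ _ := by gcongr
  · intro m hm1 hmq
    rw [hval]
    rcases Nat.lt_or_ge m 2 with h | h
    · have : m = 1 := by omega
      subst this; simp
    · rw [hAev, Finset.prod_eq_zero (i := m - 2)]
      · simp
      · simp; omega
      · rw [show m - 2 + 2 = m by omega, sub_self]
  · rw [hval, ← hden, div_self hd0]
end QL

namespace QL

noncomputable def nu (h : Polynomial ℂ) : ℝ := ∑ k ∈ Finset.range (h.natDegree + 1), (k:ℝ) * ‖h.coeff k‖

lemma nu_eq (h : Polynomial ℂ) {m : ℕ} (hm : h.natDegree < m) :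
    nu h = ∑ k ∈ Finset.range m, (k:ℝ) * ‖h.coeff k‖ := by
  apply Finset.sum_subset
  · intro k; simp; omega
  · intro k _ hk
    rw [Polynomial.coeff_eq_zero_of_natDegree_lt (by simp at hk; omega)]; simp

lemma nu_nonneg (h : Polynomial ℂ) : 0 ≤ nu h := Finset.sum_nonneg fun _ _ => by positivity

lemma nu_add_le (h g : Polynomial ℂ) : nu (h + g) ≤ nu h + nu g := by
  set m := max h.natDegree g.natDegree + 1
  rw [nu_eq h (m := m) (by omega), nu_eq g (m := m) (by omega), nu_eq (h+g) (m := m)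
    (by have := Polynomial.natDegree_add_le h g; omega), ← Finset.sum_add_distrib]
  apply Finset.sum_le_sum
  intro k _
  rw [← mul_add, Polynomial.coeff_add]
  gcongr
  exact norm_add_le _ _

lemma nu_monomial_le (t : ℂ) (k : ℕ) : nu (Polynomial.C t * Polynomial.X^k) ≤ k * ‖t‖ := by
  rw [nu_eq _ (m := k+1) (by have := Polynomial.natDegree_C_mul_X_pow_le t k; omega)]
  rw [Finset.sum_eq_single k]
  · simp
  · intro j _ hj; simp [hj]
  · simp

section
variable {h : Polynomial ℂ}

lemma pow_sub_pow_le {y w : ℂ} (hy : ‖y‖ ≤ 1) (hw : ‖w‖ ≤ 1) (k : ℕ) :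
    ‖y^k - w^k‖ ≤ k * ‖y - w‖ := by
  rw [← (Commute.all y w).mul_geom_sum₂, mul_comm, norm_mul]
  gcongr
  refine (norm_sum_le _ _).trans ?_
  refine (Finset.sum_le_card_nsmul _ _ 1 ?_).trans (by simp)
  intro i _
  rw [norm_mul, norm_pow, norm_pow]
  exact mul_le_one₀ (pow_le_one₀ (norm_nonneg _) hy) (by positivity) (pow_le_one₀ (norm_nonneg _) hw)

lemma h_lip {y w : ℂ} (hy : ‖y‖ ≤ 1) (hw : ‖w‖ ≤ 1) :
    ‖h.eval y - h.eval w‖ ≤ nu h * ‖y - w‖ := by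
  rw [Polynomial.eval_eq_sum_range, Polynomial.eval_eq_sum_range, ← Finset.sum_sub_distrib, nu,
    Finset.sum_mul]
  refine (norm_sum_le _ _).trans (Finset.sum_le_sum fun k _ => ?_)
  rw [← mul_sub, norm_mul]
  calc _ ≤ ‖h.coeff k‖ * (k * ‖y - w‖) := by gcongr; exact pow_sub_pow_le hy hw k
    _ = _ := by ring

lemma deriv_coeff_sum (h : Polynomial ℂ) (m : ℕ) : ∑ k ∈ Finset.range m, ‖h.derivative.coeff k‖ ≤ nu h := by
  rw [nu_eq h (m := m + h.natDegree + 2) (by omega), Finset.sum_range_succ']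
  simp only [Nat.cast_zero, zero_mul, add_zero]
  refine le_trans ?_ (Finset.sum_le_sum_of_subset_of_nonneg (s := Finset.range m) ?_ ?_)
  · apply Finset.sum_le_sum
    intro k _
    rw [Polynomial.coeff_derivative, norm_mul, mul_comm]
    gcongr
    rw [← Nat.cast_succ, Complex.norm_natCast]
  · intro k; simp; omega
  · intro k _ _; positivity

lemma h_deriv {w : ℂ} (hw : ‖w‖ ≤ 1) : ‖h.derivative.eval w‖ ≤ nu h := by
  rw [Polynomial.eval_eq_sum_range]
  refine (norm_sum_le _ _).trans (le_trans (Finset.sum_le_sum fun k _ => ?_) (deriv_coeff_sum h _))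
  rw [norm_mul, norm_pow]
  exact mul_le_of_le_one_right (norm_nonneg _) (pow_le_one₀ (norm_nonneg _) hw)
end

noncomputable def fp (l : ℂ) (h : Polynomial ℂ) : Polynomial ℂ := Polynomial.C l * Polynomial.X + h

/-- the basic hypotheses on `l` and `h` -/
structure Hyp (l : ℂ) (h : Polynomial ℂ) : Prop where
  l1 : ‖l‖ = 1
  nr : NR l
  X2 : Polynomial.X^2 ∣ h
  nu : nu h ≤ 1/10

section
variable {l : ℂ} {h : Polynomial ℂ} (H : Hyp l h)
include H

lemma h_zero : h.eval 0 = 0 := by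
  obtain ⟨g, hg⟩ := H.X2; rw [hg]; simp

lemma fp_lip {y w : ℂ} (hy : ‖y‖ ≤ 1) (hw : ‖w‖ ≤ 1) :
    ‖(fp l h).eval y - (fp l h).eval w - l * (y - w)‖ ≤ 1/10 * ‖y - w‖ := by
  have : (fp l h).eval y - (fp l h).eval w - l * (y - w) = h.eval y - h.eval w := by
    simp [fp]; ring
  rw [this]
  exact (h_lip hy hw).trans (by gcongr; exact H.nu)

lemma fp_lower {y w : ℂ} (hy : ‖y‖ ≤ 1) (hw : ‖w‖ ≤ 1) :
    9/10 * ‖y - w‖ ≤ ‖(fp l h).eval y - (fp l h).eval w‖ := by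
  have h1 := fp_lip H hy hw
  have h2 : ‖l * (y - w)‖ = ‖y - w‖ := by rw [norm_mul, H.l1, one_mul]
  have h3 := norm_sub_norm_le (l * (y-w)) ((fp l h).eval y - (fp l h).eval w)
  rw [norm_sub_rev (l * (y-w))] at h3
  linarith

lemma fp_zero : (fp l h).eval 0 = 0 := by simp [fp, h_zero H]

lemma fp_upper {y : ℂ} (hy : ‖y‖ ≤ 1) : ‖(fp l h).eval y‖ ≤ 11/10 * ‖y‖ := by
  have h1 := fp_lip H hy (w := 0) (by simp)
  rw [fp_zero H, sub_zero, sub_zero] at h1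
  have h2 : ‖l * y‖ = ‖y‖ := by rw [norm_mul, H.l1, one_mul]
  have h3 := norm_sub_norm_le ((fp l h).eval y) (l * y)
  linarith

lemma fp_deriv {w : ℂ} (hw : ‖w‖ ≤ 1) : ‖(fp l h).derivative.eval w - l‖ ≤ 1/10 := by
  have : (fp l h).derivative.eval w - l = h.derivative.eval w := by simp [fp]
  rw [this]
  exact (h_deriv hw).trans H.nu

lemma fp_deriv_lower {w : ℂ} (hw : ‖w‖ ≤ 1) : 9/10 ≤ ‖(fp l h).derivative.eval w‖ := by
  have h1 := fp_deriv H hw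
  have h3 := norm_sub_norm_le l ((fp l h).derivative.eval w)
  rw [norm_sub_rev, H.l1] at h3
  linarith

lemma fp_deriv_upper {w : ℂ} (hw : ‖w‖ ≤ 1) : ‖(fp l h).derivative.eval w‖ ≤ 11/10 := by
  have h1 := fp_deriv H hw
  have h3 := norm_sub_norm_le ((fp l h).derivative.eval w) l
  rw [H.l1] at h3
  linarith

lemma fp_dvd : Polynomial.X ∣ fp l h := by
  rw [Polynomial.X_dvd_iff, Polynomial.coeff_zero_eq_eval_zero, fp_zero H]
end

/-- coefficients functionals -/
noncomputable def ell (l : ℂ) (h : Polynomial ℂ) (n k : ℕ) : ℂ :=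
  PowerSeries.coeff (n+1) (dlin l h (Polynomial.X^k))
noncomputable def mm (l : ℂ) (h : Polynomial ℂ) (n k : ℕ) : ℂ :=
  PowerSeries.coeff (n+1) ((lin l h)^k)

noncomputable def LF (e : ℕ → ℂ) (n : ℕ) (Y : Polynomial ℂ) : ℂ :=
  ∑ k ∈ Finset.Icc 2 (n+1), e k * Y.coeff k

lemma LF_add (e n Y Z) : LF e n (Y + Z) = LF e n Y + LF e n Z := by
  simp [LF, mul_add, Finset.sum_add_distrib]
lemma LF_sub (e n Y Z) : LF e n (Y - Z) = LF e n Y - LF e n Z := by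
  simp [LF, mul_sub, Finset.sum_sub_distrib]
lemma LF_smul (e n) (c : ℂ) (Y) : LF e n (Polynomial.C c * Y) = c * LF e n Y := by
  simp only [LF, Polynomial.coeff_C_mul, Finset.mul_sum]
  exact Finset.sum_congr rfl fun k _ => by ring

lemma LF_bound {e : ℕ → ℂ} {n : ℕ} {Q b : ℝ} {Y : Polynomial ℂ} (hQ : 0 ≤ Q)
    (he : ∀ k, 2 ≤ k → k ≤ n+1 → ‖e k‖ ≤ Q)
    (hY : ∀ k, k ≤ n+1 → ‖Y.coeff k‖ ≤ b) : ‖LF e n Y‖ ≤ n * (Q * b) := by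
  refine (norm_sum_le _ _).trans ((Finset.sum_le_card_nsmul _ _ (Q*b) ?_).trans (by simp))
  intro k hk
  rw [Finset.mem_Icc] at hk
  rw [norm_mul]
  have := he k hk.1 hk.2
  have := hY k hk.2
  gcongr

lemma dlin_zero (l : ℂ) (hl : NR l) (h : Polynomial ℂ) (hh : Polynomial.X^2 ∣ h) : dlin l h 0 = 0 := by
  have := dlin_smul l hl h 0 0 hh (dvd_zero _)
  simpa using this

lemma dlin_sum (l : ℂ) (hl : NR l) (h : Polynomial ℂ) (hh : Polynomial.X^2 ∣ h) (c : ℕ → ℂ)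
    (s : Finset ℕ) (hs : ∀ k ∈ s, 2 ≤ k) :
    dlin l h (∑ k ∈ s, Polynomial.C (c k) * Polynomial.X^k) =
      ∑ k ∈ s, PowerSeries.C (c k) * dlin l h (Polynomial.X^k) := by
  induction s using Finset.induction_on with
  | empty => simp [dlin_zero l hl h hh]
  | insert a s ha ih =>
    have h2 : 2 ≤ a := hs a (Finset.mem_insert_self _ _)
    have h1 : ∀ k ∈ s, 2 ≤ k := fun k hk => hs k (Finset.mem_insert_of_mem hk)
    have d : ∀ k, 2 ≤ k → (Polynomial.X:Polynomial ℂ)^2 ∣ Polynomial.X^k := fun k hk => pow_dvd_pow _ hk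
    rw [Finset.sum_insert ha, Finset.sum_insert ha, dlin_add l hl h _ _ hh
      ((d a h2).mul_left _) (Finset.dvd_sum fun k hk => (d k (h1 k hk)).mul_left _), ih h1,
      dlin_smul l hl h _ _ hh (d a h2)]

lemma LF_ell {l : ℂ} (hl : NR l) {h : Polynomial ℂ} (hh : Polynomial.X^2 ∣ h) (n : ℕ) {Y : Polynomial ℂ}
    (hY : Polynomial.X^2 ∣ Y) : PowerSeries.coeff (n+1) (dlin l h Y) = LF (ell l h n) n Y := by
  set Y1 : Polynomial ℂ := ∑ k ∈ Finset.Icc 2 (n+1), Polynomial.C (Y.coeff k) * Polynomial.X^k with hY1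
  have hc1 : ∀ j, Y1.coeff j = if j ∈ Finset.Icc 2 (n+1) then Y.coeff j else 0 := by
    intro j
    rw [hY1, Polynomial.finsetSum_coeff]
    simp only [Polynomial.coeff_C_mul, Polynomial.coeff_X_pow, mul_ite, mul_one, mul_zero]
    rw [Finset.sum_ite_eq]
  have hd : Polynomial.X^(n+2) ∣ Y - Y1 := by
    rw [Polynomial.X_pow_dvd_iff]
    intro j hj
    rw [Polynomial.coeff_sub, hc1]
    by_cases h2 : 2 ≤ j
    · rw [if_pos (by rw [Finset.mem_Icc]; omega), sub_self]
    · rw [if_neg (by rw [Finset.mem_Icc]; omega), sub_zero]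
      exact Polynomial.X_pow_dvd_iff.mp hY j (by omega)
  have hY1d : Polynomial.X^2 ∣ Y1 := Finset.dvd_sum fun k hk =>
    (pow_dvd_pow _ (Finset.mem_Icc.mp hk).1).mul_left _
  have : Y = Y1 + (Y - Y1) := by ring
  rw [this, dlin_add l hl h _ _ hh hY1d ((pow_dvd_pow _ (by omega)).trans hd), map_add]
  have h0 := (dlin_order l hl h _ n hh hd).1
  rw [PowerSeries.X_pow_dvd_iff.mp h0 (n+1) (by omega), add_zero, ← this]
  rw [dlin_sum l hl h hh _ _ (fun k hk => (Finset.mem_Icc.mp hk).1), map_sum]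
  apply Finset.sum_congr rfl
  intro k _
  rw [PowerSeries.coeff_C_mul, ell, mul_comm]

lemma LF_mm (l : ℂ) (h : Polynomial ℂ) (n : ℕ) {Y : Polynomial ℂ}
    (hY : Polynomial.X^2 ∣ Y) :
    PowerSeries.coeff (n+1) (Polynomial.aeval (lin l h) Y) = LF (mm l h n) n Y := by
  rw [coeff_aeval (X_dvd_lin l h), LF]
  symm
  refine Eq.trans ?_ (Finset.sum_subset (s₁ := Finset.Icc 2 (n+1)) ?_ ?_)
  · apply Finset.sum_congr rfl
    intro k _; rw [mm, mul_comm]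
  · intro k; simp
  · intro k hk hk2
    rw [Polynomial.X_pow_dvd_iff.mp hY k (by simp at hk hk2; omega), zero_mul]

section
variable {l : ℂ} {h : Polynomial ℂ} (H : Hyp l h)
include H

lemma X2_comp {Y : Polynomial ℂ} (hY : Polynomial.X^2 ∣ Y) : Polynomial.X^2 ∣ Y.comp (fp l h) := by
  obtain ⟨g, rfl⟩ := hY
  rw [Polynomial.mul_comp, Polynomial.pow_comp, Polynomial.X_comp]
  exact (pow_dvd_pow_of_dvd (fp_dvd H) 2).mul_right _

lemma ell_comp (n : ℕ) {Y : Polynomial ℂ} (hY : Polynomial.X^2 ∣ Y) :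
    LF (ell l h n) n (Y.comp (fp l h)) =
      LF (ell l h n) n ((fp l h).derivative * Y) + LF (mm l h n) n Y := by
  have h1 := dlin_comp l H.nr h Y H.X2 hY
  rw [show Polynomial.C l * Polynomial.X + h = fp l h from rfl] at h1
  have h2 := congrArg (PowerSeries.coeff (n+1)) h1
  rw [LF_mm l h n hY, LF_ell H.nr H.X2 n (dvd_sub (X2_comp H hY) (hY.mul_left _)), LF_sub] at h2
  rw [← h2]; ring

lemma mm_comp (n : ℕ) {Y : Polynomial ℂ} (hY : Polynomial.X^2 ∣ Y) :
    LF (mm l h n) n (Y.comp (fp l h)) = l^(n+1) * LF (mm l h n) n Y := by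
  rw [← LF_mm l h n hY, ← LF_mm l h n (X2_comp H hY), ← coeff_rescale', rescale_aeval,
    lin_eq' l H.nr h H.X2, Polynomial.aeval_comp]; rfl

lemma ell_top (n : ℕ) (hn : 1 ≤ n) : (l^(n+1) - l) * ell l h n (n+1) = 1 := by
  obtain ⟨m, rfl⟩ : ∃ m, n = m + 1 := ⟨n-1, by omega⟩
  have := (dlin_order l H.nr h (Polynomial.X^(m+2)) m H.X2 dvd_rfl).2
  rw [ell, this, map_pow, Polynomial.aeval_X, coeff_pow_self (X_dvd_lin l h) (lin_one l h)]
end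

/-- truncated Cauchy kernel -/
noncomputable def Kp (n : ℕ) (w : ℂ) : Polynomial ℂ :=
  ∑ k ∈ Finset.Icc 2 (n+1), Polynomial.C (w⁻¹^(k+1)) * Polynomial.X^k

lemma Kp_X2 (n : ℕ) (w : ℂ) : Polynomial.X^2 ∣ Kp n w :=
  Finset.dvd_sum fun _ hk => (pow_dvd_pow _ (Finset.mem_Icc.mp hk).1).mul_left _

lemma Kp_coeff (n : ℕ) (w : ℂ) (j : ℕ) :
    (Kp n w).coeff j = if j ∈ Finset.Icc 2 (n+1) then w⁻¹^(j+1) else 0 := by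
  rw [Kp, Polynomial.finsetSum_coeff]
  simp only [Polynomial.coeff_C_mul, Polynomial.coeff_X_pow, mul_ite, mul_one, mul_zero]
  rw [Finset.sum_ite_eq]

lemma Kp_eval (n : ℕ) (hn : 1 ≤ n) {w y : ℂ} (hw : w ≠ 0) (hwy : w - y ≠ 0) :
    y^2/(w^2*(w-y)) = (Kp n w).eval y + y^(n+2) * (w⁻¹^(n+2) / (w-y)) := by
  have hE : (Kp n w).eval y = ∑ k ∈ Finset.Ico 2 (n+2), w⁻¹^(k+1) * y^k := by
    rw [Kp, Polynomial.eval_finsetSum]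
    apply Finset.sum_congr
    · ext k; simp; omega
    · intros; simp
  rw [hE]
  clear hE
  induction n, hn using Nat.le_induction with
  | base => simp; field_simp; ring
  | succ n hn ih =>
    rw [Finset.sum_Ico_succ_top (by omega), ih]
    simp only [inv_pow]
    field_simp
    ring

lemma Kp_bound {n : ℕ} {w : ℂ} {b : ℝ} (hb : 0 < b) (hb1 : b ≤ 1) (hw : b ≤ ‖w‖) (j : ℕ) :
    ‖(Kp n w).coeff j‖ ≤ (b⁻¹)^(n+2) := by
  rw [Kp_coeff]
  split_ifs with hj
  · rw [Finset.mem_Icc] at hj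
    rw [norm_pow, norm_inv]
    calc (‖w‖⁻¹)^(j+1) ≤ (b⁻¹)^(j+1) := by gcongr
      _ ≤ _ := pow_le_pow_right₀ (by rw [one_le_inv₀ hb]; exact hb1) (by omega)
  · simp; positivity

section
variable {l : ℂ} {h : Polynomial ℂ} (H : Hyp l h)
include H

lemma zstep {n : ℕ} (hn : 1 ≤ n) {w0 w1 : ℂ} {η r : ℝ} (hη : 0 < η) (hη1 : η ≤ 1/2) (hr : 0 < r)
    (hw0 : ‖w0‖ ≤ 1 - η) (hw1 : (fp l h).eval w0 = w1) (hr0 : r ≤ ‖w0‖) (hr1 : r ≤ ‖w1‖)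
    (θ : Polynomial ℂ) (hθ : ∀ y : ℂ, ‖y‖ ≤ 1 → ‖θ.eval y‖ ≤ 11/10)
    (hθ0 : 9/10 ≤ ‖θ.eval w0‖) (k : ℕ) (hk : k ≤ n+1) :
    ‖((Kp n w1).comp (fp l h) -
      Polynomial.C ((θ.eval w0 * (fp l h).derivative.eval w0)⁻¹) * (θ * Kp n w0)).coeff k‖ ≤
      6/(r^2*η) * ((1-η)⁻¹)^(n+2) := by
  set f := fp l h with hf
  set c : ℂ := (θ.eval w0 * f.derivative.eval w0)⁻¹ with hc
  have hw01 : ‖w0‖ ≤ 1 := by linarith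
  have hw0n : w0 ≠ 0 := by rw [← norm_pos_iff]; linarith
  have hw1n : w1 ≠ 0 := by rw [← norm_pos_iff]; linarith
  have hθn : θ.eval w0 ≠ 0 := by rw [← norm_pos_iff]; linarith
  have hfd := fp_deriv_lower H hw01
  have hfn : f.derivative.eval w0 ≠ 0 := by rw [← norm_pos_iff]; linarith
  obtain ⟨g, hg⟩ := Polynomial.X_sub_C_dvd_sub_C_eval (a := w0) (p := f)
  have hgv : ∀ y, f.eval y - w1 = (y - w0) * g.eval y := by
    intro y
    have := congrArg (Polynomial.eval y) hg
    simpa [hw1] using this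
  have hg0 : g.eval w0 = f.derivative.eval w0 := by
    have := congrArg (fun p => (Polynomial.derivative p).eval w0) hg
    simp at this
    exact this.symm
  have hgl : ∀ y : ℂ, ‖y‖ ≤ 1 → 9/10 ≤ ‖g.eval y‖ := by
    intro y hy
    by_cases hyw : y = w0
    · rw [hyw, hg0]; exact hfd
    · have h1 := fp_lower H hy hw01
      rw [← hf, hw1, hgv, norm_mul, mul_comm] at h1
      exact le_of_mul_le_mul_left h1 (norm_pos_iff.mpr (sub_ne_zero.mpr hyw))
  set N : ℂ → ℂ := fun y => (f.eval y)^2/(w1^2 * g.eval y) - c * (θ.eval y * y^2) / w0^2 with hN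
  have hgn : ∀ y ∈ Metric.ball (0:ℂ) 1, g.eval y ≠ 0 := by
    intro y hy
    have hy : ‖y‖ < 1 := by simpa using hy
    have := hgl y hy.le
    rw [← norm_pos_iff]; linarith
  have hNd : DifferentiableOn ℂ N (Metric.ball 0 1) := by
    apply DifferentiableOn.sub
    · apply DifferentiableOn.div
      · exact (f.differentiable.pow 2).differentiableOn
      · exact (g.differentiable.const_mul _).differentiableOn
      · intro y hy
        exact mul_ne_zero (pow_ne_zero _ hw1n) (hgn y hy)
    · apply Differentiable.differentiableOn
      have := θ.differentiable
      fun_prop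
  have hN0 : N w0 = 0 := by
    simp only [hN]
    rw [hw1, hg0, hc]
    field_simp
    ring
  have hw0b : Metric.ball (0:ℂ) 1 ∈ nhds w0 := Metric.isOpen_ball.mem_nhds (by
    simp; linarith)
  set Z : ℂ → ℂ := fun y => - dslope N w0 y with hZ
  have hZd : DifferentiableOn ℂ Z (Metric.ball 0 1) :=
    ((Complex.differentiableOn_dslope hw0b).mpr hNd).neg
  have hZv : ∀ y, y ≠ w0 → Z y = - (N y / (y - w0)) := by
    intro y hy
    rw [hZ]; simp only
    rw [dslope_of_ne _ hy, slope_def_field, hN0, sub_zero]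
  -- Taylor coefficients of Z
  have htc : tc Z k = ((Kp n w1).comp f - Polynomial.C c * (θ * Kp n w0)).coeff k := by
    set P := (Kp n w1).comp f - Polynomial.C c * (θ * Kp n w0) with hP
    obtain ⟨f1, hf1⟩ := fp_dvd H
    set R : ℂ → ℂ := fun y => (f1.eval y)^(n+2) * (w1⁻¹^(n+2) / (w1 - f.eval y)) -
      c * (θ.eval y * (w0⁻¹^(n+2) / (w0 - y))) with hR
    have hf0 : f.eval 0 = 0 := fp_zero H
    have hRa : AnalyticAt ℂ R 0 := by
      apply AnalyticAt.sub
      · apply AnalyticAt.mul ((analytic_poly f1 0).pow _)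
        apply analyticAt_const.div
        · exact analyticAt_const.sub (analytic_poly f 0)
        · rw [hf0, sub_zero]; exact hw1n
      · apply analyticAt_const.mul
        apply (analytic_poly θ 0).mul
        apply analyticAt_const.div
        · exact analyticAt_const.sub analyticAt_id
        · simpa using hw0n
    have heq : Z =ᶠ[nhds 0] fun y => P.eval y + y^(n+2) * R y := by
      have e1 : ∀ᶠ y in nhds (0:ℂ), w0 - y ≠ 0 :=
        (continuous_const.sub continuous_id).continuousAt.eventually_ne (by simpa using hw0n)
      have e2 : ∀ᶠ y in nhds (0:ℂ), w1 - f.eval y ≠ 0 :=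
        (continuous_const.sub f.continuous).continuousAt.eventually_ne (by simpa [hf0] using hw1n)
      filter_upwards [e1, e2] with y h1 h2
      have hne : y ≠ w0 := fun hh => h1 (by rw [hh, sub_self])
      have hy1 : y - w0 ≠ 0 := sub_ne_zero.mpr hne
      have hgy : g.eval y ≠ 0 := by
        intro h0
        apply h2
        have := hgv y
        rw [h0, mul_zero] at this
        rw [← neg_sub, this, neg_zero]
      have k1 := Kp_eval n hn hw1n h2
      have k0 := Kp_eval n hn hw0n h1
      have hfy : f.eval y = y * f1.eval y := by rw [hf, hf1]; simp
      have hPe : P.eval y = (Kp n w1).eval (f.eval y) - c * (θ.eval y * (Kp n w0).eval y) := by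
        simp [hP]
      have hz : Z y = (f.eval y)^2/(w1^2*(w1 - f.eval y)) - c * (θ.eval y * (y^2/(w0^2*(w0-y)))) := by
        rw [hZv y hne]
        simp only [hN]
        have : w1 - f.eval y = -((y - w0) * g.eval y) := by rw [← hgv]; ring
        rw [this, show w0 - y = -(y - w0) by ring]
        generalize y - w0 = u at *
        field_simp
        ring
      rw [hz, k1, k0, hPe, hR]
      simp only
      rw [show (f.eval y)^(n+2) = y^(n+2) * (f1.eval y)^(n+2) by rw [hfy, mul_pow]]
      ring
    rw [tc_congr heq]
    have ha2 : AnalyticAt ℂ (fun y => y^(n+2) * R y) 0 := (analyticAt_id.pow _).mul hRa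
    rw [tc_add (analytic_poly P 0) ha2, tc_poly, tc_shift hRa (by omega), add_zero]
  rw [← htc]
  have hR0 : 0 < 1 - η/2 := by linarith
  have hbd : ∀ y ∈ Metric.sphere (0:ℂ) (1 - η/2), ‖Z y‖ ≤ 6/(r^2*η) := by
    intro y hy
    have hy' : ‖y‖ = 1 - η/2 := by simpa using hy
    have hy1 : ‖y‖ ≤ 1 := by linarith
    have hd : η/2 ≤ ‖y - w0‖ := by
      have := norm_sub_norm_le y w0; linarith
    have hne : y ≠ w0 := by
      intro hh; rw [hh, sub_self, norm_zero] at hd; linarith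
    rw [hZv y hne, norm_neg, norm_div]
    have hNb : ‖N y‖ ≤ 3/r^2 := by
      have n1 : ‖(f.eval y)^2/(w1^2 * g.eval y)‖ ≤ (11/10)^2/(r^2 * (9/10)) := by
        rw [norm_div, norm_mul, norm_pow, norm_pow]
        have a1 : ‖f.eval y‖ ≤ 11/10 := (fp_upper H hy1).trans (by linarith)
        have a2 := hgl y hy1
        gcongr
      have n2 : ‖c * (θ.eval y * y^2) / w0^2‖ ≤ (((9/10)*(9/10))⁻¹ * (11/10 * 1^2))/r^2 := by
        rw [norm_div, norm_mul, norm_mul, norm_pow, norm_pow, hc, norm_inv, norm_mul]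
        have a1 := hθ y hy1
        gcongr
      refine (norm_sub_le _ _).trans ((add_le_add n1 n2).trans ?_)
      rw [show (11/10:ℝ)^2/(r^2 * (9/10)) + (((9/10)*(9/10))⁻¹ * (11/10 * 1^2))/r^2 =
        ((11/10)^2/(9/10) + ((9/10)*(9/10))⁻¹ * (11/10))/r^2 by field_simp]
      gcongr
      norm_num
    calc _ ≤ (3/r^2)/(η/2) := by gcongr
      _ = _ := by field_simp; ring
  have hdc : DiffContOnCl ℂ Z (Metric.ball 0 (1 - η/2)) := by
    apply DifferentiableOn.diffContOnCl
    rw [closure_ball _ hR0.ne']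
    exact hZd.mono (Metric.closedBall_subset_ball (by linarith))
  refine (tc_norm_le hR0 hdc hbd k).trans ?_
  rw [div_eq_mul_inv, ← inv_pow]
  have hx : 1 ≤ (1-η)⁻¹ := by rw [one_le_inv₀ (by linarith)]; linarith
  gcongr
  calc ((1 - η/2)⁻¹)^k ≤ ((1-η)⁻¹)^k := by
        gcongr
        · linarith
        · linarith
    _ ≤ _ := pow_le_pow_right₀ hx (by omega)

lemma fKp_bound {n : ℕ} {w : ℂ} {b : ℝ} (hb : 0 < b) (hb1 : b ≤ 1) (hw : b ≤ ‖w‖) (j : ℕ) :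
    ‖((fp l h).derivative * Kp n w).coeff j‖ ≤ 11/10 * (b⁻¹)^(n+2) := by
  rw [Polynomial.coeff_mul, Finset.Nat.sum_antidiagonal_eq_sum_range_succ_mk]
  have h1 : ∑ k ∈ Finset.range (j+1), ‖(fp l h).derivative.coeff k‖ ≤ 11/10 := by
    have h2 := (deriv_coeff_sum h (j+1)).trans H.nu
    have h3 : ∑ k ∈ Finset.range (j+1), ‖(Polynomial.C l).coeff k‖ ≤ 1 := by
      rw [Finset.sum_eq_single 0]
      · simp [H.l1]
      · intro k _ hk; simp [Polynomial.coeff_C, hk]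
      · simp
    have h4 : (fp l h).derivative = Polynomial.C l + h.derivative := by simp [fp]
    calc _ ≤ ∑ k ∈ Finset.range (j+1), (‖(Polynomial.C l).coeff k‖ + ‖h.derivative.coeff k‖) := by
          apply Finset.sum_le_sum
          intro k _
          rw [h4, Polynomial.coeff_add]; exact norm_add_le _ _
      _ ≤ _ := by rw [Finset.sum_add_distrib]; linarith
  refine (norm_sum_le _ _).trans ?_
  calc _ ≤ ∑ k ∈ Finset.range (j+1), ‖(fp l h).derivative.coeff k‖ * (b⁻¹)^(n+2) := by
        apply Finset.sum_le_sum
        intro k _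
        rw [norm_mul]
        gcongr
        exact Kp_bound hb hb1 hw _
    _ ≤ _ := by rw [← Finset.sum_mul]; gcongr

lemma tele {n : ℕ} (hn : 1 ≤ n) {w : ℕ → ℂ} (hw : ∀ i, w (i+1) = (fp l h).eval (w i)) {j : ℕ}
    {η r D Q : ℝ} (hη : 0 < η) (hη1 : η ≤ 1/2) (hr : 0 < r) (hr1 : r ≤ 1) (hQ : 0 ≤ Q)
    (hwj : 1 - η ≤ ‖w j‖) (hwi : ∀ i < j, ‖w i‖ ≤ 1 - η) (hwr : ∀ i ≤ j, r ≤ ‖w i‖)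
    (hd : ∀ i ≤ j, ‖∏ a ∈ Finset.range i, (fp l h).derivative.eval (w a)‖ ≤ D)
    (hell : ∀ k, 2 ≤ k → k ≤ n+1 → ‖ell l h n k‖ ≤ Q)
    (hmm : ∀ k, 2 ≤ k → k ≤ n+1 → ‖mm l h n k‖ ≤ Q) :
    ‖LF (ell l h n) n ((fp l h).derivative * Kp n (w 0))‖ ≤
      D^2 * (j+2)^2 * (n * (Q * (6/(r^2*η) * ((1-η)⁻¹)^(n+2)))) := by
  set x := ((1-η)⁻¹)^(n+2) with hx
  set z := n * (Q * (6/(r^2*η) * x)) with hz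
  have hx0 : 0 < x := by have : 0 < 1 - η := by linarith
                         positivity
  have hz0 : 0 ≤ z := by positivity
  set f := fp l h with hf
  set d : ℕ → ℂ := fun i => ∏ a ∈ Finset.range i, f.derivative.eval (w a) with hdd
  have hds : ∀ i, d (i+1) = d i * f.derivative.eval (w i) := fun i => Finset.prod_range_succ _ _
  have hd0 : d 0 = 1 := by simp [hdd]
  have hD1 : 1 ≤ D := by have := hd 0 (Nat.zero_le _); simpa using this
  set m : ℕ → ℂ := fun i => LF (mm l h n) n (Kp n (w i)) with hm
  set A : ℕ → ℂ := fun i => LF (ell l h n) n (f.derivative * Kp n (w i)) with hA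
  have h12 : 12 ≤ 6/(r^2*η) := by
    rw [le_div_iff₀ (by positivity)]
    have : r^2 ≤ 1 := pow_le_one₀ hr.le hr1
    nlinarith
  have hmj : ‖m j‖ ≤ z := by
    have hb := LF_bound hQ hmm (fun k _ => Kp_bound (n := n) (show 0 < 1 - η by linarith) (by linarith) hwj k)
    refine hb.trans ?_
    rw [hz, ← hx]
    gcongr
    nlinarith
  have hAj : ‖A j‖ ≤ z := by
    have hb := LF_bound hQ hell (fun k _ => fKp_bound H (n := n) (show 0 < 1 - η by linarith) (by linarith) hwj k)
    refine hb.trans ?_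
    rw [hz, ← hx]
    gcongr ?_ * (?_ * ?_)
    nlinarith
  have hle1 : ∀ i < j, ‖w i‖ ≤ 1 := fun i hi => (hwi i hi).trans (by linarith)
  have hfn : ∀ i < j, f.derivative.eval (w i) ≠ 0 := by
    intro i hi
    have := fp_deriv_lower H (hle1 i hi)
    rw [← norm_pos_iff]; linarith
  -- recursions
  have rm : ∀ i < j, ‖l^(n+1) * m (i+1) - (f.derivative.eval (w i))⁻¹ * m i‖ ≤ z := by
    intro i hi
    have hs := LF_bound hQ hmm (fun k hk => zstep H hn hη hη1 hr (hwi i hi) (hw i).symm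
      (hwr i hi.le) (hwr (i+1) hi) 1 (fun y _ => by simp; norm_num) (by simp; norm_num) k hk)
    rw [LF_sub, LF_smul, mm_comp H n (Kp_X2 n _)] at hs
    rw [Polynomial.eval_one, one_mul, one_mul] at hs
    exact hs
  have rA : ∀ i < j, ‖A (i+1) + m (i+1) - ((f.derivative.eval (w i))⁻¹)^2 * A i‖ ≤ z := by
    intro i hi
    have hs := LF_bound hQ hell (fun k hk => zstep H hn hη hη1 hr (hwi i hi) (hw i).symm
      (hwr i hi.le) (hwr (i+1) hi) f.derivative (fun y hy => fp_deriv_upper H hy)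
      (fp_deriv_lower H (hle1 i hi)) k hk)
    rw [LF_sub, LF_smul, ell_comp H n (Kp_X2 n _)] at hs
    rw [← sq, ← inv_pow] at hs
    exact hs
  have um : ∀ e ≤ j, ‖d (j-e)‖ * ‖m (j-e)‖ ≤ D * z * (1 + e) := by
    intro e
    induction e with
    | zero =>
      intro _
      simp only [Nat.sub_zero, Nat.cast_zero, add_zero, mul_one]
      have := hd j le_rfl
      gcongr
    | succ e ih =>
      intro he
      have ih := ih (by omega)
      set i := j - (e+1) with hi
      have hij : i < j := by omega
      rw [show j - e = i + 1 by omega] at ih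
      have h1 := rm i hij
      have h2 : d i * m i = d (i+1) * ((f.derivative.eval (w i))⁻¹ * m i) := by
        rw [hds]; have := hfn i hij; field_simp
      have h3 : ‖(f.derivative.eval (w i))⁻¹ * m i‖ ≤ ‖m (i+1)‖ + z := by
        have := norm_sub_norm_le ((f.derivative.eval (w i))⁻¹ * m i) (l^(n+1) * m (i+1))
        rw [norm_sub_rev ((f.derivative.eval (w i))⁻¹ * m i), norm_mul (l^(n+1)), norm_pow, H.l1, one_pow, one_mul] at this
        linarith
      rw [← norm_mul, h2, norm_mul]
      have hdi : ‖d (i+1)‖ ≤ D := hd (i+1) hij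
      calc _ ≤ ‖d (i+1)‖ * (‖m (i+1)‖ + z) := by gcongr
        _ = ‖d (i+1)‖ * ‖m (i+1)‖ + ‖d (i+1)‖ * z := by ring
        _ ≤ D * z * (1+e) + D * z := by gcongr
        _ = _ := by push_cast; ring
  have uA : ∀ e ≤ j, ‖d (j-e)‖^2 * ‖A (j-e)‖ ≤ D^2 * z * (1 + e * (j+2)) := by
    intro e
    induction e with
    | zero =>
      intro _
      simp only [Nat.sub_zero, Nat.cast_zero, zero_mul, add_zero, mul_one]
      have := hd j le_rfl
      gcongr
    | succ e ih =>
      intro he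
      have ih := ih (by omega)
      have um := um e (by omega)
      set i := j - (e+1) with hi
      have hij : i < j := by omega
      rw [show j - e = i + 1 by omega] at ih um
      have h1 := rA i hij
      have h2 : d i^2 * A i = d (i+1)^2 * (((f.derivative.eval (w i))⁻¹)^2 * A i) := by
        rw [hds]; have := hfn i hij; field_simp
      have h3 : ‖((f.derivative.eval (w i))⁻¹)^2 * A i‖ ≤ ‖A (i+1)‖ + ‖m (i+1)‖ + z := by
        have := norm_sub_norm_le (((f.derivative.eval (w i))⁻¹)^2 * A i) (A (i+1) + m (i+1))
        rw [norm_sub_rev (((f.derivative.eval (w i))⁻¹)^2 * A i)] at this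
        have := norm_add_le (A (i+1)) (m (i+1))
        linarith
      rw [← norm_pow, ← norm_mul, h2, norm_mul, norm_pow]
      have hdi : ‖d (i+1)‖ ≤ D := hd (i+1) hij
      have hej : (e:ℝ) ≤ j := by exact_mod_cast (by omega : e ≤ j)
      calc _ ≤ ‖d (i+1)‖^2 * (‖A (i+1)‖ + ‖m (i+1)‖ + z) := by gcongr
        _ = ‖d (i+1)‖^2 * ‖A (i+1)‖ + ‖d (i+1)‖ * (‖d (i+1)‖ * ‖m (i+1)‖) + ‖d (i+1)‖^2 * z := by ring
        _ ≤ D^2 * z * (1 + e * (j+2)) + D * (D * z * (1 + e)) + D^2 * z := by gcongr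
        _ ≤ D^2 * z * (1 + e * (j+2)) + D * (D * z * (1 + j)) + D^2 * z := by gcongr
        _ = _ := by push_cast; ring
  have := uA j le_rfl
  rw [Nat.sub_self, hd0, norm_one, one_pow, one_mul] at this
  refine this.trans ?_
  rw [mul_right_comm]
  gcongr
  have : (0:ℝ) ≤ j := by positivity
  nlinarith

omit H in
/-- the polynomial `w^(n+2) A(w)` -/
lemma exists_Pp (l : ℂ) (h : Polynomial ℂ) (n : ℕ) : ∃ P : Polynomial ℂ,
    (∀ w : ℂ, w ≠ 0 → P.eval w = w^(n+2) * LF (ell l h n) n ((fp l h).derivative * Kp n w)) ∧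
    (1 ≤ n → P.eval 0 = LF (ell l h n) n ((fp l h).derivative * Polynomial.X^(n+1))) := by
  set f := fp l h
  refine ⟨∑ k ∈ Finset.Icc 2 (n+1), Polynomial.C (LF (ell l h n) n (f.derivative * Polynomial.X^k)) *
    Polynomial.X^(n+1-k), ?_, ?_⟩
  · intro w hw
    have h1 : ∀ s : Finset ℕ, LF (ell l h n) n (f.derivative * ∑ k ∈ s, Polynomial.C (w⁻¹^(k+1)) * Polynomial.X^k)
      = ∑ k ∈ s, w⁻¹^(k+1) * LF (ell l h n) n (f.derivative * Polynomial.X^k) := by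
      intro s
      induction s using Finset.induction_on with
      | empty => simp [LF]
      | insert a s ha ih =>
        rw [Finset.sum_insert ha, Finset.sum_insert ha, mul_add, LF_add, ih, mul_left_comm, LF_smul]
    rw [Kp, h1, Polynomial.eval_finsetSum, Finset.mul_sum]
    apply Finset.sum_congr rfl
    intro k hk
    rw [Finset.mem_Icc] at hk
    simp only [Polynomial.eval_mul, Polynomial.eval_C, Polynomial.eval_pow, Polynomial.eval_X]
    rw [show n + 2 = (n+1-k) + (k+1) by omega, pow_add w (n+1-k) (k+1)]
    have : w^(k+1) * w⁻¹^(k+1) = 1 := by rw [← mul_pow, mul_inv_cancel₀ hw, one_pow]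
    linear_combination (-(w^(n+1-k)) * LF (ell l h n) n (f.derivative * Polynomial.X^k)) * this
  · intro hn
    rw [Polynomial.eval_finsetSum, Finset.sum_eq_single (n+1)]
    · simp
    · intro k hk hk2
      rw [Finset.mem_Icc] at hk
      have : n + 1 - k ≠ 0 := by omega
      simp [this]
    · intro h; exfalso; apply h; simp; omega

lemma Pp_zero {n : ℕ} (hn : 1 ≤ n) : ‖l^n - 1‖ *
    ‖LF (ell l h n) n ((fp l h).derivative * Polynomial.X^(n+1))‖ = 1 := by
  have h1 : LF (ell l h n) n ((fp l h).derivative * Polynomial.X^(n+1)) = ell l h n (n+1) * l := by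
    rw [LF, Finset.sum_eq_single (n+1)]
    · rw [Polynomial.coeff_mul_X_pow', if_pos le_rfl, Nat.sub_self]
      have : (fp l h).derivative.coeff 0 = l := by
        have hc1 : h.coeff 1 = 0 := Polynomial.X_pow_dvd_iff.mp H.X2 1 (by omega)
        simp [fp, Polynomial.coeff_derivative, hc1]
      rw [this]
    · intro k hk hk2
      rw [Finset.mem_Icc] at hk
      rw [Polynomial.coeff_mul_X_pow', if_neg (by omega), mul_zero]
    · intro h; exfalso; apply h; simp; omega
  have h2 := ell_top H n hn
  rw [h1, ← norm_mul, show (l^n - 1) * (ell l h n (n+1) * l) = (l^(n+1) - l) * ell l h n (n+1) by ring,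
    h2, norm_one]
end
end QL

namespace QL

lemma det_smul (c : ℂ) :
    |((ContinuousLinearMap.toSpanSingleton ℂ c).restrictScalars ℝ : ℂ →L[ℝ] ℂ).det| = ‖c‖^2 := by
  have h1 : (((ContinuousLinearMap.toSpanSingleton ℂ c).restrictScalars ℝ : ℂ →L[ℝ] ℂ) : ℂ →ₗ[ℝ] ℂ)
      = Algebra.lmul ℝ ℂ c := by
    ext z; simp [mul_comm]
  have h2 : LinearMap.det (Algebra.lmul ℝ ℂ c) = Algebra.norm ℝ c := rfl
  rw [ContinuousLinearMap.det, h1, h2, Algebra.norm_complex_apply, Complex.normSq_eq_norm_sq,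
    abs_of_nonneg (by positivity)]

lemma area_le {F : ℂ → ℂ} (hF : Differentiable ℂ F) {Ω : Set ℂ} (hΩ : MeasurableSet Ω)
    (hi : Set.InjOn F Ω) (hb : ∀ w ∈ Ω, ‖F w‖ < 1) :
    ∫⁻ w in Ω, ENNReal.ofReal (‖deriv F w‖^2) ≤ ENNReal.ofReal Real.pi := by
  have h := lintegral_abs_det_fderiv_eq_addHaar_image (volume : Measure ℂ) hΩ
    (f := F) (f' := fun w => (ContinuousLinearMap.toSpanSingleton ℂ (deriv F w)).restrictScalars ℝ)
    (fun w _ => ((hF w).hasDerivAt.hasFDerivAt.restrictScalars ℝ).hasFDerivWithinAt) hi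
  simp only [det_smul] at h
  rw [h]
  refine (measure_mono (t := Metric.ball 0 1) ?_).trans ?_
  · rintro _ ⟨w, hw, rfl⟩
    simpa using hb w hw
  · rw [Complex.volume_ball]
    simp [ENNReal.ofReal, NNReal.pi, Real.toNNReal_of_nonneg Real.pi_pos.le]
    exact le_refl _

/-- polar coordinates around `a`, as an inequality, restricted to radii in `(A,B)`. -/
lemma polar_eq (G : ℂ → ENNReal) (hG : Measurable G) (a : ℂ) :
    ∫⁻ s in Set.Ioi (0:ℝ), ENNReal.ofReal s *
      ∫⁻ θ in Set.Ioo (-Real.pi) Real.pi, G (a + s * Complex.exp (θ * Complex.I)) = ∫⁻ w, G w := by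
  have h1 : ∫⁻ w, G w = ∫⁻ w, G (a + w) := (lintegral_add_left_eq_self G a).symm
  rw [h1, ← Complex.lintegral_comp_polarCoord_symm (fun w => G (a + w))]
  rw [show polarCoord.target = Set.Ioi (0:ℝ) ×ˢ Set.Ioo (-Real.pi) Real.pi from rfl]
  rw [Measure.volume_eq_prod, ← Measure.prod_restrict, lintegral_prod]
  · apply lintegral_congr
    intro s
    simp only [smul_eq_mul]
    rw [lintegral_const_mul]
    · congr 1
      apply lintegral_congr
      intro θ
      simp only [Complex.polarCoord_symm_apply, Complex.exp_mul_I, Complex.ofReal_cos, Complex.ofReal_sin]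
    · apply hG.comp
      simp only [Complex.polarCoord_symm_apply]
      fun_prop
  · apply Measurable.aemeasurable
    apply Measurable.mul
    · fun_prop
    · apply hG.comp
      apply measurable_const.add
      have : (Complex.polarCoord.symm : ℝ × ℝ → ℂ) = fun p => (p.1:ℂ) * (Real.cos p.2 + Real.sin p.2 * Complex.I) :=
        funext Complex.polarCoord_symm_apply
      rw [this]
      fun_prop

lemma exists_radius (Φ : ℝ → ENNReal) {A B κ M : ℝ} (hA : 0 < A) (hAB : A < B)
    (hΦ : ∫⁻ s in Set.Ioi (0:ℝ), ENNReal.ofReal s * Φ s ≤ ENNReal.ofReal M)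
    (hM : M < κ * Real.log (B/A)) (hκ : 0 < κ) :
    ∃ s ∈ Set.Icc A B, ENNReal.ofReal (s^2) * Φ s ≤ ENNReal.ofReal κ := by
  by_contra! hcon
  have hlog : 0 < Real.log (B/A) := Real.log_pos (by rwa [one_lt_div hA])
  have h2 : ∀ s ∈ Set.Ioc A B, ENNReal.ofReal (κ * s⁻¹) ≤ ENNReal.ofReal s * Φ s := by
    intro s hs
    have hs0 : 0 < s := hA.trans hs.1
    have := (hcon s ⟨hs.1.le, hs.2⟩).le
    rw [mul_comm κ, ENNReal.ofReal_mul (by positivity)]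
    calc _ ≤ ENNReal.ofReal s⁻¹ * (ENNReal.ofReal (s^2) * Φ s) := by gcongr
      _ = _ := by
        rw [← mul_assoc, ← ENNReal.ofReal_mul (by positivity)]
        congr 2; field_simp
  have h3 : ∫⁻ s in Set.Ioc A B, ENNReal.ofReal (κ * s⁻¹) = ENNReal.ofReal (κ * Real.log (B/A)) := by
    have hintg : IntervalIntegrable (fun s : ℝ => κ * s⁻¹) volume A B := by
      apply IntervalIntegrable.const_mul
      apply intervalIntegral.intervalIntegrable_inv
      · intro x hx; rw [Set.uIcc_of_le hAB.le] at hx; linarith [hx.1]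
      · exact continuousOn_id
    rw [← ofReal_integral_eq_lintegral_ofReal]
    · rw [← intervalIntegral.integral_of_le hAB.le, intervalIntegral.integral_const_mul,
        integral_inv_of_pos hA (hA.trans hAB)]
    · exact hintg.1
    · filter_upwards [ae_restrict_mem measurableSet_Ioc] with s hs
      have := hA.trans hs.1
      simp only [Pi.zero_apply]
      positivity
  have h4 : ENNReal.ofReal (κ * Real.log (B/A)) ≤ ENNReal.ofReal M := by
    rw [← h3]
    refine le_trans ?_ hΦ
    refine (setLIntegral_mono' measurableSet_Ioc h2).trans ?_
    exact lintegral_mono_set (fun s hs => hA.trans hs.1)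
  rw [ENNReal.ofReal_le_ofReal_iff'] at h4
  have : 0 < κ * Real.log (B/A) := by positivity
  rcases h4 with h | h <;> linarith

def Om (F : ℕ → ℂ → ℂ) (T : ℕ) : Set ℂ := {w | ∀ i ≤ T, ‖F i w‖ < 1}

lemma Om_open {F : ℕ → ℂ → ℂ} (hF : ∀ i, Differentiable ℂ (F i)) (T : ℕ) : IsOpen (Om F T) := by
  have : Om F T = ⋂ i ∈ Set.Iic T, {w | ‖F i w‖ < 1} := by
    ext w; simp [Om]
  rw [this]
  apply Set.Finite.isOpen_biInter (Set.finite_Iic T)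
  intro i _
  exact isOpen_lt (hF i).continuous.norm continuous_const

/-- On a suitable circle, all image lengths are small. -/
lemma good_circle {F : ℕ → ℂ → ℂ} (hF : ∀ i, Differentiable ℂ (F i)) {T : ℕ}
    (hinj : ∀ i ≤ T, Set.InjOn (F i) (Om F T)) {A B η : ℝ} (hA : 0 < A) (hAB : A < B) (hη : 0 < η)
    (hL : 4 * Real.pi^2 * (T+1) ≤ η^2 * Real.log (B/A)) (a : ℂ) :
    ∃ s ∈ Set.Icc A B, ∀ i ≤ T, ∫⁻ θ in Set.Ioo (-Real.pi) Real.pi,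
      (Om F T).indicator (fun w => ENNReal.ofReal (s * ‖deriv (F i) w‖))
        (a + s * Complex.exp (θ * Complex.I)) ≤ ENNReal.ofReal η := by
  have hpi := Real.pi_pos
  set Ω := Om F T with hΩdef
  have hΩm : MeasurableSet Ω := (Om_open hF T).measurableSet
  have hdm : ∀ i, Continuous (deriv (F i)) := fun i =>
    ((hF i).contDiff (n := 1)).continuous_deriv (by norm_num)
  set g : ℕ → ℂ → ENNReal := fun i => Ω.indicator (fun w => ENNReal.ofReal (‖deriv (F i) w‖^2)) with hg
  have hgm : ∀ i, Measurable (g i) := by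
    intro i
    apply Measurable.indicator _ hΩm
    have := (hdm i).measurable
    fun_prop
  set G : ℂ → ENNReal := fun w => ∑ i ∈ Finset.range (T+1), g i w with hG
  have hGm : Measurable G := by
    apply Finset.measurable_fun_sum
    intro i _; exact hgm i
  have hGint : ∫⁻ w, G w ≤ ENNReal.ofReal ((T+1) * Real.pi) := by
    rw [hG, lintegral_finsetSum _ (fun i _ => hgm i)]
    refine (Finset.sum_le_card_nsmul _ _ (ENNReal.ofReal Real.pi) ?_).trans ?_
    · intro i hi
      have hi' : i ≤ T := by have := Finset.mem_range.mp hi; omega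
      rw [hg, lintegral_indicator hΩm]
      exact area_le (hF i) hΩm (hinj i hi') (fun w hw => hw i hi')
    · rw [Finset.card_range, nsmul_eq_mul, ENNReal.ofReal_mul (by positivity)]
      apply le_of_eq
      congr 1
      rw [show ((T:ℝ)+1) = ((T+1:ℕ):ℝ) by push_cast; ring, ENNReal.ofReal_natCast]
  have hlog : 0 < Real.log (B/A) := Real.log_pos (by rwa [one_lt_div hA])
  set κ := η^2/(2*Real.pi) with hκ
  have hκ0 : 0 < κ := by positivity
  obtain ⟨s, hs, hsκ⟩ := exists_radius (fun s => ∫⁻ θ in Set.Ioo (-Real.pi) Real.pi,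
    G (a + s * Complex.exp (θ * Complex.I))) (M := (T+1) * Real.pi) (κ := κ) hA hAB
    ((polar_eq G hGm a).trans_le hGint) (by
      rw [hκ, div_mul_eq_mul_div, lt_div_iff₀ (by positivity)]
      have : 0 < Real.pi^2 * (T+1) := by positivity
      nlinarith) hκ0
  refine ⟨s, hs, fun i hi => ?_⟩
  have hs0 : 0 < s := hA.trans_le hs.1
  have hpt : ∀ w, Ω.indicator (fun w => ENNReal.ofReal (s * ‖deriv (F i) w‖)) w ≤
      ENNReal.ofReal (η/(4*Real.pi)) + ENNReal.ofReal (Real.pi/η) * (ENNReal.ofReal (s^2) * G w) := by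
    intro w
    by_cases hw : w ∈ Ω
    · rw [Set.indicator_of_mem hw]
      have h1 : g i w ≤ G w := Finset.single_le_sum (f := fun i => g i w)
        (fun _ _ => zero_le) (Finset.mem_range.mpr (by omega))
      have h2 : g i w = ENNReal.ofReal (‖deriv (F i) w‖^2) := by
        rw [hg]; exact Set.indicator_of_mem hw _
      rw [h2] at h1
      refine le_trans ?_ (add_le_add_right (mul_le_mul_right (mul_le_mul_right h1 _) _) _)
      rw [← ENNReal.ofReal_mul (by positivity), ← ENNReal.ofReal_mul (by positivity),
        ← ENNReal.ofReal_add (by positivity) (by positivity)]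
      apply ENNReal.ofReal_le_ofReal
      set x := s * ‖deriv (F i) w‖
      have : s^2 * ‖deriv (F i) w‖^2 = x^2 := by ring
      rw [this]
      have h3 : η/(4*Real.pi) + Real.pi/η * x^2 - x = (η - 2*Real.pi*x)^2/(4*Real.pi*η) := by
        field_simp; ring
      have h4 : 0 ≤ (η - 2*Real.pi*x)^2/(4*Real.pi*η) := by positivity
      linarith
    · rw [Set.indicator_of_notMem hw]; exact zero_le
  refine (lintegral_mono (fun θ => hpt _)).trans ?_
  rw [lintegral_add_left measurable_const, setLIntegral_const, Real.volume_Ioo]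
  have hcm : Measurable fun θ : ℝ => G (a + s * Complex.exp (θ * Complex.I)) :=
    hGm.comp (by fun_prop)
  rw [lintegral_const_mul _ (hcm.const_mul _), lintegral_const_mul _ hcm]
  calc _ ≤ ENNReal.ofReal (η/(4*Real.pi)) * ENNReal.ofReal (Real.pi - -Real.pi) +
        ENNReal.ofReal (Real.pi/η) * ENNReal.ofReal κ := by gcongr
    _ = ENNReal.ofReal η := by
      rw [← ENNReal.ofReal_mul (by positivity), ← ENNReal.ofReal_mul (by positivity),
        ← ENNReal.ofReal_add (by apply mul_nonneg <;> [positivity; linarith]) (by positivity)]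
      congr 1
      rw [hκ]; field_simp; ring

lemma circle_exit {F : ℕ → ℂ → ℂ} (hF : ∀ i, Differentiable ℂ (F i)) {T : ℕ} {s η : ℝ} (hs : 0 < s)
    (hη : 0 < η) {a : ℂ} (ha : a ∉ Om F T)
    (hlen : ∀ i ≤ T, ∫⁻ θ in Set.Ioo (-Real.pi) Real.pi,
      (Om F T).indicator (fun w => ENNReal.ofReal (s * ‖deriv (F i) w‖))
        (a + s * Complex.exp (θ * Complex.I)) ≤ ENNReal.ofReal η)
    {w : ℂ} (hw : w ∈ Om F T) (hwa : ‖w - a‖ = s) : ∃ i ≤ T, 1 - η ≤ ‖F i w‖ := by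
  have hpi := Real.pi_pos
  set γ : ℝ → ℂ := fun θ => a + s * Complex.exp (θ * Complex.I) with hγ
  have hγc : Continuous γ := by fun_prop
  have hγs : ∀ z : ℂ, ‖z - a‖ = s → ∃ θ ∈ Set.Icc (-Real.pi) Real.pi, γ θ = z := by
    intro z hz
    refine ⟨Complex.arg (z - a), ⟨(Complex.neg_pi_lt_arg _).le, Complex.arg_le_pi _⟩, ?_⟩
    have := Complex.norm_mul_exp_arg_mul_I (z - a)
    rw [hz] at this
    rw [hγ]; simp only; rw [this]; ring
  have hΩo := Om_open hF T
  -- the circle leaves Ω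
  have hex : ∃ z, ‖z - a‖ = s ∧ z ∉ Om F T := by
    by_contra! hcon
    apply ha
    intro i hi
    have hb : ∀ z ∈ frontier (Metric.ball a s), ‖F i z‖ < 1 := by
      intro z hz
      rw [frontier_ball _ hs.ne'] at hz
      exact hcon z (by rw [← dist_eq_norm]; exact hz) i hi
    have hcomp : IsCompact (frontier (Metric.ball a s)) := by
      rw [frontier_ball _ hs.ne']; exact isCompact_sphere _ _
    have hne : (frontier (Metric.ball a s)).Nonempty := by
      rw [frontier_ball _ hs.ne']; exact ⟨w, by rw [Metric.mem_sphere, dist_eq_norm, hwa]⟩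
    obtain ⟨z0, hz0, hmax⟩ := hcomp.exists_isMaxOn hne (hF i).continuous.norm.continuousOn
    refine lt_of_le_of_lt ?_ (hb z0 hz0)
    exact Complex.norm_le_of_forall_mem_frontier_norm_le Metric.isBounded_ball
      (hF i).diffContOnCl (fun z hz => hmax hz) (subset_closure (Metric.mem_ball_self hs))
  obtain ⟨z, hz, hzΩ⟩ := hex
  obtain ⟨θ0, hθ0, hγ0⟩ := hγs w hwa
  obtain ⟨θz, hθz, hγz⟩ := hγs z hz
  set S : Set ℝ := Set.Icc (-Real.pi) Real.pi ∩ {θ | γ θ ∉ Om F T} with hS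
  have hSc : IsCompact S := by
    apply isCompact_Icc.inter_right
    exact (hΩo.preimage hγc).isClosed_compl
  obtain ⟨θ1, hθ1, hmin⟩ := hSc.exists_isMinOn ⟨θz, hθz, by simpa [hγz] using hzΩ⟩
    (f := fun θ => |θ - θ0|) (by fun_prop)
  obtain ⟨i, hi, hFi⟩ : ∃ i ≤ T, 1 ≤ ‖F i (γ θ1)‖ := by
    have := hθ1.2
    simp only [Set.mem_ofPred_eq, Om, not_forall, not_lt] at this
    obtain ⟨i, hi, h⟩ := this
    exact ⟨i, hi, h⟩
  refine ⟨i, hi, ?_⟩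
  have hd : ∀ θ : ℝ, HasDerivAt (fun θ : ℝ => F i (γ θ))
      (deriv (F i) (γ θ) * (s * (Complex.exp (θ * Complex.I) * Complex.I))) θ := by
    intro θ
    have h1 : HasDerivAt γ (s * (Complex.exp (θ * Complex.I) * Complex.I)) θ := by
      have h0 : HasDerivAt (fun θ : ℝ => (θ:ℂ) * Complex.I) (1 * Complex.I) θ :=
        (Complex.ofRealCLM.hasDerivAt (x := θ)).mul_const _
      rw [one_mul] at h0
      exact (h0.cexp.const_mul _).const_add _
    exact ((hF i) (γ θ)).hasDerivAt.comp θ h1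
  have hdc : Continuous (deriv (F i)) := ((hF i).contDiff (n := 1)).continuous_deriv (by norm_num)
  have hintg : ∫ θ in θ0..θ1, deriv (F i) (γ θ) * (s * (Complex.exp (θ * Complex.I) * Complex.I)) =
      F i (γ θ1) - F i (γ θ0) := by
    apply intervalIntegral.integral_eq_sub_of_hasDerivAt (fun θ _ => hd θ)
    apply Continuous.intervalIntegrable
    fun_prop
  have hnorm : ∀ θ : ℝ, ‖deriv (F i) (γ θ) * (s * (Complex.exp (θ * Complex.I) * Complex.I))‖ =
      s * ‖deriv (F i) (γ θ)‖ := by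
    intro θ
    simp [Complex.norm_exp_ofReal_mul_I, abs_of_pos hs]; ring
  have hle : ‖F i (γ θ1) - F i (γ θ0)‖ ≤ η := by
    rw [← hintg]
    refine intervalIntegral.norm_integral_le_integral_norm_uIoc.trans ?_
    simp only [hnorm]
    rw [integral_eq_lintegral_of_nonneg_ae (Eventually.of_forall fun θ => by positivity)
      (by apply Continuous.aestronglyMeasurable; fun_prop)]
    apply ENNReal.toReal_le_of_le_ofReal hη.le
    refine le_trans ?_ (hlen i hi)
    rw [show Set.uIoc θ0 θ1 = Set.Ioc (min θ0 θ1) (max θ0 θ1) from rfl, ← restrict_Ioo_eq_restrict_Ioc]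
    rw [← lintegral_indicator measurableSet_Ioo, ← lintegral_indicator measurableSet_Ioo]
    apply lintegral_mono
    intro θ
    by_cases hθ : θ ∈ Set.Ioo (min θ0 θ1) (max θ0 θ1)
    · have hin : θ ∈ Set.Ioo (-Real.pi) Real.pi := by
        have := hθ0.1; have := hθ0.2; have := hθ1.1.1; have := hθ1.1.2
        constructor
        · exact lt_of_le_of_lt (le_min hθ0.1 hθ1.1.1) hθ.1
        · exact lt_of_lt_of_le hθ.2 (max_le hθ0.2 hθ1.1.2)
      have hom : γ θ ∈ Om F T := by
        by_contra hno
        have h1 := hmin (show θ ∈ S from ⟨⟨hin.1.le, hin.2.le⟩, hno⟩)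
        simp only [Set.mem_ofPred_eq] at h1
        rw [Set.mem_Ioo] at hθ
        rcases le_total θ0 θ1 with h | h
        · rw [min_eq_left h, max_eq_right h] at hθ
          rw [abs_of_nonneg (by linarith), abs_of_nonneg (by linarith)] at h1
          linarith
        · rw [min_eq_right h, max_eq_left h] at hθ
          rw [abs_of_nonpos (by linarith), abs_of_nonpos (by linarith)] at h1
          linarith
      rw [Set.indicator_of_mem hθ, Set.indicator_of_mem hin]
      change _ ≤ (Om F T).indicator _ (γ θ)
      rw [Set.indicator_of_mem hom]
    · rw [Set.indicator_of_notMem hθ]; exact zero_le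
  have h5 := norm_sub_norm_le (F i (γ θ1)) (F i (γ θ0))
  rw [hγ0] at h5 hle
  linarith

lemma geo {F : ℕ → ℂ → ℂ} (hF : ∀ i, Differentiable ℂ (F i)) (hF0 : F 0 = id) {T : ℕ}
    (hinj : ∀ i ≤ T, Set.InjOn (F i) (Om F T)) {δ B η : ℝ} (hδ : 0 < δ) (hAB : 2*δ < B) (hη : 0 < η)
    (hB : δ ≤ 1)
    (hL : 4 * Real.pi^2 * (T+1) ≤ η^2 * Real.log (B/(2*δ))) :
    ∃ O : Set ℂ, IsOpen O ∧ O ⊆ Om F T ∧ (∀ w, Metric.closedBall w B ⊆ Om F T → w ∈ O) ∧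
      ∀ w ∈ frontier O, Metric.ball w δ ⊆ Om F T ∧ ∃ i ≤ T, 1 - η ≤ ‖F i w‖ := by
  set Ω := Om F T with hΩ
  have hΩo : IsOpen Ω := Om_open hF T
  have hΩ1 : Ω ⊆ Metric.closedBall 0 1 := by
    intro w hw
    have := hw 0 (Nat.zero_le _)
    rw [hF0] at this
    simpa using this.le
  choose s hs hlen using good_circle hF hinj (by positivity : 0 < 2*δ) hAB hη hL
  set K : Set ℂ := Metric.closedBall 0 2 \ Ω with hK
  have hKc : IsCompact K := (isCompact_closedBall _ _).diff hΩo
  obtain ⟨t, htK, htc⟩ := hKc.elim_nhds_subcover (fun a => Metric.ball a (s a - δ)) (fun a _ =>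
    Metric.ball_mem_nhds _ (by linarith [(hs a).1]))
  refine ⟨Ω \ ⋃ a ∈ t, Metric.closedBall a (s a), ?_, Set.sdiff_subset, ?_, ?_⟩
  · apply hΩo.sdiff
    exact t.finite_toSet.isClosed_biUnion (fun a _ => Metric.isClosed_closedBall)
  · intro w hw
    refine ⟨hw (Metric.mem_closedBall_self (by linarith)), ?_⟩
    simp only [Set.mem_iUnion, not_exists]
    intro a hat hwa
    apply (htK a hat).2
    apply hw
    rw [Metric.mem_closedBall, dist_comm]
    exact (Metric.mem_closedBall.mp hwa).trans (hs a).2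
  · intro w hw
    set O := Ω \ ⋃ a ∈ t, Metric.closedBall a (s a) with hO
    have hOo : IsOpen O := by
      apply hΩo.sdiff
      exact t.finite_toSet.isClosed_biUnion (fun a _ => Metric.isClosed_closedBall)
    have hwc : w ∈ closure O := frontier_subset_closure hw
    have hwO : w ∉ O := by
      rw [hOo.frontier_eq] at hw; exact hw.2
    have hnb : ∀ a ∈ t, w ∉ Metric.ball a (s a) := by
      intro a hat hwa
      obtain ⟨y, hy1, hy2⟩ := mem_closure_iff.mp hwc _ Metric.isOpen_ball hwa
      apply hy2.2
      simp only [Set.mem_iUnion]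
      exact ⟨a, hat, Metric.ball_subset_closedBall hy1⟩
    have hw1 : w ∈ Metric.closedBall (0:ℂ) 1 :=
      closure_minimal (Set.sdiff_subset.trans hΩ1) Metric.isClosed_closedBall hwc
    have hw1' : ‖w‖ ≤ 1 := by simpa using hw1
    have hball : Metric.ball w δ ⊆ Ω := by
      intro y hy
      by_contra hyΩ
      have hyw : ‖y - w‖ < δ := by rw [← dist_eq_norm]; exact hy
      have hyK : y ∈ K := by
        refine ⟨?_, hyΩ⟩
        have : ‖y‖ ≤ 2 := by
          calc ‖y‖ = ‖(y - w) + w‖ := by ring_nf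
            _ ≤ ‖y - w‖ + ‖w‖ := norm_add_le _ _
            _ ≤ 2 := by linarith
        simpa using this
      obtain ⟨a, hat, hya⟩ := by simpa using htc hyK
      apply hnb a hat
      have hya : dist y a < s a - δ := hya
      have : dist w a ≤ dist w y + dist y a := dist_triangle _ _ _
      have h3 : dist w y < δ := by rw [dist_comm]; exact hy
      rw [Metric.mem_ball]; linarith
    refine ⟨hball, ?_⟩
    have hwΩ : w ∈ Ω := hball (Metric.mem_ball_self hδ)
    have : w ∈ ⋃ a ∈ t, Metric.closedBall a (s a) := by
      by_contra h; exact hwO ⟨hwΩ, h⟩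
    simp only [Set.mem_iUnion] at this
    obtain ⟨a, hat, hwa⟩ := this
    have heq : ‖w - a‖ = s a := by
      rw [← dist_eq_norm]
      apply le_antisymm hwa
      have := hnb a hat
      rw [Metric.mem_ball, not_lt] at this
      exact this
    exact circle_exit hF (by linarith [(hs a).1]) hη (htK a hat).2 (hlen a) hwΩ heq
end QL

namespace QL

/-- iterates of `fp l h` -/
noncomputable def fi (l : ℂ) (h : Polynomial ℂ) : ℕ → Polynomial ℂ
  | 0 => Polynomial.X
  | i+1 => (fp l h).comp (fi l h i)

section
variable {l : ℂ} {h : Polynomial ℂ}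

lemma fi_eval_succ (i : ℕ) (w : ℂ) :
    (fi l h (i+1)).eval w = (fp l h).eval ((fi l h i).eval w) := by
  simp [fi]

lemma fi_eval_zero (w : ℂ) : (fi l h 0).eval w = w := by simp [fi]

lemma fi_deriv (i : ℕ) (w : ℂ) : (fi l h i).derivative.eval w =
    ∏ a ∈ Finset.range i, (fp l h).derivative.eval ((fi l h a).eval w) := by
  induction i with
  | zero => simp [fi]
  | succ i ih =>
    rw [Finset.prod_range_succ, ← ih, fi, Polynomial.derivative_comp]
    simp

lemma fi_inj (H : Hyp l h) {y w : ℂ} (i : ℕ) (hy : ∀ a < i, ‖(fi l h a).eval y‖ ≤ 1)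
    (hw : ∀ a < i, ‖(fi l h a).eval w‖ ≤ 1) (he : (fi l h i).eval y = (fi l h i).eval w) : y = w := by
  induction i with
  | zero => simpa [fi] using he
  | succ i ih =>
    apply ih (fun a ha => hy a (by omega)) (fun a ha => hw a (by omega))
    have := fp_lower H (hy i (by omega)) (hw i (by omega))
    rw [fi_eval_succ, fi_eval_succ] at he
    rw [he, sub_self, norm_zero] at this
    have h2 := norm_nonneg ((fi l h i).eval y - (fi l h i).eval w)
    exact sub_eq_zero.mp (norm_eq_zero.mp (by linarith))

lemma fi_aeval (H : Hyp l h) (i : ℕ) : Polynomial.aeval (lin l h) (fi l h i) =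
    PowerSeries.rescale (l^i) (lin l h) := by
  induction i with
  | zero => ext k; simp [fi]
  | succ i ih =>
    rw [fi, Polynomial.aeval_comp, ih, ← rescale_aeval, fp, ← lin_eq' l H.nr h H.X2]
    ext k
    simp only [coeff_rescale', pow_succ, mul_pow]; ring

lemma exists_E (H : Hyp l h) (c : ℕ → ℂ) {J q s : ℕ} (hs : 1 ≤ s)
    (hc0 : ∀ m, 1 ≤ m → m ≤ q → ∑ j ∈ Finset.range J, c j * l^(m*j) = 0)
    (hc1 : ∑ j ∈ Finset.range J, c j * l^((q+1)*j) = 1) :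
    ∃ Et : Polynomial ℂ, (∀ w, ∑ j ∈ Finset.range J, c j * ((fi l h j).eval w)^s
      = w^(q+1) * Et.eval w) ∧ Et.eval 0 = PowerSeries.coeff (q+1) ((lin l h)^s) := by
  set ψ := lin l h with hψ
  have hX : PowerSeries.X ∣ ψ := X_dvd_lin l h
  set E : Polynomial ℂ := ∑ j ∈ Finset.range J, Polynomial.C (c j) * (fi l h j)^s with hE
  have hco : ∀ m, PowerSeries.coeff m (Polynomial.aeval ψ E) =
      (∑ j ∈ Finset.range J, c j * l^(m*j)) * PowerSeries.coeff m (ψ^s) := by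
    intro m
    rw [hE, map_sum, map_sum, Finset.sum_mul]
    apply Finset.sum_congr rfl
    intro j _
    rw [map_mul, Polynomial.aeval_C, map_pow, fi_aeval H, ← map_pow]
    have : (algebraMap ℂ (PowerSeries ℂ)) (c j) = PowerSeries.C (c j) := rfl
    rw [this, PowerSeries.coeff_C_mul, coeff_rescale', ← pow_mul, mul_comm j m]; ring
  have hco0 : ∀ m ≤ q, PowerSeries.coeff m (Polynomial.aeval ψ E) = 0 := by
    intro m hm
    rw [hco]
    rcases Nat.eq_zero_or_pos m with rfl | hm0
    · have : PowerSeries.coeff 0 (ψ^s) = 0 := by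
        rw [PowerSeries.coeff_zero_eq_constantCoeff_apply, map_pow,
          PowerSeries.X_dvd_iff.mp hX, zero_pow (by omega)]
      rw [this, mul_zero]
    · rw [hc0 m hm0 hm, zero_mul]
  have hE0 : ∀ m, m ≤ q → E.coeff m = 0 := by
    intro m
    induction m using Nat.strong_induction_on with
    | _ m ih =>
      intro hm
      have := hco0 m hm
      rw [coeff_aeval hX, Finset.sum_range_succ, Finset.sum_eq_zero, zero_add,
        coeff_pow_self hX (lin_one l h), mul_one] at this
      · exact this
      · intro j hj
        rw [ih j (by simpa using hj) (by simp at hj; omega), zero_mul]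
  have hE1 : E.coeff (q+1) = PowerSeries.coeff (q+1) (ψ^s) := by
    have := hco (q+1)
    rw [hc1, one_mul, coeff_aeval hX, Finset.sum_range_succ, Finset.sum_eq_zero, zero_add,
        coeff_pow_self hX (lin_one l h), mul_one] at this
    · exact this
    · intro j hj
      rw [hE0 j (by simp at hj; omega), zero_mul]
  have hdvd : Polynomial.X^(q+1) ∣ E := by
    rw [Polynomial.X_pow_dvd_iff]
    intro d hd
    exact hE0 d (by omega)
  obtain ⟨Et, hEt⟩ := hdvd
  refine ⟨Et, fun w => ?_, ?_⟩
  · have := congrArg (Polynomial.eval w) hEt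
    rw [hE, Polynomial.eval_finsetSum] at this
    simpa using this
  · rw [← hE1, hEt, Polynomial.coeff_X_pow_mul', if_pos le_rfl, Nat.sub_self,
      Polynomial.coeff_zero_eq_eval_zero]

lemma loc_close {ψ : PowerSeries ℂ} (h0 : PowerSeries.coeff 0 ψ = 0) (h1 : PowerSeries.coeff 1 ψ = 1)
    {C : ℝ} (hC : 1 ≤ C) (hb : ∀ k, ‖PowerSeries.coeff k ψ‖ ≤ C^k) {z : ℂ}
    (hz : ‖z‖ ≤ 1/(4*C^2)) : ‖ev ψ z - z‖ ≤ 1/3 * ‖z‖ := by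
  have hC0 : 0 < C := by linarith
  have hzC : ‖z‖ * C^2 ≤ 1/4 := by
    rw [le_div_iff₀ (by positivity)] at hz; linarith
  have hzC' : ‖z‖ * C ≤ 1/4 := by nlinarith [norm_nonneg z]
  have hA := (AS_of_bound hC0 hb (norm_nonneg z) (by linarith)).hasSum le_rfl
  have h2 := (hasSum_nat_add_iff' 2).mpr hA
  simp only [Finset.sum_range_succ, Finset.sum_range_zero, h0, h1, pow_zero, pow_one, zero_mul, zero_add,
    one_mul] at h2
  have hg := (hasSum_geometric_of_lt_one (r := ‖z‖*C) (by positivity) (by linarith)).mul_left ((‖z‖*C)^2)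
  have := h2.norm_le_of_bounded hg (fun k => by
    rw [norm_mul, norm_pow, ← pow_add, add_comm 2 k, mul_pow, mul_comm]
    gcongr
    exact hb _)
  refine this.trans ?_
  rw [← div_eq_mul_inv, div_le_iff₀ (by linarith)]
  nlinarith [norm_nonneg z]

lemma loc_surj {ψ : PowerSeries ℂ} (h0 : PowerSeries.coeff 0 ψ = 0) (h1 : PowerSeries.coeff 1 ψ = 1)
    {C : ℝ} (hC : 1 ≤ C) (hb : ∀ k, ‖PowerSeries.coeff k ψ‖ ≤ C^k) {r : ℝ} (hr : 0 < r)
    (hrR : r ≤ 1/(4*C^2)) {w : ℂ} (hw : ‖w‖ < r/3) : ∃ z, ‖z‖ ≤ r ∧ ev ψ z = w := by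
  have hC0 : 0 < C := by linarith
  have hrC : r * C^2 ≤ 1/4 := by
    rw [le_div_iff₀ (by positivity)] at hrR; linarith
  have hd : DifferentiableOn ℂ (ev ψ) (Metric.ball 0 (2*r)) := by
    apply ev_differentiableOn
    intro s hs hs2
    exact AS_of_bound hC0 hb hs (by nlinarith)
  have hdc : DiffContOnCl ℂ (ev ψ) (Metric.ball 0 r) := by
    apply (hd.mono _).diffContOnCl
    rw [closure_ball _ hr.ne']
    exact Metric.closedBall_subset_ball (by linarith)
  have hev0 : ev ψ 0 = 0 := by rw [ev_zero, h0]
  have hlow : ∀ z ∈ Metric.sphere (0:ℂ) r, 2*r/3 ≤ ‖ev ψ z - ev ψ 0‖ := by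
    intro z hz
    have hz' : ‖z‖ = r := by simpa using hz
    have := loc_close h0 h1 hC hb (hz'.le.trans hrR)
    have h3 := norm_sub_norm_le z (ev ψ z)
    rw [norm_sub_rev] at h3
    rw [hev0, sub_zero]; rw [hz'] at *; linarith
  have hne : ∃ᶠ z in nhds (0:ℂ), ev ψ z ≠ ev ψ 0 := by
    rw [Filter.frequently_iff]
    intro U hU
    obtain ⟨ε, hε, hεU⟩ := Metric.mem_nhds_iff.mp hU
    set t := min (ε/2) r
    have ht : 0 < t := lt_min (by linarith) hr
    refine ⟨(t:ℂ), hεU ?_, ?_⟩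
    · simp [abs_of_pos ht]; exact (min_le_left _ _).trans_lt (by linarith)
    · have hn : ‖(t:ℂ)‖ = t := by simp [abs_of_pos ht]
      have := loc_close h0 h1 hC hb (z := t) ((hn.le.trans (min_le_right _ _)).trans hrR)
      intro hh
      rw [hh, hev0, zero_sub, norm_neg, hn] at this
      linarith
  have := hdc.ball_subset_image_closedBall hr hlow hne
  rw [hev0] at this
  obtain ⟨z, hz, rfl⟩ := this (show w ∈ Metric.ball 0 (2*r/3/2) by simp; linarith)
  exact ⟨z, by simpa using hz, rfl⟩

lemma fi_ev (H : Hyp l h) {C : ℝ} (hC : 1 ≤ C)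
    (hb : ∀ k, ‖PowerSeries.coeff k (lin l h)‖ ≤ C^k) {z : ℂ} (hz : ‖z‖ ≤ 1/(4*C^2)) (i : ℕ) :
    (fi l h i).eval (ev (lin l h) z) = ev (lin l h) (l^i * z) := by
  have hC0 : 0 < C := by linarith
  have hzC : ‖z‖ * C^2 ≤ 1/4 := by
    rw [le_div_iff₀ (by positivity)] at hz; linarith
  have hzC' : ‖z‖ * C ≤ 1/4 := by nlinarith [norm_nonneg z]
  rw [← ev_rescale, ← fi_aeval H,
    (AS_ev_aeval (norm_nonneg z) (AS_of_bound hC0 hb (norm_nonneg z) (by linarith)) _).2 z le_rfl]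

lemma loc_upper {ψ : PowerSeries ℂ} (h0 : PowerSeries.coeff 0 ψ = 0) (h1 : PowerSeries.coeff 1 ψ = 1)
    {C : ℝ} (hC : 1 ≤ C) (hb : ∀ k, ‖PowerSeries.coeff k ψ‖ ≤ C^k) {z : ℂ}
    (hz : ‖z‖ ≤ 1/(4*C^2)) : ‖ev ψ z‖ ≤ 4/3 * ‖z‖ := by
  have := loc_close h0 h1 hC hb hz
  have h3 := norm_sub_norm_le (ev ψ z) z
  linarith

lemma R_le {C : ℝ} (hC : 1 ≤ C) : 1/(4*C^2) ≤ 1/4 := by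
  apply one_div_le_one_div_of_le (by norm_num); nlinarith

lemma fi_small (H : Hyp l h) {C : ℝ} (hC : 1 ≤ C)
    (hb : ∀ k, ‖PowerSeries.coeff k (lin l h)‖ ≤ C^k) {w : ℂ} (hw : ‖w‖ < 1/(4*C^2)/3) (i : ℕ) :
    ‖(fi l h i).eval w‖ < 1 := by
  have hR : 0 < 1/(4*C^2) := by positivity
  obtain ⟨z, hz, rfl⟩ := loc_surj (lin_zero l h) (lin_one l h) hC hb hR le_rfl hw
  rw [fi_ev H hC hb hz]
  have hn : ‖l^i * z‖ = ‖z‖ := by rw [norm_mul, norm_pow, H.l1, one_pow, one_mul]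
  have := loc_upper (lin_zero l h) (lin_one l h) hC hb (z := l^i*z) (hn.le.trans hz)
  have := R_le hC
  linarith

lemma fi_far (H : Hyp l h) {C : ℝ} (hC : 1 ≤ C)
    (hb : ∀ k, ‖PowerSeries.coeff k (lin l h)‖ ≤ C^k) {r : ℝ} (hr : 0 < r) (hrR : r ≤ 1/(4*C^2))
    {w : ℂ} (i : ℕ) (hw : ∀ a < i, ‖(fi l h a).eval w‖ ≤ 1)
    (hwr : 4/3 * r < ‖w‖) : r/3 ≤ ‖(fi l h i).eval w‖ := by
  by_contra hlt
  push Not at hlt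
  obtain ⟨z, hz, he⟩ := loc_surj (lin_zero l h) (lin_one l h) hC hb hr hrR hlt
  have hl : l ≠ 0 := by intro h0; have := H.l1; rw [h0] at this; simp at this
  set z' := (l^i)⁻¹ * z
  have hz' : ‖z'‖ = ‖z‖ := by simp [z', H.l1]
  have hz'R : ‖z'‖ ≤ 1/(4*C^2) := by rw [hz']; linarith
  have hR := R_le hC
  have hup : ∀ a, ‖(fi l h a).eval (ev (lin l h) z')‖ ≤ 4/3*r := by
    intro a
    rw [fi_ev H hC hb hz'R]
    have hn : ‖l^a * z'‖ = ‖z'‖ := by rw [norm_mul, norm_pow, H.l1, one_pow, one_mul]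
    have := loc_upper (lin_zero l h) (lin_one l h) hC hb (z := l^a*z') (hn.le.trans hz'R)
    linarith
  have : w = ev (lin l h) z' := by
    apply fi_inj H i hw (fun a _ => (hup a).trans (by linarith))
    rw [fi_ev H hC hb hz'R, ← he]
    simp [z', hl]
  have h2 := hup 0
  rw [fi_eval_zero, ← this] at h2
  linarith
end
end QL

namespace QL

lemma step_core {l : ℂ} {h : Polynomial ℂ} (H : Hyp l h) {C : ℝ} (hC : 1 ≤ C)
    (hb : ∀ k, ‖PowerSeries.coeff k (lin l h)‖ ≤ C^k) {q J n s : ℕ} (c : ℕ → ℂ) {M : ℝ}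
    (hM : ∑ j ∈ Finset.range J, ‖c j‖ ≤ M)
    (hc0 : ∀ m, 1 ≤ m → m ≤ q → ∑ j ∈ Finset.range J, c j * l^(m*j) = 0)
    (hc1 : ∑ j ∈ Finset.range J, c j * l^((q+1)*j) = 1)
    (hJ : 1 ≤ J) (hs : 1 ≤ s) (hn : 1 ≤ n) {δ B η Q : ℝ} (hδ : 0 < δ) (hδB : 2*δ < B)
    (hB : B ≤ 1/(64*C^2)) (hη : 0 < η) (hη1 : η ≤ 1/2)
    (hL : 4*Real.pi^2*J ≤ η^2 * Real.log (B/(2*δ))) (hQ : 0 ≤ Q)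
    (hell : ∀ k, 2 ≤ k → k ≤ n+1 → ‖ell l h n k‖ ≤ Q)
    (hmm : ∀ k, 2 ≤ k → k ≤ n+1 → ‖mm l h n k‖ ≤ Q) :
    (‖l^n - 1‖⁻¹)^(q+1) * ‖PowerSeries.coeff (q+1) ((lin l h)^s)‖^(n+2) ≤
      ((2/δ)^2*(J+1:ℝ)^2*(n*(Q*(6/((1/(192*C^2))^2*η)*((1-η)⁻¹)^(n+2)))))^(q+1) * M^(n+2) := by
  obtain ⟨T, rfl⟩ : ∃ T, J = T + 1 := ⟨J-1, by omega⟩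
  have hC0 : 0 < C := by linarith
  have hC2 : 1 ≤ C^2 := one_le_pow₀ hC
  set R := 1/(4*C^2) with hR
  have hRp : 0 < R := by positivity
  have hBR : B ≤ R/16 := by refine hB.trans (le_of_eq ?_); rw [hR]; field_simp; norm_num
  have hR4 : R ≤ 1/4 := R_le hC
  set F : ℕ → ℂ → ℂ := fun i w => (fi l h i).eval w with hF
  obtain ⟨O, hO, hOs, hOin, hOf⟩ := geo (F := F) (fun i => (fi l h i).differentiable)
    (by ext w; simp [hF, fi]) (T := T)
    (by
      intro i hi y hy w hw he
      exact fi_inj H i (fun a ha => (hy a (by omega)).le) (fun a ha => (hw a (by omega)).le) he)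
    hδ hδB hη (by linarith) (by push_cast at hL ⊢; exact hL)
  have hin : ∀ w : ℂ, ‖w‖ < R/8 → w ∈ O := by
    intro w hw
    apply hOin
    intro y hy i hi
    apply fi_small H hC hb
    have : ‖y - w‖ ≤ B := by simpa [dist_eq_norm] using hy
    have h3 := norm_sub_norm_le y w
    linarith
  have hbd : Bornology.IsBounded O := by
    apply Bornology.IsBounded.subset (Metric.isBounded_ball (x := (0:ℂ)) (r := 1))
    intro w hw
    have := hOs hw 0 (by omega)
    simpa [hF, fi] using this
  obtain ⟨P, hP, hP0⟩ := exists_Pp l h n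
  obtain ⟨Et, hEt, hEt0⟩ := exists_E H c hs hc0 hc1
  set S := (2/δ)^2*((T+1:ℕ)+1:ℝ)^2*(n*(Q*(6/((1/(192*C^2))^2*η)*((1-η)⁻¹)^(n+2)))) with hS
  have hS0 : 0 ≤ S := by
    have : 0 ≤ (1-η)⁻¹ := inv_nonneg.mpr (by linarith)
    positivity
  have hM0 : 0 ≤ M := le_trans (Finset.sum_nonneg fun _ _ => norm_nonneg _) hM
  have hfr : ∀ w ∈ frontier O, ‖(P^(q+1) * Et^(n+2)).eval w‖ ≤ S^(q+1) * M^(n+2) := by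
    intro w hw
    obtain ⟨hball, i0, hi0, hi0η⟩ := hOf w hw
    have hwO : w ∉ O := fun hh => by
      rw [hO.frontier_eq] at hw; exact hw.2 hh
    have hwR : R/8 ≤ ‖w‖ := by
      by_contra hlt; exact hwO (hin w (by linarith))
    have hw0 : w ≠ 0 := by rw [← norm_pos_iff]; linarith
    have hwOm : ∀ i ≤ T, ‖(fi l h i).eval w‖ < 1 := fun i hi => hball (Metric.mem_ball_self hδ) i hi
    classical
    have hex : ∃ i, 1 - η ≤ ‖(fi l h i).eval w‖ := ⟨i0, hi0η⟩
    set j := Nat.find hex with hj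
    have hjT : j ≤ T := (Nat.find_le hi0η).trans hi0
    have hA := tele H hn (w := fun i => (fi l h i).eval w) (fun i => fi_eval_succ i w) (j := j)
      (r := 1/(192*C^2)) (D := 2/δ) (Q := Q) hη hη1 (by positivity)
      (by rw [div_le_one (by positivity)]; linarith) hQ
      (Nat.find_spec hex) (fun i hi => (not_le.mp (Nat.find_min hex hi)).le)
      (by
        intro i hi
        have := fi_far H hC hb (r := R/16) (by linarith) (by linarith) (w := w) i
          (fun a ha => (hwOm a (by omega)).le) (by linarith)
        refine le_trans (le_of_eq ?_) this
        rw [hR]; field_simp; norm_num)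
      (by
        intro i hi
        rw [← fi_deriv, ← Polynomial.deriv]
        have := Complex.norm_deriv_le_of_forall_mem_sphere_norm_le (f := fun y => (fi l h i).eval y)
          (c := w) (R := δ/2) (C := 1) (by linarith) (fi l h i).differentiable.diffContOnCl
          (by
            intro y hy
            refine (hball (a := y) ?_ i (by omega)).le
            rw [Metric.mem_ball, Metric.mem_sphere.mp hy]; linarith)
        refine this.trans (le_of_eq (by field_simp)))
      hell hmm
    simp only [fi_eval_zero] at hA
    have hA2 : ‖LF (ell l h n) n ((fp l h).derivative * Kp n w)‖ ≤ S := by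
      refine hA.trans ?_
      rw [hS]
      have : 0 ≤ (1-η)⁻¹ := inv_nonneg.mpr (by linarith)
      have hjT' : (j:ℝ) ≤ T := by exact_mod_cast hjT
      have hj2 : (j:ℝ) + 2 ≤ ((T+1:ℕ):ℝ) + 1 := by push_cast; linarith
      gcongr
    have hE2 : ‖w^(q+1) * Et.eval w‖ ≤ M := by
      rw [← hEt]
      refine (norm_sum_le _ _).trans (le_trans (Finset.sum_le_sum fun i hi => ?_) hM)
      rw [norm_mul, norm_pow]
      exact mul_le_of_le_one_right (norm_nonneg _)
        (pow_le_one₀ (norm_nonneg _) (hwOm i (by simp at hi; omega)).le)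
    have : (P^(q+1) * Et^(n+2)).eval w =
        (LF (ell l h n) n ((fp l h).derivative * Kp n w))^(q+1) * (w^(q+1) * Et.eval w)^(n+2) := by
      rw [Polynomial.eval_mul, Polynomial.eval_pow, Polynomial.eval_pow, hP w hw0]
      rw [mul_pow, mul_pow, ← pow_mul, ← pow_mul, mul_comm (n+2) (q+1)]; ring
    rw [this, norm_mul, norm_pow, norm_pow]
    gcongr
  have hmain := Complex.norm_le_of_forall_mem_frontier_norm_le hbd
    ((P^(q+1) * Et^(n+2)).differentiable.diffContOnCl) hfr (subset_closure (hin 0 (by simpa using by linarith)))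
  rw [Polynomial.eval_mul, Polynomial.eval_pow, Polynomial.eval_pow, norm_mul, norm_pow, norm_pow,
    hEt0, hP0 hn] at hmain
  have hpz := Pp_zero H hn
  have : ‖l^n - 1‖⁻¹ = ‖LF (ell l h n) n ((fp l h).derivative * Polynomial.X^(n+1))‖ :=
    inv_eq_of_mul_eq_one_right hpz
  rw [this]
  exact hmain
end QL

namespace QL

lemma Q_bound {l : ℂ} {h : Polynomial ℂ} {n : ℕ} {τ Bn : ℝ} (hX : Polynomial.X^2 ∣ h) (hτ : 0 < τ)
    (hBn : ∀ h' : Polynomial ℂ, Polynomial.X^2 ∣ h' → nu h' ≤ nu h + τ → ∀ s, 1 ≤ s → s ≤ n+1 →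
      ‖PowerSeries.coeff (n+1) ((lin l h')^s)‖ ≤ Bn) {k : ℕ} (hk : 2 ≤ k) (hk' : k ≤ n+1) :
    ‖ell l h n k‖ ≤ Bn * ((n+1)/τ) := by
  rw [ell, dlin, PowerSeries.coeff_mk]
  have hn1 : (0:ℝ) < n+1 := by positivity
  refine (Complex.norm_deriv_le_of_forall_mem_sphere_norm_le (R := τ/(n+1)) (C := Bn) (by positivity)
    (lin_diff l h (Polynomial.X^k) (n+1)).diffContOnCl ?_).trans (le_of_eq (by field_simp))
  intro t ht
  have ht' : ‖t‖ = τ/(n+1) := by simpa using ht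
  have := hBn (h + Polynomial.C t * Polynomial.X^k)
    (dvd_add hX ((pow_dvd_pow _ hk).trans (Dvd.intro_left _ rfl))) ?_ 1 le_rfl (by omega)
  · simpa using this
  · refine (nu_add_le _ _).trans ?_
    have h1 := nu_monomial_le t k
    have h2 : (k:ℝ) * ‖t‖ ≤ τ := by
      rw [ht', ← mul_div_assoc, div_le_iff₀ hn1, mul_comm]
      gcongr
      exact_mod_cast hk'
    linarith

lemma step_num {q n : ℕ} {τ x b M S Q X : ℝ} (hq1 : 64 ≤ q) (hn : q^10 ≤ n)
    (hx : 0 < x) (hτ : 0 < τ) (hb : 0 ≤ b) (hτ1 : τ ≤ 1)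
    (hX : 0 < X) (hXe : X = b + Real.log x/(n+2) - 20 * (Real.log q / q) - Real.log (1/τ)/n)
    (hQ : Q = Real.exp ((n+1)*X) * ((n+1)/τ))
    (hS0 : 0 ≤ S)
    (hS : S ≤ Q * Real.exp (2*n/q^2) * Real.exp ((n+2)*(2/q)) * n^4)
    (hM : M = 64 * (q:ℝ)^7)
    (hcore : x^(q+1) * (Real.exp ((q+1)*b))^(n+2) ≤ S^(q+1) * M^(n+2)) : False := by
  have hq1' : (64:ℝ) ≤ q := by exact_mod_cast hq1
  have hn' : (q:ℝ)^10 ≤ n := by exact_mod_cast hn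
  have hq0 : (0:ℝ) < q := by linarith
  have hn0 : (0:ℝ) < n := lt_of_lt_of_le (by positivity) hn'
  have hM0 : 0 < M := by rw [hM]; positivity
  have hSp : 0 < S := by
    rcases hS0.lt_or_eq with h1 | h1
    · exact h1
    · rw [← h1, zero_pow (by omega), zero_mul] at hcore
      have : 0 < x^(q+1) * (Real.exp ((q+1)*b))^(n+2) := by positivity
      linarith
  have hQ0 : 0 < Q := by rw [hQ]; positivity
  have h1 := Real.log_le_log (by positivity) hcore
  rw [Real.log_mul (by positivity) (by positivity), Real.log_mul (by positivity) (by positivity),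
    Real.log_pow, Real.log_pow, Real.log_pow, Real.log_pow, Real.log_exp] at h1
  have h2 := Real.log_le_log hSp hS
  rw [Real.log_mul (by positivity) (by positivity), Real.log_mul (by positivity) (by positivity),
    Real.log_mul (by positivity) (by positivity),
    Real.log_exp, Real.log_exp, Real.log_pow, hQ, Real.log_mul (by positivity) (by positivity),
    Real.log_exp, Real.log_div (by positivity) (by positivity)] at h2
  have hlogq : 1 ≤ Real.log q := by
    rw [Real.le_log_iff_exp_le hq0]
    exact (Real.exp_one_lt_d9.le.trans (by norm_num)).trans hq1'
  have hlogM : Real.log M ≤ 8 * Real.log q := by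
    have h8 : (8:ℝ) * Real.log q = Real.log ((q:ℝ)^8) := by rw [Real.log_pow]; norm_num
    rw [h8, hM]
    apply Real.log_le_log (by positivity)
    calc (64:ℝ) * (q:ℝ)^7 ≤ q * (q:ℝ)^7 := by gcongr
      _ = _ := by ring
  have hlogM0 : 0 ≤ Real.log M := by
    apply Real.log_nonneg
    rw [hM]
    have : (1:ℝ) ≤ (q:ℝ)^7 := one_le_pow₀ (by linarith)
    linarith
  have hq5 : (q:ℝ)^5 ≤ Real.sqrt n := by
    apply Real.le_sqrt_of_sq_le
    calc ((q:ℝ)^5)^2 = (q:ℝ)^10 := by ring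
      _ ≤ (n:ℝ) := hn'
  have hsq : Real.sqrt n * Real.sqrt n = n := Real.mul_self_sqrt hn0.le
  have hs0 : 0 < Real.sqrt n := Real.sqrt_pos.mpr hn0
  have hlogn : Real.log n ≤ 2 * Real.sqrt n := by
    rw [← hsq, Real.log_mul hs0.ne' hs0.ne']
    have := Real.log_le_sub_one_of_pos hs0
    rw [hsq]
    linarith
  have hn1 : 1 ≤ (n:ℝ) := le_trans (one_le_pow₀ (by linarith)) hn'
  have hlogn1 : Real.log (n+1) ≤ 1 + Real.log n := by
    calc Real.log (n+1) ≤ Real.log (2 * n) := Real.log_le_log (by positivity) (by linarith)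
      _ = Real.log 2 + Real.log n := Real.log_mul (by norm_num) hn0.ne'
      _ ≤ _ := by have := Real.log_two_lt_d9; linarith
  have hlt : Real.log (1/τ) = -Real.log τ := by rw [one_div, Real.log_inv]
  have hlt0 : Real.log τ ≤ 0 := Real.log_nonpos hτ.le hτ1
  -- small terms
  have hsm : 1 + 5 * Real.log n ≤ n / q := by
    rw [le_div_iff₀ hq0]
    have hq4 : (64:ℝ)^4 ≤ (q:ℝ)^4 := by gcongr
    have : 11 * q ≤ Real.sqrt n := by
      refine le_trans ?_ hq5
      calc 11 * (q:ℝ) ≤ 64^4 * q := by gcongr; norm_num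
        _ ≤ (q:ℝ)^4 * q := by gcongr
        _ = _ := by ring
    have h1s : 1 ≤ Real.sqrt n := by linarith
    calc (1 + 5 * Real.log n) * q ≤ (11 * Real.sqrt n) * q := by gcongr; linarith
      _ = Real.sqrt n * (11 * q) := by ring
      _ ≤ Real.sqrt n * Real.sqrt n := by gcongr
      _ = n := hsq
  set lq := Real.log q
  set ln := Real.log n
  set lx := Real.log x
  set lM := Real.log M
  have hb1 : (q+1:ℝ)*(lx + (n+2)*b) ≤ (q+1) * ((n+1)*X + (Real.log (n+1) - Real.log τ) + 2*n/q^2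
     + (n+2)*(2/q) + 4 * ln) + (n+2) * lM := by
    push_cast at h1 h2
    have : (q+1:ℝ) * Real.log S ≤ (q+1) * ((n+1)*X + (Real.log (n+1) - Real.log τ) + 2*n/q^2
     + (n+2)*(2/q) + 4 * ln) := by gcongr
    linarith
  have hM2 : (n+2) * lM ≤ (q+1) * ((n+2) * (8 * (lq / q))) := by
    calc (n+2) * lM ≤ (n+2) * (8 * lq) := by gcongr
      _ = q * ((n+2) * (8 * (lq / q))) := by field_simp
      _ ≤ _ := by
        have : 0 ≤ lq / q := by positivity
        gcongr; linarith
  have hb2 : lx + (n+2)*b ≤ (n+1)*X + (Real.log (n+1) - Real.log τ) + 2*n/q^2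
     + (n+2)*(2/q) + 4 * ln + (n+2) * (8 * (lq / q)) := by
    have hq1p : (0:ℝ) < q+1 := by positivity
    have : (q+1:ℝ)*(lx + (n+2)*b) ≤ (q+1)* ((n+1)*X + (Real.log (n+1) - Real.log τ) + 2*n/q^2
     + (n+2)*(2/q) + 4 * ln + (n+2) * (8 * (lq / q))) := by
      rw [mul_add (q+1:ℝ) _ ((n+2) * (8 * (lq / q)))]; linarith
    exact le_of_mul_le_mul_left this hq1p
  have hXm : (n+2)*X = (n+2)*b + lx - (n+2) * (20 * (lq / q)) - (n+2)*(-Real.log τ/n) := by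
    rw [hXe, hlt]; field_simp
  have hτn : -Real.log τ ≤ (n+2)*(-Real.log τ/n) := by
    rw [← mul_div_assoc, le_div_iff₀ hn0]; nlinarith
  have hq2 : 2*n/(q:ℝ)^2 ≤ n / q := by
    rw [div_le_div_iff₀ (by positivity) hq0]
    calc 2 * (n:ℝ) * q = n * q * 2 := by ring
      _ ≤ n * q * q := by gcongr; linarith
      _ = n * q^2 := by ring
  have hlqq : 1 / (q:ℝ) ≤ lq / q := by gcongr
  have h3 : (n:ℝ)/q ≤ (n+2) * (lq/q) := by
    calc (n:ℝ)/q = n * (1/q) := by ring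
      _ ≤ _ := by gcongr; linarith
  have h4 : (n+2:ℝ)*(2/q) ≤ 2 * ((n+2) * (lq/q)) := by
    calc (n+2:ℝ)*(2/q) = 2 * ((n+2) * (1/q)) := by ring
      _ ≤ _ := by gcongr
  have h5 : 0 < (n+2) * (lq/q) := by positivity
  have h6 : (n+1)*X ≤ (n+2)*X := by gcongr; norm_num
  have e1 : (n+2:ℝ) * (8 * (lq / q)) = 8 * ((n+2) * (lq/q)) := by ring
  have e2 : (n+2:ℝ) * (20 * (lq / q)) = 20 * ((n+2) * (lq/q)) := by ring
  rw [e1] at hb2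
  rw [e2] at hXm
  linarith

set_option maxHeartbeats 1600000 in
/-- The inductive step. -/
lemma step {α : ℝ} (hα : Irrational α) {κ C : ℝ} (hκ : κ ≤ 1/10) (hC : 1 ≤ C)
    (hst : ∀ h : Polynomial ℂ, Polynomial.X^2 ∣ h → nu h ≤ κ → ∀ k,
      ‖PowerSeries.coeff k (lin (lam α) h)‖ ≤ C^k)
    {q q' n s : ℕ} {p : ℤ} (h1 : |q*α - p| ≤ 1/q') (h2 : 1/(2*q') ≤ |q*α - p|)
    (hc : IsCoprime p (q:ℤ)) (hqC : 400 * C^2 ≤ q) (hqq : q^10 ≤ q') (hn : q' ≤ n)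
    {h : Polynomial ℂ} (hX : Polynomial.X^2 ∣ h) {τ : ℝ} (hτ : 0 < τ) (hτ1 : τ ≤ 1)
    (hnu : nu h + τ ≤ κ) {b : ℝ} (hb : 0 ≤ b) (hs : 1 ≤ s)
    (hbc : Real.exp ((q+1)*b) ≤ ‖PowerSeries.coeff (q+1) ((lin (lam α) h)^s)‖) :
    ∃ h' : Polynomial ℂ, Polynomial.X^2 ∣ h' ∧ nu h' ≤ nu h + τ ∧ ∃ s', 1 ≤ s' ∧ s' ≤ n+1 ∧
      Real.exp ((n+1) * max 0 (b + Real.log (‖lam α^n - 1‖⁻¹)/(n+2)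
        - 20 * (Real.log q / q) - Real.log (1/τ)/n)) ≤
      ‖PowerSeries.coeff (n+1) ((lin (lam α) h')^s')‖ := by
  set X := b + Real.log (‖lam α^n - 1‖⁻¹)/(n+2) - 20 * (Real.log q / q) - Real.log (1/τ)/n with hXe
  rcases le_or_gt X 0 with hX0 | hX0
  · refine ⟨h, hX, by linarith, n+1, by omega, le_rfl, ?_⟩
    rw [max_eq_left hX0, coeff_pow_self (X_dvd_lin _ _) (lin_one _ _)]
    simp
  rw [max_eq_right hX0.le]
  by_contra hcon
  push Not at hcon
  have H : Hyp (lam α) h := ⟨lam_norm α, lam_NR hα, hX, by linarith⟩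
  have hC2 : 1 ≤ C^2 := one_le_pow₀ hC
  have hq400 : (400:ℝ) ≤ q := by linarith
  have hq400' : 400 ≤ q := by exact_mod_cast hq400
  have hqn : q^10 ≤ n := hqq.trans hn
  have hqn' : (q:ℝ)^10 ≤ n := by exact_mod_cast hqn
  have hn' : (q':ℝ) ≤ n := by exact_mod_cast hn
  have hn1 : 1 ≤ n := le_trans (Nat.one_le_pow _ _ (by omega)) hqn
  have hq0 : (0:ℝ) < q := by linarith
  have hn0 : (0:ℝ) < n := by exact_mod_cast hn1
  obtain ⟨c, hcM, hc0, hc1⟩ := interp h1 h2 (by omega) hc (by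
    calc 8 * q^6 ≤ q^4 * q^6 := by gcongr; calc 8 ≤ 400^4 := by norm_num
                                              _ ≤ q^4 := by gcongr
      _ = q^10 := by ring
      _ ≤ q' := hqq)
  set J := q + q'/q^6 with hJ
  have hJr : (J:ℝ) ≤ q + n/q^6 := by
    rw [hJ]; push_cast
    have : ((q'/q^6 : ℕ):ℝ) ≤ (q':ℝ)/((q^6:ℕ):ℝ) := Nat.cast_div_le
    push_cast at this
    have h3 : (q':ℝ)/q^6 ≤ n/q^6 := by gcongr
    linarith
  set Q := Real.exp ((n+1)*X) * ((n+1)/τ) with hQ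
  have hB : ∀ h' : Polynomial ℂ, Polynomial.X^2 ∣ h' → nu h' ≤ nu h + τ → ∀ s, 1 ≤ s → s ≤ n+1 →
      ‖PowerSeries.coeff (n+1) ((lin (lam α) h')^s)‖ ≤ Real.exp ((n+1)*X) :=
    fun h' a b s c d => (hcon h' a b s c d).le
  have hQ0 : 0 < Q := by positivity
  set δ := Real.exp (-(n/q^2)) with hδ
  set B := Real.exp (-(n/q^2)/2) with hBd
  set y : ℝ := n/q^2 with hy
  have hyq : (q:ℝ)^8 ≤ y := by
    rw [hy, le_div_iff₀ (by positivity)]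
    calc (q:ℝ)^8 * (q:ℝ)^2 = (q:ℝ)^10 := by ring
      _ ≤ (n:ℝ) := hqn'
  have hq8 : 400 * (q:ℝ) ≤ (q:ℝ)^8 := by
    calc 400 * (q:ℝ) ≤ q * q := by gcongr
      _ = (q:ℝ)^2 := by ring
      _ ≤ _ := pow_le_pow_right₀ (by linarith) (by norm_num)
  have hlogB : Real.log (B/(2*δ)) = y/2 - Real.log 2 := by
    rw [Real.log_div (by positivity) (by positivity), Real.log_mul (by positivity) (by positivity),
      hδ, hBd, Real.log_exp, Real.log_exp]; ring
  have hl2 := Real.log_two_lt_d9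
  have hδB : 2*δ < B := by
    have : 0 < Real.log (B/(2*δ)) := by rw [hlogB]; linarith
    rw [Real.log_pos_iff (by positivity)] at this
    rwa [lt_div_iff₀ (by positivity), one_mul] at this
  have hBC : B ≤ 1/(64*C^2) := by
    rw [hBd, neg_div, Real.exp_neg, ← one_div]
    apply one_div_le_one_div_of_le (by positivity)
    have := Real.add_one_le_exp (y/2)
    linarith
  have hL : 4*Real.pi^2*J ≤ (1/(q:ℝ))^2 * Real.log (B/(2*δ)) := by
    rw [hlogB]
    have hpi : 4*Real.pi^2 ≤ 40 := by
      have := Real.pi_lt_d2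
      have := Real.pi_pos
      nlinarith
    have e1 : (n:ℝ)/q^6 = y / q^4 := by rw [hy]; field_simp
    have hJ2 : (J:ℝ) ≤ y / (320 * q^2) := by
      rw [e1] at hJr
      have a1 : (q:ℝ) ≤ y / (640*q^2) := by
        rw [le_div_iff₀ (by positivity)]
        refine le_trans ?_ hyq
        have hq2 : (640:ℝ) ≤ q^5 := by
          calc (640:ℝ) ≤ 400^5 := by norm_num
            _ ≤ q^5 := by gcongr
        calc (q:ℝ)*(640*(q:ℝ)^2) = 640 * (q:ℝ)^3 := by ring
          _ ≤ (q:ℝ)^5 * (q:ℝ)^3 := by gcongr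
          _ = _ := by ring
      have a2 : y/(q:ℝ)^4 ≤ y / (640*q^2) := by
        apply div_le_div_of_nonneg_left (by positivity) (by positivity)
        calc 640 * (q:ℝ)^2 ≤ (q:ℝ)^2 * (q:ℝ)^2 := by gcongr; nlinarith
          _ = _ := by ring
      have a3 : y / (640*(q:ℝ)^2) + y / (640*q^2) = y/(320*q^2) := by field_simp; ring
      linarith
    calc 4*Real.pi^2*J ≤ 40 * (y / (320 * q^2)) := by gcongr
      _ = (1/(q:ℝ))^2 * (y/8) := by field_simp; ring
      _ ≤ _ := by gcongr; linarith
  have hη1 : 1/(q:ℝ) ≤ 1/2 := by apply one_div_le_one_div_of_le <;> linarith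
  have core := step_core H hC (hst h hX (by linarith)) c hcM hc0 hc1 (le_trans (by omega) (Nat.le_add_right q (q'/q^6))) hs hn1
    (δ := δ) (B := B) (η := 1/q) (Q := Q) (by positivity) hδB hBC (by positivity) hη1 hL hQ0.le
    (fun k hk hk' => Q_bound hX hτ hB hk hk')
    (fun k hk hk' => by
      refine (hB h hX (by linarith) k (by omega) hk').trans ?_
      rw [hQ]
      refine le_mul_of_one_le_right (Real.exp_pos _).le ?_
      rw [le_div_iff₀ hτ]
      linarith)
  have hx : 0 < ‖lam α^n - 1‖⁻¹ := by
    rw [inv_pos, norm_pos_iff]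
    obtain ⟨m, rfl⟩ : ∃ m, n = m+1 := ⟨n-1, by omega⟩
    intro h0
    apply lam_NR hα m
    have : lam α^(m+2) - lam α = lam α * (lam α^(m+1) - 1) := by ring
    rw [this, h0, mul_zero]
  have hη0 : 0 < 1 - 1/(q:ℝ) := by linarith
  refine step_num (M := 64*(q:ℝ)^7) (by omega) hqn hx hτ hb hτ1 hX0 hXe hQ ?_ ?_ rfl
    (le_trans ?_ core)
  · positivity
  · have hJn : (J:ℝ) + 1 ≤ n := by
      have a1 : (n:ℝ)/q^6 ≤ n/2 := by
        apply div_le_div_of_nonneg_left hn0.le (by norm_num)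
        calc (2:ℝ) ≤ 400^6 := by norm_num
          _ ≤ q^6 := by gcongr
      have a2 : (q:ℝ) * 400 ≤ n := by
        calc (q:ℝ) * 400 ≤ q * q^9 := by
              gcongr
              calc (400:ℝ) ≤ 400^9 := by norm_num
                _ ≤ q^9 := by gcongr
          _ = q^10 := by ring
          _ ≤ n := hqn'
      linarith
    have hd : (2/δ)^2 = 4 * Real.exp (2*n/q^2) := by
      rw [hδ, div_pow, ← Real.exp_nat_mul, div_eq_mul_inv, ← Real.exp_neg, hy]
      norm_num
      ring
    have hη : ((1 - 1/(q:ℝ))⁻¹)^(n+2) ≤ Real.exp ((n+2)*(2/q)) := by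
      have : (1 - 1/(q:ℝ))⁻¹ ≤ Real.exp (2/q) := by
        have a := Real.add_one_le_exp (2/(q:ℝ))
        refine le_trans ?_ a
        rw [inv_le_iff_one_le_mul₀ hη0]
        have e : (2/(q:ℝ)+1) * (1-1/q) = 1 + (1/q) * (1 - 2 * (1/q)) := by field_simp; ring
        rw [e]
        have : 0 ≤ (1/(q:ℝ)) * (1 - 2 * (1/q)) := by
          apply mul_nonneg (by positivity); linarith
        linarith
      calc _ ≤ (Real.exp (2/q))^(n+2) := by gcongr
        _ = _ := by rw [← Real.exp_nat_mul]; push_cast; rfl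
    have hr : 4 * (6/((1/(192*C^2))^2*(1/(q:ℝ)))) ≤ n := by
      have e : 4 * (6/((1/(192*C^2))^2*(1/(q:ℝ)))) = 24 * (192*C^2)^2 * q := by field_simp; ring
      rw [e]
      calc 24 * (192*C^2)^2 * q ≤ q^2 * q^2 * (q:ℝ) := by
            gcongr
            · calc (24:ℝ) ≤ 400^2 := by norm_num
                _ ≤ q^2 := by gcongr
            · linarith
        _ = (q:ℝ)^5 := by ring
        _ ≤ (q:ℝ)^10 := pow_le_pow_right₀ (by linarith) (by norm_num)
        _ ≤ n := hqn'
    rw [hd]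
    calc 4 * Real.exp (2*n/q^2) * (J+1:ℝ)^2 *
          (n * (Q * (6/((1/(192*C^2))^2*(1/(q:ℝ))) * ((1 - 1/(q:ℝ))⁻¹)^(n+2))))
        = Q * Real.exp (2*n/q^2) * ((1 - 1/(q:ℝ))⁻¹)^(n+2) *
          ((J+1:ℝ)^2 * n * (4 * (6/((1/(192*C^2))^2*(1/(q:ℝ)))))) := by ring
      _ ≤ Q * Real.exp (2*n/q^2) * Real.exp ((n+2)*(2/q)) * ((n:ℝ)^2 * n * n) := by gcongr
      _ = _ := by ring
  · gcongr
end QL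

namespace QL

lemma coeff_pow_le {ψ : PowerSeries ℂ} (h0 : PowerSeries.coeff 0 ψ = 0) (h1 : PowerSeries.coeff 1 ψ = 1)
    {C : ℝ} (hC : 1 ≤ C) (hb : ∀ k, ‖PowerSeries.coeff k ψ‖ ≤ C^k) (s k : ℕ) :
    ‖PowerSeries.coeff k (ψ^s)‖ ≤ (4*C^2)^k := by
  have hC0 : 0 < C := by linarith
  set R := 1/(4*C^2) with hR
  have hRp : 0 < R := by positivity
  have hA : ∀ r, 0 ≤ r → r < 2*R → AS ψ r := by
    intro r hr hr2
    apply AS_of_bound hC0 hb hr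
    have hRC : R * C^2 = 1/4 := by rw [hR]; field_simp
    have : R * C ≤ 1/4 := by rw [← hRC]; gcongr; nlinarith
    nlinarith
  have hA1 := hA R hRp.le (by linarith)
  have hev := AS_ev_aeval hRp.le hA1 (Polynomial.X^s)
  simp only [map_pow, Polynomial.aeval_X, Polynomial.eval_pow, Polynomial.eval_X] at hev
  have hd : DifferentiableOn ℂ (ev ψ) (Metric.ball 0 (2*R)) := ev_differentiableOn hA
  have hdc : DiffContOnCl ℂ (fun z => (ev ψ z)^s) (Metric.ball 0 R) := by
    apply ((hd.pow s).mono _).diffContOnCl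
    rw [closure_ball _ hRp.ne']
    exact Metric.closedBall_subset_ball (by linarith)
  have ht := (hev.1.ht hRp).tc_eq
  have hcg : ev (ψ^s) =ᶠ[nhds 0] fun z => (ev ψ z)^s := by
    filter_upwards [Metric.ball_mem_nhds (0:ℂ) hRp] with z hz
    exact hev.2 z (by simpa using (mem_ball_zero_iff.mp hz).le)
  have := tc_norm_le hRp hdc (C := 1) (by
    intro z hz
    have hz' : ‖z‖ = R := by simpa using hz
    rw [norm_pow]
    apply pow_le_one₀ (norm_nonneg _)
    have h3 := loc_upper h0 h1 hC hb hz'.le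
    have := R_le hC
    linarith) k
  rw [← tc_congr hcg, ht] at this
  refine this.trans (le_of_eq ?_)
  rw [hR, one_div_pow, one_div_one_div]

theorem brjuno_of_class {α : ℝ} (hα : α ∈ IrrN 2) {κ C : ℝ} (hκ0 : 0 < κ) (hκ : κ ≤ 1/10) (hC : 1 ≤ C)
    (hst : ∀ h : Polynomial ℂ, Polynomial.X^2 ∣ h → nu h ≤ κ → ∀ k,
      ‖PowerSeries.coeff k (lin (lam α) h)‖ ≤ C^k) : IsBrjuno α := by
  obtain ⟨q, p, hq, hq2, hqd, hcop, hup, hlo⟩ := cf_facts hα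
  have hirr : Irrational α := hα.2.1
  have hqR : ∀ k, (cfq α k : ℝ) = q k := fun k => by rw [← hq]; push_cast; rfl
  set T : ℕ → ℝ := fun k => Real.log (q (k+1)) / q k with hT
  have hq1 : ∀ k, (1:ℝ) ≤ q k := fun k => by
    have := (Nat.one_le_two_pow (n := k)).trans (hq2 k)
    exact_mod_cast this
  have hq0 : ∀ k, (0:ℝ) < q k := fun k => by linarith [hq1 k]
  have hmono : Monotone q := monotone_nat_of_le_succ fun k => by have := hqd k; omega
  have hT0 : ∀ k, 0 ≤ T k := fun k => div_nonneg (Real.log_nonneg (hq1 _)) (hq0 k).le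
  suffices Summable T by
    unfold IsBrjuno
    simp only [hqR]; exact this
  set e : ℕ → ℝ := fun k => Real.log (q k) / q k with he
  have he0 : ∀ k, 0 ≤ e k := fun k => div_nonneg (Real.log_nonneg (hq1 _)) (hq0 k).le
  have hinv : ∀ k, 1 / (q k:ℝ) ≤ (1/2)^k := fun k => by
    rw [one_div_pow]
    apply one_div_le_one_div_of_le (by positivity)
    exact_mod_cast hq2 k
  have hes : Summable e := by
    apply Summable.of_nonneg_of_le he0 (f := fun k => 2 * (Real.sqrt (1/2))^k)
    · intro k
      have hs0 : 0 < Real.sqrt (q k) := Real.sqrt_pos.mpr (hq0 k)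
      have hsq : Real.sqrt (q k) * Real.sqrt (q k) = q k := Real.mul_self_sqrt (hq0 k).le
      have hl : Real.log (q k) ≤ 2 * Real.sqrt (q k) := by
        rw [← hsq, Real.log_mul hs0.ne' hs0.ne', hsq]
        have := Real.log_le_sub_one_of_pos hs0
        linarith
      have h1 : e k ≤ 2 * Real.sqrt (1/(q k:ℝ)) := by
        rw [he, Real.sqrt_div (by norm_num), Real.sqrt_one]
        simp only
        rw [div_le_iff₀ (hq0 k)]
        calc _ ≤ _ := hl
          _ = 2 * (1/Real.sqrt (q k)) * (Real.sqrt (q k) * Real.sqrt (q k)) := by field_simp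
          _ = _ := by rw [hsq]
      refine h1.trans ?_
      gcongr
      apply Real.sqrt_le_iff.mpr
      refine ⟨by positivity, ?_⟩
      rw [← pow_mul, mul_comm k 2, pow_mul, Real.sq_sqrt (by norm_num)]
      exact hinv k
    · apply (summable_geometric_of_lt_one (Real.sqrt_nonneg _) _).mul_left
      rw [Real.sqrt_lt' (by norm_num)]; norm_num
  obtain ⟨k0, hk0⟩ : ∃ k0 : ℕ, 400*C^2 ≤ (2:ℝ)^k0 := by
    obtain ⟨k, hk⟩ := pow_unbounded_of_one_lt (400*C^2) (by norm_num : (1:ℝ) < 2)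
    exact ⟨k, hk.le⟩
  have hqC : ∀ k ≥ k0, 400*C^2 ≤ q k := fun k hk => by
    refine hk0.trans (le_trans (pow_le_pow_right₀ (by norm_num) hk) ?_)
    exact_mod_cast hq2 k
  have hbad : ∀ k, ¬ (q k^10 ≤ q (k+1)) → T k ≤ 10 * e k := by
    intro k hk
    push Not at hk
    have : Real.log (q (k+1)) ≤ 10 * Real.log (q k) := by
      have h10 : (10:ℝ) * Real.log (q k) = Real.log ((q k:ℝ)^10) := by rw [Real.log_pow]; norm_num
      rw [h10]
      apply Real.log_le_log (hq0 _)
      exact_mod_cast hk.le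
    calc T k ≤ (10 * Real.log (q k)) / q k := by
          have := hq0 k
          simp only [hT]; gcongr
      _ = _ := by simp only [he]; ring
  classical
  by_cases hex : ∃ j ≥ k0, q j^10 ≤ q (j+1)
  swap
  · push Not at hex
    rw [← summable_nat_add_iff k0]
    apply Summable.of_nonneg_of_le (fun _ => hT0 _) (f := fun k => 10 * e (k+k0))
    · intro k
      exact hbad _ (not_le.mpr (hex _ (by omega)))
    · exact ((summable_nat_add_iff k0).mpr hes).mul_left 10
  obtain ⟨j0, hj0, hj0g⟩ := hex
  set g : ℕ → ℝ := fun i => if q i^10 ≤ q (i+1) ∧ j0 < i then T i else 0 with hg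
  have hg0 : ∀ i, 0 ≤ g i := fun i => by
    simp only [hg]; split_ifs
    · exact hT0 i
    · exact le_rfl
  set err : ℕ → ℝ := fun i => (3 + Real.log (1/κ) + i) * (1/2)^i + 20 * e i with herr
  have hlκ : 0 ≤ Real.log (1/κ) := by
    apply Real.log_nonneg
    rw [le_div_iff₀ hκ0]; linarith
  have herr0 : ∀ i, 0 ≤ err i := fun i => by
    have := he0 i
    simp only [herr]; positivity
  have herrs : Summable err := by
    apply Summable.add _ (hes.mul_left 20)
    have h1 : Summable fun i : ℕ => (3 + Real.log (1/κ)) * (1/2:ℝ)^i :=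
      (summable_geometric_of_lt_one (by norm_num) (by norm_num)).mul_left _
    have h2 : Summable fun i : ℕ => (i:ℝ) * (1/2:ℝ)^i := by
      simpa using summable_pow_mul_geometric_of_norm_lt_one 1 (r := (1/2:ℝ)) (by norm_num)
    refine (h1.add h2).congr fun i => by ring
  have claim : ∀ m, j0 + 1 ≤ m → ∃ j, j < m ∧ j0 ≤ j ∧ q j^10 ≤ q (j+1) ∧ ∃ (h : Polynomial ℂ) (s : ℕ) (b : ℝ),
      Polynomial.X^2 ∣ h ∧ nu h ≤ κ * (1 - (1/2)^m) ∧ 1 ≤ s ∧ 0 ≤ b ∧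
      Real.exp ((q j+1)*b) ≤ ‖PowerSeries.coeff (q j+1) ((lin (lam α) h)^s)‖ ∧
      ∑ i ∈ Finset.range m, (g i / 3 - err i) - 20 * e j0 ≤ b - 20 * e j := by
    intro m hm
    induction m, hm using Nat.le_induction with
    | base =>
      refine ⟨j0, by omega, le_rfl, hj0g, 0, q j0 + 1, 0, dvd_zero _, ?_, by omega, le_rfl, ?_, ?_⟩
      · have : nu 0 = 0 := by simp [nu]
        rw [this]
        apply mul_nonneg hκ0.le
        have : (1/2:ℝ)^(j0+1) ≤ 1 := pow_le_one₀ (by norm_num) (by norm_num)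
        linarith
      · rw [coeff_pow_self (X_dvd_lin _ _) (lin_one _ _)]; simp
      · have : ∑ i ∈ Finset.range (j0+1), (g i / 3 - err i) ≤ 0 := by
          apply Finset.sum_nonpos
          intro i hi
          have : g i = 0 := by
            simp only [hg]; rw [if_neg]; simp at hi; omega
          rw [this]; have := herr0 i; linarith
        linarith
    | succ m hm ih =>
      obtain ⟨j, hjm, hj0j, hjg, h, s, b, hX, hnu, hs, hb, hbc, hsum⟩ := ih
      by_cases hmg : q m^10 ≤ q (m+1)
      swap
      · refine ⟨j, by omega, hj0j, hjg, h, s, b, hX, hnu.trans ?_, hs, hb, hbc, ?_⟩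
        · have hpp : (1/2:ℝ)^(m+1) ≤ (1/2)^m :=
            pow_le_pow_of_le_one (by norm_num) (by norm_num) (by omega)
          apply mul_le_mul_of_nonneg_left _ hκ0.le
          linarith
        · rw [Finset.sum_range_succ]
          have : g m = 0 := by
            simp only [hg]; rw [if_neg]; tauto
          rw [this]; have := herr0 m; linarith
      · set τ := κ * (1/2)^(m+1) with hτ
        have hτ0 : 0 < τ := by positivity
        have hp1 : (1/2:ℝ)^(m+1) ≤ 1 := pow_le_one₀ (by norm_num) (by norm_num)
        have hτ1 : τ ≤ 1 := by
          calc τ ≤ κ * 1 := by rw [hτ]; gcongr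
            _ ≤ 1 := by linarith
        have hnu' : nu h + τ ≤ κ * (1 - (1/2)^(m+1)) := by
          have : κ * (1 - (1/2)^m) + τ = κ * (1 - (1/2)^(m+1)) := by rw [hτ]; ring
          linarith
        have hκ' : κ * (1 - (1/2:ℝ)^(m+1)) ≤ κ := by
          apply mul_le_of_le_one_right hκ0.le
          have : (0:ℝ) ≤ (1/2)^(m+1) := by positivity
          linarith
        obtain ⟨h', hX', hnu2, s', hs', hs'n, hbc'⟩ := step hirr hκ hC hst (q := q j) (q' := q (j+1))
          (n := q m) (p := p j) (hup j) (hlo j) (hcop j) (hqC j (by omega)) hjg (hmono (by omega))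
          hX hτ0 hτ1 (hnu'.trans hκ') hb hs hbc
        refine ⟨m, by omega, by omega, hmg, h', s', _, hX', hnu2.trans hnu', hs', le_max_left _ _, hbc', ?_⟩
        rw [Finset.sum_range_succ]
        have hgm : g m = T m := by
          simp only [hg]; rw [if_pos]; exact ⟨hmg, by omega⟩
        rw [hgm]
        refine le_trans ?_ (sub_le_sub_right (le_max_right _ _) _)
        have hqm := hq0 m
        -- the small divisor
        have hdiv : T m / 3 - 2 * (1/2)^m ≤ Real.log (‖lam α^(q m) - 1‖⁻¹)/(q m+2) := by
          have hle := lam_pow_q_le (hup m)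
          have hne : 0 < ‖lam α^(q m) - 1‖ := by
            rw [norm_pos_iff]
            obtain ⟨u, hu⟩ : ∃ u, q m = u+1 := ⟨q m-1, by have := hq1 m; have : 1 ≤ q m := by exact_mod_cast this
                                                          omega⟩
            rw [hu]
            intro h0
            apply lam_NR hirr u
            have : lam α^(u+2) - lam α = lam α * (lam α^(u+1) - 1) := by ring
            rw [this, h0, mul_zero]
          have hlog : Real.log (q (m+1)) - 2 ≤ Real.log (‖lam α^(q m) - 1‖⁻¹) := by
            rw [Real.log_inv]
            have h1 := Real.log_le_log hne hle
            rw [Real.log_div (by positivity) (hq0 (m+1)).ne'] at h1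
            have h2 : Real.log (2*Real.pi) ≤ 2 := by
              rw [Real.log_le_iff_le_exp (by positivity)]
              have h3 := Real.exp_one_gt_d9
              have h4 : Real.exp 2 = Real.exp 1 * Real.exp 1 := by rw [← Real.exp_add]; norm_num
              have := Real.pi_lt_d2
              rw [h4]; nlinarith
            linarith
          have hlq : 0 ≤ Real.log (q (m+1)) := Real.log_nonneg (hq1 _)
          calc T m / 3 - 2 * (1/2)^m ≤ Real.log (q (m+1)) / (q m + 2) - 2 * (1/(q m + 2)) := by
                have a1 : T m / 3 ≤ Real.log (q (m+1)) / (q m + 2) := by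
                  simp only [hT]
                  rw [div_div]
                  apply div_le_div_of_nonneg_left hlq (by linarith)
                  have := hq1 m
                  linarith
                have a2 : 1/((q m:ℝ)+2) ≤ (1/2)^m := by
                  refine le_trans ?_ (hinv m)
                  apply one_div_le_one_div_of_le hqm; linarith
                linarith
            _ = (Real.log (q (m+1)) - 2)/(q m + 2) := by ring
            _ ≤ _ := by gcongr
        have hτe : Real.log (1/τ) / q m ≤ (Real.log (1/κ) + (m+1)) * (1/2)^m := by
          have h1 : Real.log (1/τ) ≤ Real.log (1/κ) + (m+1) := by
            have : (1/τ:ℝ) = 1/κ * 2^(m+1) := by rw [hτ]; field_simp; rw [← mul_pow]; norm_num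
            rw [this, Real.log_mul (by positivity) (by positivity), Real.log_pow]
            push_cast
            have := Real.log_two_lt_d9
            have hm0 : (0:ℝ) ≤ m + 1 := by positivity
            nlinarith
          calc Real.log (1/τ) / q m ≤ (Real.log (1/κ) + (m+1)) / q m := by gcongr
            _ = (Real.log (1/κ) + (m+1)) * (1/q m) := by ring
            _ ≤ _ := by gcongr; exact hinv m
        have : err m = 2 * (1/2)^m + (Real.log (1/κ) + (m+1)) * (1/2)^m + 20 * e m := by
          simp only [herr]; ring
        rw [this]
        simp only [he] at hsum ⊢
        linarith
  have hgs : Summable g := by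
    apply summable_of_sum_range_le hg0 (c := 3 * (Real.log (4*C^2) + 20 * e j0 + ∑' i, err i))
    intro m
    obtain ⟨j, _, _, _, h, s, b, hX, hnu, hs, hb, hbc, hsum⟩ := claim (m + j0 + 1) (by omega)
    have hκ' : nu h ≤ κ := by
      refine hnu.trans (mul_le_of_le_one_right hκ0.le ?_)
      have : (0:ℝ) ≤ (1/2)^(m+j0+1) := by positivity
      linarith
    have hbb : b ≤ Real.log (4*C^2) := by
      have h1 := hbc.trans (coeff_pow_le (lin_zero _ _) (lin_one _ _) hC (hst h hX hκ') s (q j + 1))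
      have h2 := Real.log_le_log (Real.exp_pos _) h1
      rw [Real.log_exp, Real.log_pow] at h2
      push_cast at h2
      have := hq0 j
      exact le_of_mul_le_mul_left h2 (by positivity)
    have h1 : ∑ i ∈ Finset.range m, g i ≤ ∑ i ∈ Finset.range (m+j0+1), g i := by
      apply Finset.sum_le_sum_of_subset_of_nonneg
      · intro i; simp; omega
      · intro i _ _; exact hg0 i
    have h2 : ∑ i ∈ Finset.range (m+j0+1), err i ≤ ∑' i, err i :=
      herrs.sum_le_tsum _ (fun i _ => herr0 i)
    rw [Finset.sum_sub_distrib, ← Finset.sum_div] at hsum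
    have := he0 j
    linarith
  rw [← summable_nat_add_iff (j0+1)]
  apply Summable.of_nonneg_of_le (fun _ => hT0 _) (f := fun k => g (k+(j0+1)) + 10 * e (k+(j0+1)))
  · intro k
    by_cases hk : q (k+(j0+1))^10 ≤ q (k+(j0+1)+1)
    · have : g (k+(j0+1)) = T (k+(j0+1)) := by
        simp only [hg]; rw [if_pos]; exact ⟨hk, by omega⟩
      rw [this]; have := he0 (k+(j0+1)); linarith
    · have := hbad _ hk
      have := hg0 (k+(j0+1)); linarith
  · exact ((summable_nat_add_iff (j0+1)).mpr hgs).add (((summable_nat_add_iff (j0+1)).mpr hes).mul_left 10)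
end QL

namespace QL

/-- holomorphic logarithm on a ball -/
lemma exists_log {g : ℂ → ℂ} {R : ℝ} (hR : 0 < R) (hg : DifferentiableOn ℂ g (Metric.ball 0 R))
    (h0 : ∀ z ∈ Metric.ball (0:ℂ) R, g z ≠ 0) :
    ∃ L : ℂ → ℂ, DifferentiableOn ℂ L (Metric.ball 0 R) ∧ L 0 = Complex.log (g 0) ∧
      ∀ z ∈ Metric.ball (0:ℂ) R, Complex.exp (L z) = g z := by
  have hd : DifferentiableOn ℂ (fun z => deriv g z / g z) (Metric.ball 0 R) :=
    (hg.deriv Metric.isOpen_ball).div hg h0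
  have hex := hd.isExactOn_ball
  obtain ⟨L, hL0, hL⟩ := hex.with_val_at 0 (Complex.log (g 0))
  have hLd : DifferentiableOn ℂ L (Metric.ball 0 R) := fun z hz =>
    (hL z hz).differentiableAt.differentiableWithinAt
  refine ⟨L, hLd, hL0, ?_⟩
  have h00 : (0:ℂ) ∈ Metric.ball (0:ℂ) R := Metric.mem_ball_self hR
  have key : ∀ z ∈ Metric.ball (0:ℂ) R, g z * Complex.exp (-L z) = g 0 * Complex.exp (-L 0) := by
    intro z hz
    have hde : ∀ x ∈ Metric.ball (0:ℂ) R, HasDerivAt (fun z => g z * Complex.exp (-L z)) 0 x := by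
      intro x hx
      have h1 := (hg.differentiableAt (Metric.isOpen_ball.mem_nhds hx)).hasDerivAt
      have h2 := h1.mul ((hL x hx).neg.cexp)
      have := h0 x hx
      refine h2.congr_deriv ?_
      show deriv g x * Complex.exp (-L x) + g x * (Complex.exp (-L x) * -(deriv g x/g x)) = 0
      field_simp
      ring
    exact (convex_ball (0:ℂ) R).is_const_of_fderivWithin_eq_zero (𝕜 := ℂ)
      (fun x hx => (hde x hx).differentiableAt.differentiableWithinAt)
      (fun x hx => by
        have := (hde x hx).hasFDerivAt.hasFDerivWithinAt (s := Metric.ball (0:ℂ) R)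
        rw [this.fderivWithin (Metric.isOpen_ball.uniqueDiffWithinAt hx)]
        ext; simp) hz h00
  intro z hz
  have := key z hz
  rw [hL0, Complex.exp_neg, Complex.exp_neg, Complex.exp_log (h0 0 h00),
    mul_inv_cancel₀ (h0 0 h00), ← div_eq_mul_inv, div_eq_one_iff_eq (Complex.exp_ne_zero _)] at this
  exact this.symm

/-- Harnack type lower bound -/
lemma harnack {c : ℝ} (hc : 0 < c) : ∃ c' > 0, ∀ g : ℂ → ℂ,
    DifferentiableOn ℂ g (Metric.ball 0 1) → (∀ z ∈ Metric.ball (0:ℂ) 1, g z ≠ 0) →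
    (∀ z ∈ Metric.ball (0:ℂ) 1, ‖g z‖ ≤ 21/10) → c ≤ ‖g 0‖ → c' ≤ ‖g (1/2)‖ := by
  refine ⟨Real.exp (-(2 * (1 + |Real.log (21/10) - Real.log c|))) * c, by positivity, ?_⟩
  intro g hg h0 hb hc0
  obtain ⟨L, hL, hL0, hexp⟩ := exists_log one_pos hg h0
  have h00 : (0:ℂ) ∈ Metric.ball (0:ℂ) 1 := Metric.mem_ball_self one_pos
  have h12 : (1/2:ℂ) ∈ Metric.ball (0:ℂ) 1 := by simp; norm_num
  have hre : ∀ z ∈ Metric.ball (0:ℂ) 1, (L z).re = Real.log ‖g z‖ := by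
    intro z hz
    rw [← hexp z hz, Complex.norm_exp, Real.log_exp]
  set M := 1 + |Real.log (21/10) - Real.log c|
  have hM : 0 < M := by positivity
  have := Complex.borelCaratheodory_zero (f := fun z => L z - L 0) (M := M) (R := 1) (z := 1/2) hM
    (hL.sub_const _) (by
      intro z hz
      simp only [Set.mem_ofPred_eq, Complex.sub_re]
      rw [hre z hz, hre 0 h00]
      have h1 : Real.log ‖g z‖ ≤ Real.log (21/10) :=
        Real.log_le_log (norm_pos_iff.mpr (h0 z hz)) (hb z hz)
      have h2 : Real.log c ≤ Real.log ‖g 0‖ := Real.log_le_log hc hc0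
      have := le_abs_self (Real.log (21/10) - Real.log c)
      linarith) one_pos h12 (by simp)
  have h3 : ‖(1/2:ℂ)‖ = 1/2 := by simp
  rw [h3] at this
  have h4 : |(L (1/2) - L 0).re| ≤ 2 * M := by
    refine (Complex.abs_re_le_norm _).trans (this.trans (le_of_eq ?_)); ring
  rw [Complex.sub_re, hre _ h12, hre _ h00] at h4
  have h5 := (abs_le.mp h4).1
  have hg0 : 0 < ‖g 0‖ := norm_pos_iff.mpr (h0 0 h00)
  have hg1 : 0 < ‖g (1/2)‖ := norm_pos_iff.mpr (h0 _ h12)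
  calc Real.exp (-(2*M)) * c ≤ Real.exp (-(2*M)) * ‖g 0‖ := by gcongr
    _ = Real.exp (-(2*M) + Real.log ‖g 0‖) := by rw [Real.exp_add, Real.exp_log hg0]
    _ ≤ Real.exp (Real.log ‖g (1/2)‖) := by apply Real.exp_le_exp.mpr; linarith
    _ = _ := Real.exp_log hg1

/-- first exit -/
lemma first_exit {F : ℂ → ℂ} {R c : ℝ} (hF : ContinuousOn F (Metric.closedBall 0 R))
    (h0 : ‖F 0‖ < c) {z : ℂ} (hz : ‖z‖ ≤ R) (hzc : c ≤ ‖F z‖) :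
    ∃ z1, 0 < ‖z1‖ ∧ ‖z1‖ ≤ ‖z‖ ∧ ‖F z1‖ = c ∧ ∀ w, ‖w‖ < ‖z1‖ → ‖F w‖ < c := by
  set K := Metric.closedBall (0:ℂ) R ∩ (fun w => ‖F w‖) ⁻¹' Set.Ici c with hK
  have hKc : IsCompact K := by
    apply (isCompact_closedBall (0:ℂ) R).of_isClosed_subset _ Set.inter_subset_left
    exact hF.norm.preimage_isClosed_of_isClosed Metric.isClosed_closedBall isClosed_Ici
  have hzK : z ∈ K := ⟨by simpa using hz, hzc⟩
  obtain ⟨z1, hz1, hmin⟩ := hKc.exists_isMinOn ⟨z, hzK⟩ continuous_norm.continuousOn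
  have hz1R : ‖z1‖ ≤ R := by simpa using hz1.1
  have hz1c : c ≤ ‖F z1‖ := hz1.2
  have hlt : ∀ w, ‖w‖ < ‖z1‖ → ‖F w‖ < c := by
    intro w hw
    by_contra hcon
    have := hmin (a := w) ⟨by simpa using hw.le.trans hz1R, not_lt.mp hcon⟩
    simp only [Set.mem_ofPred_eq] at this
    linarith
  have hz1p : 0 < ‖z1‖ := by
    rw [norm_pos_iff]; rintro rfl; linarith
  refine ⟨z1, hz1p, hmin hzK, le_antisymm ?_ hz1c, hlt⟩
  have ht : Tendsto (fun n : ℕ => (1 - 1/((n:ℝ)+1))) atTop (nhds (1 - 0)) :=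
    tendsto_const_nhds.sub tendsto_one_div_add_atTop_nhds_zero_nat
  have ht2 : Tendsto (fun n : ℕ => (((1 - 1/((n:ℝ)+1) : ℝ)) : ℂ) * z1) atTop (nhds z1) := by
    have := ((Complex.continuous_ofReal.tendsto _).comp ht).mul_const z1
    simpa using this
  have hn : ∀ n : ℕ, ‖(((1 - 1/((n:ℝ)+1) : ℝ)) : ℂ) * z1‖ < ‖z1‖ := by
    intro n
    rw [norm_mul, Complex.norm_real, Real.norm_eq_abs]
    have h1 : (0:ℝ) < 1/((n:ℝ)+1) := by positivity
    have h2 : 1/((n:ℝ)+1) ≤ 1 := by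
      rw [div_le_one (by positivity)]; have : (0:ℝ) ≤ n := by positivity
      linarith
    rw [abs_of_nonneg (by linarith)]
    nlinarith
  have hcw := (hF z1 (by simpa using hz1R)).tendsto.norm
  have ht3 : Tendsto (fun n : ℕ => (((1 - 1/((n:ℝ)+1) : ℝ)) : ℂ) * z1) atTop
      (nhdsWithin z1 (Metric.closedBall 0 R)) := by
    rw [tendsto_nhdsWithin_iff]
    exact ⟨ht2, Eventually.of_forall fun n => by simpa using (hn n).le.trans hz1R⟩
  exact le_of_tendsto (hcw.comp ht3) (Eventually.of_forall fun n => (hlt _ (hn n)).le)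

/-- coefficientwise holomorphic families of polynomials -/
def CP (p : ℂ → Polynomial ℂ) : Prop := ∀ j, Differentiable ℂ (fun t => (p t).coeff j)

lemma CP.const (p : Polynomial ℂ) : CP (fun _ => p) := fun j => differentiable_const _

lemma CP.add {p q : ℂ → Polynomial ℂ} (hp : CP p) (hq : CP q) : CP (fun t => p t + q t) := by
  intro j; simp only [Polynomial.coeff_add]; exact (hp j).add (hq j)

lemma CP.mul {p q : ℂ → Polynomial ℂ} (hp : CP p) (hq : CP q) : CP (fun t => p t * q t) := by
  intro j
  simp only [Polynomial.coeff_mul]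
  apply Differentiable.fun_sum
  intro i _
  exact (hp i.1).mul (hq i.2)

lemma CP.C : CP (fun t => Polynomial.C t) := by
  intro j
  simp only [Polynomial.coeff_C]
  split_ifs <;> fun_prop

lemma CP.pow {p : ℂ → Polynomial ℂ} (hp : CP p) (n : ℕ) : CP (fun t => p t ^ n) := by
  induction n with
  | zero => simpa using CP.const 1
  | succ n ih => simp only [pow_succ]; exact ih.mul hp

lemma CP.comp {p : ℂ → Polynomial ℂ} (hp : CP p) (a : Polynomial ℂ) : CP (fun t => a.comp (p t)) := by
  induction a using Polynomial.induction_on' with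
  | add a b ha hb => simp only [Polynomial.add_comp]; exact ha.add hb
  | monomial n c =>
    simp only [Polynomial.monomial_comp]
    exact (CP.const _).mul (hp.pow n)

/-- scaling covariance of the linearization -/
lemma lin_scale (μ : ℂ) (hμ : NR μ) {h g : Polynomial ℂ} (hh : Polynomial.X^2 ∣ h)
    (hg : Polynomial.X^2 ∣ g) {σ : ℂ} (hσ : σ ≠ 0)
    (hgh : ∀ k, σ * g.coeff k = σ^k * h.coeff k) (k : ℕ) :
    σ * PowerSeries.coeff k (lin μ g) = σ^k * PowerSeries.coeff k (lin μ h) := by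
  set φ : PowerSeries ℂ := PowerSeries.C σ⁻¹ * PowerSeries.rescale σ (lin μ h) with hφ
  have hgp : Polynomial.C σ * g = h.comp (Polynomial.C σ * Polynomial.X) := by
    ext k
    rw [Polynomial.coeff_C_mul, hgh, Polynomial.comp_C_mul_X_coeff, mul_comm]
  have hC : (PowerSeries.C σ * PowerSeries.C σ⁻¹ : PowerSeries ℂ) = 1 := by
    rw [← map_mul, mul_inv_cancel₀ hσ, map_one]
  have hCφ : PowerSeries.C σ * φ = PowerSeries.rescale σ (lin μ h) := by
    rw [hφ, ← mul_assoc, hC, one_mul]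
  have e1 : PowerSeries.C σ * Polynomial.aeval φ g =
      Polynomial.aeval (PowerSeries.rescale σ (lin μ h)) h := by
    have := congrArg (Polynomial.aeval φ) hgp
    rw [map_mul, Polynomial.aeval_C, Polynomial.aeval_comp, map_mul, Polynomial.aeval_C,
      Polynomial.aeval_X] at this
    rw [← hCφ]; exact this
  have key : φ = lin μ g := by
    apply lin_unique μ hμ g hg
    · rw [hφ, PowerSeries.coeff_C_mul, coeff_rescale', lin_zero]; simp
    · rw [hφ, PowerSeries.coeff_C_mul, coeff_rescale', lin_one]; field_simp
    · have hi : (PowerSeries.C σ⁻¹ * PowerSeries.C σ : PowerSeries ℂ) = 1 := by rw [mul_comm, hC]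
      have h1 : ∀ x y : PowerSeries ℂ, PowerSeries.C σ * x = PowerSeries.C σ * y → x = y := by
        intro x y hxy
        have := congrArg (fun u => PowerSeries.C σ⁻¹ * u) hxy
        simpa only [← mul_assoc, hi, one_mul] using this
      apply h1
      rw [mul_add, e1, ← rescale_aeval]
      have h2 : PowerSeries.C σ * PowerSeries.rescale μ φ
          = PowerSeries.rescale σ (PowerSeries.rescale μ (lin μ h)) := by
        ext k
        rw [PowerSeries.coeff_C_mul, coeff_rescale', coeff_rescale', coeff_rescale', hφ,
          PowerSeries.coeff_C_mul, coeff_rescale']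
        field_simp
      rw [h2, lin_eq μ hμ h hh, map_add, map_mul, rescale_C, mul_left_comm, hCφ]
  rw [← key, hφ, PowerSeries.coeff_C_mul, coeff_rescale']
  field_simp

end QL

namespace QL

/-- truncated weighted norm -/
noncomputable def Nn (r : ℝ) (n : ℕ) (φ : PowerSeries ℂ) : ℝ :=
  ∑ i ∈ Finset.range n, ‖PowerSeries.coeff i φ‖ * r^i

section
variable {r : ℝ} (hr : 0 ≤ r) (n : ℕ)

lemma Nn_nonneg {r : ℝ} (hr : 0 ≤ r) (n : ℕ) (φ : PowerSeries ℂ) : 0 ≤ Nn r n φ :=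
  Finset.sum_nonneg fun _ _ => by positivity

lemma Nn_mul {r : ℝ} (hr : 0 ≤ r) (n : ℕ) (φ ψ : PowerSeries ℂ) :
    Nn r n (φ * ψ) ≤ Nn r n φ * Nn r n ψ := by
  set F : ℕ → ℝ := fun i => ‖PowerSeries.coeff i φ‖ * r^i with hF
  set G : ℕ → ℝ := fun i => ‖PowerSeries.coeff i ψ‖ * r^i with hG
  have hF0 : ∀ i, 0 ≤ F i := fun i => by simp only [hF]; positivity
  have hG0 : ∀ i, 0 ≤ G i := fun i => by simp only [hG]; positivity
  calc Nn r n (φ * ψ) ≤ ∑ i ∈ Finset.range n, ∑ p ∈ Finset.HasAntidiagonal.antidiagonal i,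
        F p.1 * G p.2 := by
        apply Finset.sum_le_sum
        intro i _
        rw [PowerSeries.coeff_mul]
        calc _ ≤ (∑ p ∈ Finset.HasAntidiagonal.antidiagonal i,
              ‖PowerSeries.coeff p.1 φ * PowerSeries.coeff p.2 ψ‖) * r^i := by
              gcongr; exact norm_sum_le _ _
          _ = _ := by
              rw [Finset.sum_mul]
              apply Finset.sum_congr rfl
              intro p hp
              rw [Finset.HasAntidiagonal.mem_antidiagonal] at hp
              rw [← hp, norm_mul, pow_add]; simp only [hF, hG]; ring
    _ = ∑ x ∈ (Finset.range n).sigma (fun i => Finset.HasAntidiagonal.antidiagonal i),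
          F x.2.1 * G x.2.2 := by rw [Finset.sum_sigma]
    _ = ∑ p ∈ ((Finset.range n).sigma (fun i => Finset.HasAntidiagonal.antidiagonal i)).image
          (fun x => x.2), F p.1 * G p.2 := by
        rw [Finset.sum_image]
        rintro ⟨i, p⟩ hx ⟨j, q⟩ hy hxy
        simp at hx hy hxy
        obtain ⟨_, hx⟩ := hx
        obtain ⟨_, hy⟩ := hy
        subst hxy
        subst hx
        subst hy
        rfl
    _ ≤ ∑ p ∈ Finset.range n ×ˢ Finset.range n, F p.1 * G p.2 := by
        apply Finset.sum_le_sum_of_subset_of_nonneg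
        · intro p hp
          simp at hp ⊢
          omega
        · intro p _ _; exact mul_nonneg (hF0 _) (hG0 _)
    _ = Nn r n φ * Nn r n ψ := by
        rw [Nn, Nn, Finset.sum_mul_sum, Finset.sum_product]

lemma Nn_C_mul (r : ℝ) (n : ℕ) (c : ℂ) (φ : PowerSeries ℂ) :
    Nn r n (PowerSeries.C c * φ) = ‖c‖ * Nn r n φ := by
  simp only [Nn, PowerSeries.coeff_C_mul, norm_mul, Finset.mul_sum, mul_assoc]

lemma Nn_one_le (r : ℝ) (n : ℕ) : Nn r n 1 ≤ 1 := by
  rw [Nn]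
  rcases n with _ | n
  · simp
  · rw [Finset.sum_range_succ']
    simp [PowerSeries.coeff_one]

lemma Nn_pow {r : ℝ} (hr : 0 ≤ r) (n : ℕ) (φ : PowerSeries ℂ) (j : ℕ) :
    Nn r n (φ^j) ≤ (Nn r n φ)^j := by
  induction j with
  | zero => simpa using Nn_one_le r n
  | succ j ih =>
    rw [pow_succ, pow_succ]
    exact (Nn_mul hr n _ _).trans (by
      have := Nn_nonneg hr n φ
      gcongr)

lemma Nn_aeval {r : ℝ} (hr : 0 ≤ r) (n : ℕ) (φ : PowerSeries ℂ) (h : Polynomial ℂ) :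
    Nn r n (Polynomial.aeval φ h) ≤ ∑ j ∈ Finset.range (h.natDegree+1), ‖h.coeff j‖ * (Nn r n φ)^j := by
  rw [Polynomial.aeval_eq_sum_range]
  calc Nn r n (∑ j ∈ Finset.range (h.natDegree+1), h.coeff j • φ^j)
      ≤ ∑ j ∈ Finset.range (h.natDegree+1), Nn r n (h.coeff j • φ^j) := by
        simp only [Nn]
        rw [Finset.sum_comm]
        apply Finset.sum_le_sum
        intro i _
        rw [map_sum, ← Finset.sum_mul]
        gcongr
        exact norm_sum_le _ _
    _ ≤ _ := by
        apply Finset.sum_le_sum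
        intro j _
        have : h.coeff j • φ^j = PowerSeries.C (h.coeff j) * φ^j := by
          rw [PowerSeries.smul_eq_C_mul]
        rw [this, Nn_C_mul]
        gcongr
        exact Nn_pow hr n φ j
end

lemma small_div {μ : ℂ} (h1 : ‖μ‖ < 1) (m : ℕ) : ‖μ‖ * (1 - ‖μ‖) ≤ ‖μ^(m+2) - μ‖ := by
  have h2 : ‖μ^(m+2)‖ ≤ ‖μ‖^2 := by
    rw [norm_pow]; exact pow_le_pow_of_le_one (norm_nonneg _) h1.le (by omega)
  have h3 := norm_sub_norm_le μ (μ^(m+2))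
  rw [norm_sub_rev] at h3
  nlinarith

lemma NR_of_lt {μ : ℂ} (h0 : μ ≠ 0) (h1 : ‖μ‖ < 1) : NR μ := by
  intro m hm
  have := small_div h1 m
  rw [hm, norm_zero] at this
  have h2 : 0 < ‖μ‖ := norm_pos_iff.mpr h0
  nlinarith

lemma lin_conv {μ : ℂ} (h0 : μ ≠ 0) (h1 : ‖μ‖ < 1) {h : Polynomial ℂ} (hh : Polynomial.X^2 ∣ h) :
    ∃ r > 0, AS (lin μ h) r := by
  set d := ‖μ‖ * (1 - ‖μ‖) with hd
  have hd0 : 0 < d := mul_pos (norm_pos_iff.mpr h0) (by linarith)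
  set H := ∑ j ∈ Finset.range (h.natDegree+1), ‖h.coeff j‖ with hH
  have hH0 : 0 ≤ H := Finset.sum_nonneg fun _ _ => norm_nonneg _
  set r := min (1/2) (d/(4*(H+1))) with hr
  have hr0 : 0 < r := lt_min (by norm_num) (by positivity)
  have hr1 : r ≤ 1/2 := min_le_left _ _
  have hr2 : 4*(H+1)*r ≤ d := by
    have : r ≤ d/(4*(H+1)) := min_le_right _ _
    rw [le_div_iff₀ (by positivity)] at this; linarith
  have hc0 : h.coeff 0 = 0 := by
    rw [Polynomial.X_pow_dvd_iff] at hh; exact hh 0 (by omega)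
  have hc1 : h.coeff 1 = 0 := by
    rw [Polynomial.X_pow_dvd_iff] at hh; exact hh 1 (by omega)
  have key : ∀ n, Nn r (n+2) (lin μ h) ≤ 2*r := by
    intro n
    induction n with
    | zero =>
      rw [Nn, Finset.sum_range_succ, Finset.sum_range_one, lin_zero, lin_one]
      simp; linarith
    | succ n ih =>
      have e1 : Nn r (n+1+2) (linP μ h n) = Nn r (n+2) (lin μ h) := by
        rw [Nn, Nn, show n+1+2 = (n+2)+1 by omega, Finset.sum_range_succ,
          coeff_linP_big _ _ _ _ (by omega)]
        simp only [norm_zero, zero_mul, add_zero]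
        apply Finset.sum_congr rfl
        intro i hi
        simp at hi
        rw [coeff_lin μ h n i (by omega)]
      have e2 : ∀ m, m ≤ n → PowerSeries.coeff (m+2) (lin μ h) =
          PowerSeries.coeff (m+2) (Polynomial.aeval (linP μ h n) h) / (μ^(m+2) - μ) := by
        intro m hm
        rw [lin_spec μ h hh]
        congr 1
        have := aeval_congr (k := n+2) h hh (X_dvd_linP μ h n) (X_dvd_lin μ h) (by
          rw [PowerSeries.X_pow_dvd_iff]
          intro i hi
          rw [map_sub, coeff_lin μ h n i (by omega), sub_self])
        rw [PowerSeries.X_pow_dvd_iff] at this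
        have h3 := this (m+2) (by omega)
        rw [map_sub, sub_eq_zero] at h3
        exact h3.symm
      have e3 : Nn r (n+1+2) (Polynomial.aeval (linP μ h n) h) ≤ H * (2*r)^2 := by
        refine (Nn_aeval hr0.le _ _ _).trans ?_
        rw [e1, hH, Finset.sum_mul]
        apply Finset.sum_le_sum
        intro j _
        rcases j with _ | _ | j
        · simp [hc0]
        · simp [hc1]
        · gcongr
          have hN := Nn_nonneg hr0.le (n+2) (lin μ h)
          calc (Nn r (n+2) (lin μ h))^(j+1+1) ≤ (2*r)^(j+1+1) := by gcongr
            _ ≤ (2*r)^2 := pow_le_pow_of_le_one (by positivity) (by linarith) (by omega)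
      rw [Nn, show n+1+2 = (n+1)+1+1 by omega, Finset.sum_range_succ', Finset.sum_range_succ']
      rw [Nn, show n+1+2 = (n+1)+1+1 by omega, Finset.sum_range_succ', Finset.sum_range_succ'] at e3
      simp only [zero_add, lin_zero, lin_one, pow_one, pow_zero, norm_zero, norm_one, zero_mul,
        one_mul, add_zero] at e3 ⊢
      have e4 : ∑ k ∈ Finset.range (n+1), ‖PowerSeries.coeff (k+1+1) (lin μ h)‖ * r^(k+1+1) ≤
          (1/d) * ∑ k ∈ Finset.range (n+1),
            ‖PowerSeries.coeff (k+1+1) (Polynomial.aeval (linP μ h n) h)‖ * r^(k+1+1) := by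
        rw [Finset.mul_sum]
        apply Finset.sum_le_sum
        intro k hk
        simp at hk
        rw [show k+1+1 = k+2 by omega, e2 k (by omega), norm_div, ← mul_assoc]
        gcongr
        rw [div_eq_mul_inv, mul_comm, one_div]
        gcongr
        exact small_div h1 k
      have e5 : ∑ k ∈ Finset.range (n+1),
            ‖PowerSeries.coeff (k+1+1) (Polynomial.aeval (linP μ h n) h)‖ * r^(k+1+1) ≤ H*(2*r)^2 := by
        refine le_trans ?_ e3
        have : 0 ≤ ‖PowerSeries.coeff 1 (Polynomial.aeval (linP μ h n) h)‖ * r := by positivity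
        have h7 : 0 ≤ ‖PowerSeries.coeff 0 (Polynomial.aeval (linP μ h n) h)‖ * 1 := by positivity
        linarith
      have e6 : (1/d) * (H*(2*r)^2) ≤ r := by
        rw [one_div, inv_mul_le_iff₀ hd0]
        nlinarith
      have e7 : (1/d) * ∑ k ∈ Finset.range (n+1),
            ‖PowerSeries.coeff (k+1+1) (Polynomial.aeval (linP μ h n) h)‖ * r^(k+1+1)
            ≤ (1/d) * (H*(2*r)^2) := by gcongr
      linarith
  refine ⟨r, hr0, summable_of_sum_range_le (c := 2*r) (fun k => by positivity) fun n => ?_⟩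
  refine le_trans ?_ (key n)
  rw [Nn]
  exact Finset.sum_le_sum_of_subset_of_nonneg (by
    intro i; simp; omega) (fun _ _ _ => by positivity)

end QL

namespace QL

/-- smallness class for the outer perturbation -/
def Good (a : Polynomial ℂ) : Prop := Polynomial.X^2 ∣ a ∧
  ∀ w w' : ℂ, ‖w‖ ≤ 7 → ‖w'‖ ≤ 7 → ‖a.eval w - a.eval w'‖ ≤ (1/50) * ‖w - w'‖

noncomputable def qq (μ : ℂ) : Polynomial ℂ := Polynomial.C μ * Polynomial.X + Polynomial.X^2

noncomputable def hq (μ : ℂ) (a : Polynomial ℂ) : Polynomial ℂ := Polynomial.X^2 + a.comp (qq μ)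

lemma X_dvd_qq (μ : ℂ) : Polynomial.X ∣ qq μ := by
  refine ⟨Polynomial.C μ + Polynomial.X, ?_⟩
  rw [qq]; ring

lemma X2_comp' {a p : Polynomial ℂ} (ha : Polynomial.X^2 ∣ a) (hp : Polynomial.X ∣ p) :
    Polynomial.X^2 ∣ a.comp p := by
  obtain ⟨b, rfl⟩ := ha
  rw [Polynomial.mul_comp, Polynomial.X_pow_comp]
  exact Dvd.dvd.mul_right (pow_dvd_pow_of_dvd hp 2) _

lemma X2_hq {μ : ℂ} {a : Polynomial ℂ} (ha : Polynomial.X^2 ∣ a) : Polynomial.X^2 ∣ hq μ a :=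
  dvd_add dvd_rfl (X2_comp' ha (X_dvd_qq μ))

/-- the step map -/
noncomputable def stp (μ : ℂ) (a : Polynomial ℂ) (y : ℂ) : ℂ :=
  (μ*y + y^2) + a.eval (μ*y+y^2)

lemma eval_hq (μ : ℂ) (a : Polynomial ℂ) (y : ℂ) :
    (Polynomial.C μ * Polynomial.X + hq μ a).eval y = stp μ a y := by
  simp [hq, qq, stp, Polynomial.eval_comp]; ring

lemma Good.zero {a : Polynomial ℂ} (ha : Good a) : a.eval 0 = 0 := by
  obtain ⟨b, rfl⟩ := ha.1
  simp

lemma Good.le {a : Polynomial ℂ} (ha : Good a) {w : ℂ} (hw : ‖w‖ ≤ 7) : ‖a.eval w‖ ≤ 1/50*‖w‖ := by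
  have := ha.2 w 0 hw (by simp)
  rwa [ha.zero, sub_zero, sub_zero] at this

lemma Good.inj {a : Polynomial ℂ} (ha : Good a) {w w' : ℂ} (hw : ‖w‖ ≤ 7) (hw' : ‖w'‖ ≤ 7) :
    ‖w - w'‖ ≤ 2 * ‖(w + a.eval w) - (w' + a.eval w')‖ := by
  have := ha.2 w w' hw hw'
  have h2 : w - w' = ((w + a.eval w) - (w' + a.eval w')) - (a.eval w - a.eval w') := by ring
  have h3 := norm_sub_le ((w + a.eval w) - (w' + a.eval w')) (a.eval w - a.eval w')
  rw [← h2] at h3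
  have := norm_nonneg (w - w')
  linarith

lemma Good.surj {a : Polynomial ℂ} (ha : Good a) {v : ℂ} (hv : ‖v‖ ≤ 5/2) :
    ∃ w, ‖w‖ ≤ 3 ∧ w + a.eval w = v := by
  set f : ℂ → ℂ := fun w => v - a.eval w with hf
  set s := Metric.closedBall (0:ℂ) 3 with hs
  have hms : Set.MapsTo f s s := by
    intro w hw
    have hw3 : ‖w‖ ≤ 3 := by simpa [hs] using hw
    have h1 := ha.le (w := w) (by linarith)
    have h2 := norm_sub_le v (a.eval w)
    have h3 : ‖f w‖ ≤ 3 := by simp only [hf]; linarith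
    simpa [hs] using h3
  have hc : ContractingWith (1/50) (hms.restrict f s s) := by
    refine ⟨by rw [← NNReal.coe_lt_coe]; norm_num, ?_⟩
    apply LipschitzWith.of_dist_le_mul
    rintro ⟨x, hx⟩ ⟨y, hy⟩
    have hx3 : ‖x‖ ≤ 3 := by simpa [hs] using hx
    have hy3 : ‖y‖ ≤ 3 := by simpa [hs] using hy
    have := ha.2 y x (by linarith) (by linarith)
    simp only [Subtype.dist_eq, Set.MapsTo.val_restrict_apply, dist_eq_norm, hf]
    rw [show v - a.eval x - (v - a.eval y) = a.eval y - a.eval x by ring, norm_sub_rev x y]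
    simpa using this
  obtain ⟨w, hw, hfw, -⟩ := hc.exists_fixedPoint' (s := s) Metric.isClosed_closedBall.isComplete hms
    (x := 0) (by simp [hs]) (edist_ne_top _ _)
  refine ⟨w, by simpa [hs] using hw, ?_⟩
  have : v - a.eval w = w := hfw
  rw [← this]; nth_rewrite 2 [this]; ring

lemma Good.inv {a : Polynomial ℂ} (ha : Good a) : ∃ B : ℂ → ℂ,
    (∀ v, ‖v‖ ≤ 5/2 → B v + a.eval (B v) = v) ∧
    (∀ w, ‖w‖ ≤ 7 → ‖w + a.eval w‖ ≤ 5/2 → B (w + a.eval w) = w) ∧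
    DifferentiableOn ℂ B (Metric.ball 0 (5/2)) := by
  have hex : ∀ v : ℂ, ∃ w, ‖v‖ ≤ 5/2 → ‖w‖ ≤ 3 ∧ w + a.eval w = v := by
    intro v
    by_cases hv : ‖v‖ ≤ 5/2
    · obtain ⟨w, hw⟩ := ha.surj hv; exact ⟨w, fun _ => hw⟩
    · exact ⟨0, fun h => absurd h hv⟩
  choose B hB using hex
  refine ⟨B, fun v hv => (hB v hv).2, ?_, ?_⟩
  · intro w hw hv
    obtain ⟨h1, h2⟩ := hB _ hv
    have := ha.inj (w := B (w + a.eval w)) (w' := w) (by linarith) hw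
    rw [h2, sub_self, norm_zero, mul_zero] at this
    exact sub_eq_zero.mp (norm_le_zero_iff.mp this)
  · intro v hv
    have hv' : ‖v‖ < 5/2 := by simpa using hv
    have hev : ∀ᶠ y in nhds v, ‖y‖ ≤ 5/2 := by
      filter_upwards [Metric.isOpen_ball.mem_nhds hv] with y hy
      have : ‖y‖ < 5/2 := by simpa using hy
      exact this.le
    have hlip : ∀ᶠ y in nhds v, ‖B y - B v‖ ≤ 2 * ‖y - v‖ := by
      filter_upwards [hev] with y hy
      have h1 := hB y hy
      have h2 := hB v hv'.le
      have := ha.inj (w := B y) (w' := B v) (by linarith) (by linarith)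
      rwa [h1.2, h2.2] at this
    have hcont : ContinuousAt B v := by
      rw [ContinuousAt, tendsto_iff_norm_sub_tendsto_zero]
      refine squeeze_zero' (Eventually.of_forall fun _ => norm_nonneg _) hlip ?_
      have : Tendsto (fun y : ℂ => 2 * ‖y - v‖) (nhds v) (nhds (2 * ‖v - v‖)) := by
        apply Continuous.tendsto (f := fun y : ℂ => 2 * ‖y - v‖); fun_prop
      simpa using this
    have hBv := hB v hv'.le
    have hda : HasDerivAt (fun w => w + a.eval w) (1 + a.derivative.eval (B v)) (B v) :=
      (hasDerivAt_id _).add (a.hasDerivAt _)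
    have hd1 : ‖a.derivative.eval (B v)‖ ≤ 1/50 := by
      apply (a.hasDerivAt (B v)).le_of_lip' (by norm_num)
      have : Metric.ball (0:ℂ) 7 ∈ nhds (B v) := Metric.isOpen_ball.mem_nhds (by
        simp; linarith [hBv.1])
      filter_upwards [this] with x hx
      have hx' : ‖x‖ < 7 := by simpa using hx
      exact ha.2 x (B v) hx'.le (by linarith [hBv.1])
    have hne : 1 + a.derivative.eval (B v) ≠ 0 := by
      intro h
      have h2 : a.derivative.eval (B v) = -1 := by linear_combination h
      rw [h2] at hd1; norm_num at hd1
    have := HasDerivAt.of_local_left_inverse hcont hda hne (by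
      filter_upwards [hev] with y hy
      exact (hB y hy).2)
    exact this.differentiableAt.differentiableWithinAt

/-- Koenigs limit -/
lemma koenigs {F : ℂ → ℂ} (hF0 : F 0 = 0) (hF : HasDerivAt F 1 0) {μ : ℂ} (h0 : μ ≠ 0) (h1 : ‖μ‖ < 1)
    (z : ℂ) : Tendsto (fun n : ℕ => F (μ^n * z) / μ^n) atTop (nhds z) := by
  have ht : Tendsto (fun n : ℕ => μ^n * z) atTop (nhds 0) := by
    simpa using (tendsto_pow_atTop_nhds_zero_of_norm_lt_one h1).mul_const z
  have := hF.isLittleO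
  simp only [hF0, sub_zero, smul_eq_mul, mul_one] at this
  have h2 := this.comp_tendsto ht
  have h3 : (fun n : ℕ => F (μ^n*z) - μ^n*z) =o[atTop] (fun n : ℕ => μ^n) := by
    refine h2.trans_isBigO ?_
    apply Asymptotics.IsBigO.of_bound ‖z‖
    refine Eventually.of_forall fun n => ?_
    simp only [Function.comp_apply, norm_mul]; rw [mul_comm]
  have h4 := h3.tendsto_div_nhds_zero
  have h5 := h4.add_const z
  rw [zero_add] at h5
  refine h5.congr fun n => ?_
  have : μ^n ≠ 0 := pow_ne_zero _ h0
  field_simp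
  ring

lemma ev_deriv {ψ : PowerSeries ℂ} {r : ℝ} (hr : 0 < r) (hA : AS ψ r)
    (h1 : PowerSeries.coeff 1 ψ = 1) : HasDerivAt (ev ψ) 1 0 := by
  have hd : DifferentiableOn ℂ (ev ψ) (Metric.ball 0 r) :=
    ev_differentiableOn fun s hs hsr => hA.mono hs hsr.le
  have hda := hd.differentiableAt (Metric.ball_mem_nhds (0:ℂ) hr)
  have := congrFun (hA.ht hr).tc_eq 1
  rw [tc, h1, iteratedDeriv_one] at this
  have h2 := hda.hasDerivAt
  simp at this
  rwa [this] at h2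

section
variable {μ : ℂ} {a : Polynomial ℂ}

lemma psi_step (h0 : μ ≠ 0) (h1 : ‖μ‖ < 1) (ha : Good a) {R : ℝ}
    (hA : ∀ r, 0 ≤ r → r < R → AS (lin μ (hq μ a)) r) {z : ℂ} (hz : ‖z‖ < R) :
    ev (lin μ (hq μ a)) (μ * z) = stp μ a (ev (lin μ (hq μ a)) z) := by
  rw [lin_func μ (NR_of_lt h0 h1) _ (X2_hq ha.1) (norm_nonneg z) (hA _ (norm_nonneg z) hz) le_rfl,
    eval_hq]

lemma psi_bound (h0 : μ ≠ 0) (h1 : ‖μ‖ < 1) (ha : Good a) {R : ℝ}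
    (hA : ∀ r, 0 ≤ r → r < R → AS (lin μ (hq μ a)) r) {z : ℂ} (hz : ‖z‖ < R) :
    ‖ev (lin μ (hq μ a)) z‖ ≤ 21/10 := by
  set F := ev (lin μ (hq μ a)) with hF
  by_contra hcon
  push Not at hcon
  have hd : DifferentiableOn ℂ F (Metric.ball 0 R) := ev_differentiableOn hA
  have hF0 : F 0 = 0 := by rw [hF, ev_zero, lin_zero]
  obtain ⟨z1, hz1p, hz1z, hz1c, hlt⟩ := first_exit (F := F) (R := ‖z‖) (c := 21/10)
    (hd.continuousOn.mono (by
      intro w hw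
      have : ‖w‖ ≤ ‖z‖ := by simpa using hw
      simpa using this.trans_lt hz)) (by rw [hF0]; norm_num) le_rfl hcon.le
  have hst := psi_step h0 h1 ha hA (z := z1) (hz1z.trans_lt hz)
  have h3 : ‖F (μ * z1)‖ < 21/10 := by
    apply hlt
    rw [norm_mul]; nlinarith
  rw [← hF] at hst
  rw [hst, stp] at h3
  set y := F z1
  set w := μ*y+y^2 with hw
  have hw1 : ‖w‖ ≤ 21/10 + (21/10)^2 := by
    refine (norm_add_le _ _).trans ?_
    rw [norm_mul, norm_pow, hz1c]; nlinarith
  have hw2 : (21/10)^2 - 21/10 ≤ ‖w‖ := by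
    have h4 := norm_sub_norm_le (y^2) (-(μ*y))
    rw [sub_neg_eq_add, norm_neg, add_comm (y^2), ← hw, norm_mul, norm_pow, hz1c] at h4
    nlinarith
  have h5 := ha.le (w := w) (by linarith)
  have h6 := norm_sub_norm_le w (-(a.eval w))
  rw [sub_neg_eq_add, norm_neg] at h6
  nlinarith

lemma structure_lemma (h0 : μ ≠ 0) (h1 : ‖μ‖ < 1) (ha : Good a) :
    ∃ u : ℂ, ∃ ρ : ℝ, u ≠ 0 ∧ ‖u‖ ≤ ρ ∧ (∀ r, 0 ≤ r → r < ρ → AS (lin μ (hq μ a)) r) ∧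
      ev (lin μ (hq μ a)) (μ * u) = -μ^2/4 + a.eval (-μ^2/4) := by
  set ψ := lin μ (hq μ a) with hψ
  set S : Set ℝ := {r | 0 ≤ r ∧ AS ψ r} with hS
  obtain ⟨r0, hr0, hAr0⟩ := lin_conv h0 h1 (X2_hq (μ := μ) ha.1)
  have hr0S : r0 ∈ S := ⟨hr0.le, hAr0⟩
  have hbd : BddAbove S := by
    refine ⟨21/10, ?_⟩
    rintro r ⟨hr, hAr⟩
    rcases hr.eq_or_lt with h | h
    · rw [← h]; norm_num
    have hAr' : ∀ s, 0 ≤ s → s < r → AS ψ s := fun s hs hsr => hAr.mono hs hsr.le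
    have := tc_norm_le' h (ev_differentiableOn hAr') (C := 21/10) (fun z hz =>
      psi_bound h0 h1 ha hAr' (by simpa using hz)) 1
    have e1 : PowerSeries.coeff 1 ψ = 1 := lin_one _ _
    rw [(hAr.ht h).tc_eq] at this
    simp only at this
    rw [e1, norm_one, pow_one, le_div_iff₀ h] at this
    linarith
  set ρ := sSup S with hρ
  have hr0ρ : r0 ≤ ρ := le_csSup hbd hr0S
  have hρ0 : 0 < ρ := by linarith
  have hA : ∀ r, 0 ≤ r → r < ρ → AS ψ r := by
    intro r hr hrρ
    obtain ⟨s, hs, hrs⟩ := exists_lt_of_lt_csSup ⟨r0, hr0S⟩ hrρ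
    exact hs.2.mono hr hrs.le
  have hb : ∀ z, ‖z‖ < ρ → ‖ev ψ z‖ ≤ 21/10 := fun z hz => psi_bound h0 h1 ha hA hz
  have hd : DifferentiableOn ℂ (ev ψ) (Metric.ball 0 ρ) := ev_differentiableOn hA
  have hμp : 0 < ‖μ‖ := norm_pos_iff.mpr h0
  obtain ⟨B, hB1, hB2, hBd⟩ := ha.inv
  set R := ρ / ‖μ‖ with hR
  have hρR : ρ < R := by rw [hR, lt_div_iff₀ hμp]; nlinarith
  have hmR : ∀ z : ℂ, ‖z‖ < R → ‖μ * z‖ < ρ := by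
    intro z hz; rw [norm_mul]; rw [hR, lt_div_iff₀ hμp] at hz; linarith
  set g : ℂ → ℂ := fun z => μ^2 + 4 * B (ev ψ (μ * z)) with hg
  have hgd : DifferentiableOn ℂ g (Metric.ball 0 R) := by
    apply DifferentiableOn.const_add
    apply DifferentiableOn.const_mul
    apply hBd.comp (t := Metric.ball (0:ℂ) (5/2))
    · apply hd.comp (t := Metric.ball (0:ℂ) ρ) (by fun_prop)
      intro z hz
      have := hmR z (by simpa using hz)
      simpa using this
    · intro z hz
      have := hb _ (hmR z (by simpa using hz))
      simp; linarith
  have hev0 : ev ψ 0 = 0 := by rw [ev_zero, hψ, lin_zero]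
  have hg0 : g 0 = μ^2 := by
    have hB0 := hB2 0 (by simp) (by simp [ha.zero]; norm_num)
    rw [ha.zero, add_zero] at hB0
    simp [hg, hev0, hB0]
  -- existence of the zero
  have hex : ∃ u, ‖u‖ ≤ ρ ∧ g u = 0 := by
    by_contra hcon
    push Not at hcon
    obtain ⟨R1, hR1, hR1R⟩ := exists_between hρR
    obtain ⟨R2, hR2, hR2R, hR2g⟩ : ∃ R2, ρ < R2 ∧ R2 < R ∧ ∀ z, ‖z‖ < R2 → g z ≠ 0 := by
      set K := Metric.closedBall (0:ℂ) R1 ∩ g ⁻¹' {0} with hK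
      have hKc : IsCompact K := by
        apply (isCompact_closedBall (0:ℂ) R1).of_isClosed_subset _ Set.inter_subset_left
        apply (hgd.continuousOn.mono _).preimage_isClosed_of_isClosed Metric.isClosed_closedBall
          isClosed_singleton
        exact Metric.closedBall_subset_ball hR1R
      rcases K.eq_empty_or_nonempty with hE | hE
      · refine ⟨R1, hR1, hR1R, fun z hz hgz => ?_⟩
        have : z ∈ K := ⟨by simpa using hz.le, hgz⟩
        rw [hE] at this; exact this
      · obtain ⟨z1, hz1, hmin⟩ := hKc.exists_isMinOn hE continuous_norm.continuousOn
        have hz1R : ‖z1‖ ≤ R1 := by simpa using hz1.1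
        refine ⟨‖z1‖, ?_, by linarith, fun z hz hgz => ?_⟩
        · by_contra h5
          exact hcon z1 (not_lt.mp h5) hz1.2
        · have := hmin (a := z) ⟨by simpa using hz.le.trans hz1R, hgz⟩
          simp only [Set.mem_ofPred_eq] at this
          linarith
    have hR20 : 0 < R2 := by linarith
    obtain ⟨L, hL, hL0, hexp⟩ := exists_log hR20 (hgd.mono (Metric.ball_subset_ball hR2R.le))
      (fun z hz => hR2g z (by simpa using hz))
    obtain ⟨σ, hσ, hσ0⟩ : ∃ σ : ℂ, σ^2 = 1 ∧ σ * Complex.exp (L 0 / 2) = μ := by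
      have h5 : Complex.exp (L 0/2)^2 = μ^2 := by
        rw [← Complex.exp_nat_mul, ← hg0, ← hexp 0 (Metric.mem_ball_self hR20)]
        congr 1; push_cast; ring
      rcases sq_eq_sq_iff_eq_or_eq_neg.mp h5 with h6 | h6
      · exact ⟨1, by ring, by rw [h6]; ring⟩
      · exact ⟨-1, by ring, by rw [h6]; ring⟩
    set q : ℂ → ℂ := fun z => σ * Complex.exp (L z / 2) with hq'
    have hqd : DifferentiableOn ℂ q (Metric.ball 0 R2) :=
      ((hL.div_const 2).cexp).const_mul σ
    have hq2 : ∀ z, ‖z‖ < R2 → q z^2 = g z := by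
      intro z hz
      simp only [hq']
      rw [mul_pow, hσ, one_mul, ← Complex.exp_nat_mul, ← hexp z (by simpa using hz)]
      congr 1; push_cast; ring
    set F : ℂ → ℂ := fun z => (-μ + q z)/2 with hF
    have hFd : DifferentiableOn ℂ F (Metric.ball 0 R2) := (hqd.const_add _).div_const 2
    have hsq : ∀ z, ‖z‖ < ρ → (2 * ev ψ z + μ)^2 = g z := by
      intro z hz
      have hst := psi_step h0 h1 ha hA hz
      rw [← hψ] at hst
      have hbz := hb z hz
      have hw : ‖μ * ev ψ z + (ev ψ z)^2‖ ≤ 7 := by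
        refine (norm_add_le _ _).trans ?_
        rw [norm_mul, norm_pow]
        nlinarith [norm_nonneg (ev ψ z)]
      have hv : ‖ev ψ (μ * z)‖ ≤ 5/2 := by
        have := hb (μ*z) (hmR z (hz.trans hρR)); linarith
      have := hB2 _ hw (by rw [hst, stp] at hv; exact hv)
      simp only [hg]
      rw [hst, stp, this]; ring
    have hFe : F =ᶠ[nhds 0] ev ψ := by
      have hc1 : ContinuousAt (fun z => q z + (2 * ev ψ z + μ)) 0 := by
        have e1 := hqd.continuousOn.continuousAt (Metric.ball_mem_nhds (0:ℂ) hR20)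
        have e2 := hd.continuousOn.continuousAt (Metric.ball_mem_nhds (0:ℂ) hρ0)
        exact e1.add ((e2.const_mul 2).add_const μ)
      have hne : q 0 + (2 * ev ψ 0 + μ) ≠ 0 := by
        simp only [hq']
        rw [hσ0, hev0]
        intro h; apply h0; linear_combination h/2
      filter_upwards [hc1.eventually_ne hne, Metric.ball_mem_nhds (0:ℂ) hρ0] with z hz1 hz2
      have hz3 : ‖z‖ < ρ := by simpa using hz2
      have e1 := hq2 z (by linarith)
      have e2 := hsq z hz3
      have e3 : (q z - (2 * ev ψ z + μ)) * (q z + (2 * ev ψ z + μ)) = 0 := by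
        linear_combination e1 - e2
      have e4 := (mul_eq_zero.mp e3).resolve_right hz1
      simp only [hF]
      linear_combination e4/2
    obtain ⟨R3, hR3, hR3R⟩ := exists_between hR2
    have hA3 : AS ψ R3 := by
      apply AS_of_holo hFd _ (by linarith) hR3R
      intro k
      rw [tc_congr hFe, (hAr0.ht hr0).tc_eq]
    have : R3 ≤ ρ := le_csSup hbd ⟨by linarith, hA3⟩
    linarith
  obtain ⟨u, hu, hgu⟩ := hex
  refine ⟨u, ρ, ?_, hu, hA, ?_⟩
  · rintro rfl
    rw [hg0] at hgu
    exact h0 (pow_eq_zero_iff (two_ne_zero) |>.mp hgu)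
  · have hBu : B (ev ψ (μ*u)) = -μ^2/4 := by
      simp only [hg] at hgu; linear_combination hgu/4
    have := hB1 (ev ψ (μ*u)) (by
      have := hb _ (hmR u (by linarith)); linarith)
    rw [hBu] at this
    exact this.symm

end
end QL

namespace QL

noncomputable def xs (μ : ℂ) (a : Polynomial ℂ) : ℕ → ℂ
  | 0 => -μ^2/4 + a.eval (-μ^2/4)
  | n+1 => stp μ a (xs μ a n)

lemma schwarz {F : ℂ → ℂ} {R M : ℝ} (hF : DifferentiableOn ℂ F (Metric.ball 0 R)) (h0 : F 0 = 0)
    (hb : ∀ z, ‖z‖ < R → ‖F z‖ ≤ M) {z : ℂ} (hz : ‖z‖ < R) : ‖F z‖ ≤ M / R * ‖z‖ := by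
  have := Complex.dist_le_div_mul_dist_of_mapsTo_ball (f := F) (c := 0) (R₁ := R) (R₂ := M) (z := z) hF
    (by
      intro w hw
      have := hb w (by simpa using hw)
      simpa [h0] using this) (by simpa using hz)
  simpa [h0] using this

lemma orbit {μ : ℂ} {a : Polynomial ℂ} (h0 : μ ≠ 0) (h1 : ‖μ‖ < 1) (ha : Good a) :
    ∃ u : ℂ, ∃ ρ : ℝ, u ≠ 0 ∧ ‖u‖ ≤ ρ ∧ (∀ r, 0 ≤ r → r < ρ → AS (lin μ (hq μ a)) r) ∧
      ev (lin μ (hq μ a)) (μ * u) = -μ^2/4 + a.eval (-μ^2/4) ∧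
      (∀ n, xs μ a n ≠ 0) ∧ (∀ n, ‖xs μ a n / μ^(n+1)‖ ≤ 21/10) ∧
      Tendsto (fun n => xs μ a n / μ^(n+1)) atTop (nhds u) := by
  obtain ⟨u, ρ, hu, huρ, hA, hev⟩ := structure_lemma h0 h1 ha
  have hup : 0 < ‖u‖ := norm_pos_iff.mpr hu
  have hμp : 0 < ‖μ‖ := norm_pos_iff.mpr h0
  have hρ : 0 < ρ := by linarith
  set ψ := lin μ (hq μ a) with hψ
  have hlt : ∀ n : ℕ, ‖μ^(n+1) * u‖ < ρ := by
    intro n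
    rw [norm_mul, norm_pow]
    have : ‖μ‖^(n+1) < 1 := pow_lt_one₀ hμp.le h1 (by omega)
    nlinarith
  have hx : ∀ n, xs μ a n = ev ψ (μ^(n+1) * u) := by
    intro n
    induction n with
    | zero => rw [xs, zero_add, pow_one, hev]
    | succ n ih =>
      rw [xs, ih, pow_succ' μ (n+1), mul_assoc]
      exact (psi_step h0 h1 ha hA (hlt n)).symm
  have hev0 : ev ψ 0 = 0 := by rw [ev_zero, hψ, lin_zero]
  have hb : ∀ z, ‖z‖ < ρ → ‖ev ψ z‖ ≤ 21/10 := fun z hz => psi_bound h0 h1 ha hA hz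
  have hd : DifferentiableOn ℂ (ev ψ) (Metric.ball 0 ρ) := ev_differentiableOn hA
  have hder : HasDerivAt (ev ψ) 1 0 :=
    ev_deriv (half_pos hρ) (hA _ (half_pos hρ).le (half_lt_self hρ)) (lin_one _ _)
  have hT : Tendsto (fun n => xs μ a n / μ^(n+1)) atTop (nhds u) := by
    have := (koenigs hev0 hder h0 h1 u).comp (tendsto_add_atTop_nat 1)
    refine this.congr fun n => ?_
    simp only [Function.comp_apply, hx]
  refine ⟨u, ρ, hu, huρ, hA, hev, ?_, ?_, hT⟩
  · intro n hn
    have hz : ∀ m, xs μ a (n+m) = 0 := by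
      intro m
      induction m with
      | zero => exact hn
      | succ m ih => rw [← add_assoc, xs, ih]; simp [stp, ha.zero]
    have h2 : Tendsto (fun n => xs μ a n / μ^(n+1)) atTop (nhds 0) := by
      refine tendsto_const_nhds.congr' ?_
      filter_upwards [eventually_ge_atTop n] with m hm
      obtain ⟨k, rfl⟩ := Nat.exists_eq_add_of_le hm
      rw [hz, zero_div]
    exact hu (tendsto_nhds_unique hT h2)
  · intro n
    have := schwarz hd hev0 hb (hlt n)
    rw [hx, norm_div, div_le_iff₀ (by rw [norm_pow]; positivity)]
    refine this.trans ?_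
    rw [norm_mul]
    have h3 : ‖u‖ / ρ ≤ 1 := by rw [div_le_one hρ]; exact huρ
    calc 21/10/ρ * (‖μ^(n+1)‖ * ‖u‖) = 21/10 * ‖μ^(n+1)‖ * (‖u‖/ρ) := by ring
      _ ≤ 21/10 * ‖μ^(n+1)‖ * 1 := by gcongr
      _ = _ := by ring

lemma phi_est {φ : ℂ → ℂ} (hφ : AnalyticAt ℂ φ 0) (h0 : φ 0 = 0) (h1 : deriv φ 0 = 1) :
    ∃ δ > 0, ∃ K : ℝ, 0 ≤ K ∧ ∀ w : ℂ, ‖w‖ < δ → ‖φ w - w‖ ≤ K * ‖w‖^2 ∧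
      ∀ t : ℝ, 0 ≤ t → t ≤ 1 → ‖φ (t * w) - t * φ w‖ ≤ (1 - t) * K * ‖w‖^2 := by
  have ds : ∀ {f : ℂ → ℂ}, AnalyticAt ℂ f 0 → AnalyticAt ℂ (dslope f 0) 0 := by
    rintro f ⟨p, hp⟩
    exact ⟨_, HasFPowerSeriesAt.has_fpower_series_dslope_fslope hp⟩
  set d := dslope φ 0 with hd
  set q := dslope d 0 with hq
  have hqa : AnalyticAt ℂ q 0 := ds (ds hφ)
  have hd0 : d 0 = 1 := by rw [hd, dslope_same, h1]
  have e1 : ∀ w, φ w = w + w^2 * q w := by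
    intro w
    have a1 := sub_smul_dslope φ 0 w
    have a2 := sub_smul_dslope d 0 w
    rw [← hd, h0] at a1
    rw [← hq, hd0] at a2
    simp only [sub_zero, smul_eq_mul] at a1 a2
    linear_combination -a1 - w * a2
  obtain ⟨L, s, hs, hL⟩ := (hqa.contDiffAt (n := 1)).exists_lipschitzOnWith
  obtain ⟨δ, hδ, hδs⟩ := Metric.mem_nhds_iff.mp hs
  refine ⟨min δ 1, lt_min hδ one_pos, ‖q 0‖ + 2*L, by positivity, fun w hw => ?_⟩
  have hw1 : ‖w‖ < δ := hw.trans_le (min_le_left _ _)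
  have hw2 : ‖w‖ < 1 := hw.trans_le (min_le_right _ _)
  have hin : ∀ t : ℝ, 0 ≤ t → t ≤ 1 → (t:ℂ) * w ∈ s := by
    intro t ht ht1
    apply hδs
    simp only [Metric.mem_ball, dist_zero_right, norm_mul, Complex.norm_real, Real.norm_eq_abs,
      abs_of_nonneg ht]
    nlinarith [norm_nonneg w]
  have hLip : ∀ t t' : ℝ, 0 ≤ t → t ≤ 1 → 0 ≤ t' → t' ≤ 1 →
      ‖q (t * w) - q (t' * w)‖ ≤ L * (|t - t'|) := by
    intro t t' a1 a2 a3 a4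
    have := hL.dist_le_mul _ (hin t a1 a2) _ (hin t' a3 a4)
    rw [dist_eq_norm, dist_eq_norm, ← sub_mul, norm_mul, ← Complex.ofReal_sub, Complex.norm_real,
      Real.norm_eq_abs] at this
    refine this.trans ?_
    have h3 : |t - t'| * ‖w‖ ≤ |t - t'| := mul_le_of_le_one_right (abs_nonneg _) hw2.le
    gcongr
  have hqb : ∀ t : ℝ, 0 ≤ t → t ≤ 1 → ‖q (t * w)‖ ≤ ‖q 0‖ + L := by
    intro t a1 a2
    have := hLip t 0 a1 a2 le_rfl zero_le_one
    rw [Complex.ofReal_zero, zero_mul, sub_zero, abs_of_nonneg a1] at this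
    have h3 := norm_sub_norm_le (q (t*w)) (q 0)
    have h4 : (L:ℝ) * t ≤ L := mul_le_of_le_one_right L.2 a2
    linarith
  constructor
  · rw [e1 w, add_sub_cancel_left, norm_mul, norm_pow, mul_comm]
    have := hqb 1 zero_le_one le_rfl
    rw [Complex.ofReal_one, one_mul] at this
    have hL0 : (0:ℝ) ≤ L := L.2
    gcongr
    linarith
  · intro t a1 a2
    have e2 : φ (t*w) - t * φ w = t * w^2 * (((t - 1 : ℝ):ℂ) * q (t*w) + (q (t*w) - q w)) := by
      rw [e1 (t*w), e1 w]; push_cast; ring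
    rw [e2, norm_mul, norm_mul, norm_pow, Complex.norm_real, Real.norm_eq_abs, abs_of_nonneg a1]
    have h3 := hLip t 1 a1 a2 zero_le_one le_rfl
    rw [Complex.ofReal_one, one_mul] at h3
    have h5 : |t - 1| = 1 - t := by rw [abs_of_nonpos (by linarith)]; ring
    have h4 : ‖((t - 1 : ℝ):ℂ) * q (t*w) + (q (t*w) - q w)‖ ≤ (1-t) * (‖q 0‖ + 2*L) := by
      refine (norm_add_le _ _).trans ?_
      rw [norm_mul, Complex.norm_real, Real.norm_eq_abs, h5]
      rw [h5] at h3
      have := mul_le_mul_of_nonneg_left (hqb t a1 a2) (show 0 ≤ 1 - t by linarith)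
      linarith
    calc t * ‖w‖^2 * ‖((t - 1 : ℝ):ℂ) * q (t*w) + (q (t*w) - q w)‖
        ≤ 1 * ‖w‖^2 * ((1-t) * (‖q 0‖ + 2*L)) := by gcongr
      _ = _ := by ring

lemma Good_zero : Good 0 := ⟨dvd_zero _, fun w w' _ _ => by simp⟩

lemma lemD {l : ℂ} (hl : ‖l‖ = 1) {φ : ℂ → ℂ} (hφ : AnalyticAt ℂ φ 0) (h0 : φ 0 = 0)
    (h1 : deriv φ 0 = 1) (hc : ∀ᶠ y in nhds (0:ℂ), φ (l*y+y^2) = l * φ y) :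
    ∃ c > 0, ∀ t : ℝ, 1/2 < t → t < 1 → ∀ u : ℂ, ∀ ρ : ℝ, u ≠ 0 → ‖u‖ ≤ ρ →
      (∀ r, 0 ≤ r → r < ρ → AS (lin (t*l) (hq (t*l) 0)) r) →
      ev (lin (t*l) (hq (t*l) 0)) ((t*l)*u) = -(t*l)^2/4 → c ≤ ‖u‖ := by
  obtain ⟨δ, hδ, K, hK, hest⟩ := phi_est hφ h0 h1
  obtain ⟨δ', hδ', hcδ⟩ := Metric.eventually_nhds_iff.mp hc
  obtain ⟨R0, hR0, hR8, hRδ, hRδ', hRK⟩ : ∃ R0 : ℝ, 0 < R0 ∧ R0 ≤ 1/8 ∧ 2*R0 < δ ∧ R0 < δ' ∧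
      9*K*R0 ≤ 1/2 := by
    refine ⟨min (min (1/8) (δ/3)) (min (δ'/2) (1/(18*(K+1)))), by positivity, ?_, ?_, ?_, ?_⟩
    · exact (min_le_left _ _).trans (min_le_left _ _)
    · have : min (min (1/8) (δ/3)) (min (δ'/2) (1/(18*(K+1)))) ≤ δ/3 :=
        (min_le_left _ _).trans (min_le_right _ _)
      linarith
    · have : min (min (1/8) (δ/3)) (min (δ'/2) (1/(18*(K+1)))) ≤ δ'/2 :=
        (min_le_right _ _).trans (min_le_left _ _)
      linarith
    · have : min (min (1/8) (δ/3)) (min (δ'/2) (1/(18*(K+1)))) ≤ 1/(18*(K+1)) :=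
        (min_le_right _ _).trans (min_le_right _ _)
      calc 9*K*(min (min (1/8) (δ/3)) (min (δ'/2) (1/(18*(K+1))))) ≤ 9*K*(1/(18*(K+1))) := by gcongr
        _ ≤ 1/2 := by
          rw [mul_one_div, div_le_div_iff₀ (by positivity) (by norm_num)]; linarith
  refine ⟨R0/4, by positivity, ?_⟩
  intro t ht ht1 u ρ hu huρ hA hev
  have ht0 : (0:ℝ) < t := by linarith
  have htc : (t:ℂ) ≠ 0 := by exact_mod_cast ht0.ne'
  have hl0 : l ≠ 0 := by rintro rfl; simp at hl
  set μ : ℂ := t * l with hμ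
  have hμn : ‖μ‖ = t := by rw [hμ, norm_mul, hl, Complex.norm_real, Real.norm_eq_abs, abs_of_pos ht0, mul_one]
  have hμ0 : μ ≠ 0 := mul_ne_zero htc hl0
  have hμ1 : ‖μ‖ < 1 := by rw [hμn]; exact ht1
  have hup : 0 < ‖u‖ := norm_pos_iff.mpr hu
  have hρ : 0 < ρ := by linarith
  set ψ := lin μ (hq μ 0) with hψ
  have hev0 : ev ψ 0 = 0 := by rw [ev_zero, hψ, lin_zero]
  have hd : DifferentiableOn ℂ (ev ψ) (Metric.ball 0 ρ) := ev_differentiableOn hA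
  have hder : HasDerivAt (ev ψ) 1 0 :=
    ev_deriv (half_pos hρ) (hA _ (half_pos hρ).le (half_lt_self hρ)) (lin_one _ _)
  set F : ℂ → ℂ := fun z => ev ψ z / t with hF
  have hF0 : F 0 = 0 := by simp [hF, hev0]
  have hFd : DifferentiableOn ℂ F (Metric.ball 0 ρ) := hd.div_const _
  have hμu : ‖μ * u‖ < ρ := by rw [norm_mul, hμn]; nlinarith
  have hFu : R0 ≤ ‖F (μ * u)‖ := by
    simp only [hF]
    rw [hev, norm_div, norm_div, norm_neg, norm_pow, hμn, Complex.norm_real, Real.norm_eq_abs,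
      abs_of_pos ht0, le_div_iff₀ ht0]
    norm_num
    nlinarith
  obtain ⟨z1, hz1p, hz1z, hz1c, hlt⟩ := first_exit (F := F) (R := ‖μ*u‖) (c := R0)
    (hFd.continuousOn.mono (by
      intro w hw
      have : ‖w‖ ≤ ‖μ*u‖ := by simpa using hw
      simpa using this.trans_lt hμu)) (by rw [hF0]; simpa using hR0) le_rfl hFu
  have hz1ρ : ‖z1‖ < ρ := hz1z.trans_lt hμu
  have hpow : ∀ j : ℕ, ‖μ^j * z1‖ ≤ ‖z1‖ := by
    intro j
    rw [norm_mul, norm_pow, hμn]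
    exact mul_le_of_le_one_left hz1p.le (pow_le_one₀ ht0.le ht1.le)
  have hFj : ∀ j : ℕ, ‖F (μ^j * z1)‖ ≤ R0 * t^j := by
    intro j
    rcases Nat.eq_zero_or_pos j with rfl | hj
    · simp [hz1c]
    · have hlt' : ‖μ^j * z1‖ < ‖z1‖ := by
        rw [norm_mul, norm_pow, hμn]
        exact mul_lt_of_lt_one_left hz1p (pow_lt_one₀ ht0.le ht1 hj.ne')
      have := schwarz (hFd.mono (Metric.ball_subset_ball hz1ρ.le)) hF0
        (fun w hw => (hlt w hw).le) hlt'
      refine this.trans_eq ?_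
      rw [norm_mul, norm_pow, hμn]
      field_simp
  set G : ℕ → ℂ := fun j => φ (F (μ^j * z1)) / μ^j with hG
  have hstep : ∀ j, ‖G (j+1) - G j‖ ≤ 8*K*R0^2*(1-t)*t^j := by
    intro j
    set y := F (μ^j * z1) with hy
    have hyj := hFj j
    rw [← hy] at hyj
    have hyR : ‖y‖ ≤ R0 := hyj.trans (mul_le_of_le_one_right hR0.le (pow_le_one₀ ht0.le ht1.le))
    have e1 : F (μ^(j+1) * z1) = t * (l*y+y^2) := by
      have := psi_step hμ0 hμ1 Good_zero hA ((hpow j).trans_lt hz1ρ)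
      simp only [hF]
      rw [pow_succ' μ j, mul_assoc]
      rw [← hψ] at this
      rw [this, hy]
      simp only [stp, hF, Polynomial.eval_zero, add_zero]
      rw [hμ]
      field_simp
    have hwn : ‖l*y+y^2‖ ≤ 2*‖y‖ := by
      refine (norm_add_le _ _).trans ?_
      rw [norm_mul, hl, norm_pow]
      nlinarith [norm_nonneg y]
    have e2 := (hest (l*y+y^2) (by linarith)).2 t ht0.le ht1.le
    rw [hcδ (y := y) (by simp; linarith), ← e1] at e2
    have e3 : G (j+1) - G j = (φ (F (μ^(j+1)*z1)) - t * (l * φ y)) / μ^(j+1) := by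
      simp only [hG]
      rw [← hy, pow_succ μ j]
      have := pow_ne_zero j hμ0
      field_simp
      rw [hμ]; ring
    rw [e3, norm_div, norm_pow, hμn, div_le_iff₀ (by positivity)]
    refine e2.trans ?_
    have h5 : ‖l*y+y^2‖^2 ≤ (2*(R0*t^j))^2 := by
      gcongr; linarith
    calc (1-t)*K*‖l*y+y^2‖^2 ≤ (1-t)*K*(2*(R0*t^j))^2 := by
          apply mul_le_mul_of_nonneg_left h5; apply mul_nonneg _ hK; linarith
      _ = (4*K*R0^2*(1-t)*t^j*t^j) * 1 := by ring
      _ ≤ (4*K*R0^2*(1-t)*t^j*t^j) * (2*t) := by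
          apply mul_le_mul_of_nonneg_left (by linarith)
          have : 0 ≤ 1 - t := by linarith
          positivity
      _ = _ := by ring
  have hsum : ∀ n, ‖G n - G 0‖ ≤ 8*K*R0^2*(1-t^n) := by
    intro n
    induction n with
    | zero => simp
    | succ n ih =>
      have h2 := norm_add_le (G (n+1) - G n) (G n - G 0)
      rw [sub_add_sub_cancel] at h2
      have h3 := hstep n
      calc _ ≤ _ := h2
        _ ≤ 8*K*R0^2*(1-t)*t^n + 8*K*R0^2*(1-t^n) := add_le_add h3 ih
        _ = _ := by ring
  have hGlim : Tendsto G atTop (nhds (z1/t)) := by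
    have hd1 : HasDerivAt (fun z => (t:ℂ) * φ (F z)) 1 0 := by
      have a1 : HasDerivAt F (1/t) 0 := hder.div_const _
      have a2 : HasDerivAt φ 1 (F 0) := by
        rw [hF0, ← h1]; exact hφ.differentiableAt.hasDerivAt
      refine ((a2.comp 0 a1).const_mul (t:ℂ)).congr_deriv ?_
      field_simp
    have := (koenigs (F := fun z => (t:ℂ) * φ (F z)) (by simp [hF0, h0]) hd1 hμ0 hμ1 z1).div_const (t:ℂ)
    refine this.congr fun n => ?_
    simp only [hG]
    field_simp
  have hfin : ‖z1/t - G 0‖ ≤ 8*K*R0^2 := by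
    refine le_of_tendsto (hGlim.sub_const (G 0)).norm (Eventually.of_forall fun n => ?_)
    refine (hsum n).trans ?_
    have : 0 ≤ t^n := by positivity
    apply mul_le_of_le_one_right (by positivity); linarith
  have hG0 : R0 - K*R0^2 ≤ ‖G 0‖ := by
    have e1 : G 0 = φ (F z1) := by simp [hG]
    have e2 := (hest (F z1) (by rw [hz1c]; linarith)).1
    rw [hz1c] at e2
    have e3 := norm_sub_norm_le (F z1) (F z1 - φ (F z1))
    rw [sub_sub_cancel, norm_sub_rev (F z1) (φ _), hz1c] at e3
    rw [e1]; linarith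
  have h6 := norm_sub_norm_le (G 0) (G 0 - z1/t)
  rw [sub_sub_cancel, norm_sub_rev (G 0), norm_div z1, Complex.norm_real, Real.norm_eq_abs, abs_of_pos ht0] at h6
  have h7 : R0/2 ≤ ‖z1‖/t := by nlinarith
  rw [le_div_iff₀ ht0] at h7
  have h8 : ‖z1‖ ≤ ‖u‖ := by
    refine hz1z.trans ?_
    rw [norm_mul, hμn]; nlinarith
  nlinarith

end QL

namespace QL

lemma Good.smul {a : Polynomial ℂ} (ha : Good a) {s : ℂ} (hs : ‖s‖ ≤ 1) : Good (Polynomial.C s * a) := by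
  refine ⟨ha.1.mul_left _, fun w w' hw hw' => ?_⟩
  rw [Polynomial.eval_mul, Polynomial.eval_mul, Polynomial.eval_C, Polynomial.eval_C, ← mul_sub, norm_mul]
  exact (mul_le_of_le_one_left (norm_nonneg _) hs).trans (ha.2 w w' hw hw')

lemma xs_diff (μ : ℂ) (a : Polynomial ℂ) (n : ℕ) :
    Differentiable ℂ (fun s => xs μ (Polynomial.C s * a) n) := by
  induction n with
  | zero =>
    simp only [xs, Polynomial.eval_mul, Polynomial.eval_C]
    fun_prop
  | succ n ih =>
    simp only [xs, stp, Polynomial.eval_mul, Polynomial.eval_C]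
    have h1 : Differentiable ℂ (fun s => μ * xs μ (Polynomial.C s * a) n
        + (xs μ (Polynomial.C s * a) n)^2) := (ih.const_mul μ).add (ih.pow 2)
    exact h1.add (differentiable_id.mul (a.differentiable.comp h1))

lemma CP_hq (b : Polynomial ℂ) : CP (fun μ => hq μ b) :=
  CP.add (CP.const _) (CP.comp (CP.add (CP.mul CP.C (CP.const _)) (CP.const _)) b)

lemma combine {l : ℂ} (hl : ‖l‖ = 1) (hNR : NR l) {φ : ℂ → ℂ} (hφ : AnalyticAt ℂ φ 0) (h0 : φ 0 = 0)
    (h1 : deriv φ 0 = 1) (hc : ∀ᶠ y in nhds (0:ℂ), φ (l*y+y^2) = l * φ y) :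
    ∃ C : ℝ, 1 ≤ C ∧ ∀ a : Polynomial ℂ, Good a → ∀ k,
      ‖PowerSeries.coeff k (lin l (hq l (Polynomial.C (1/2) * a)))‖ ≤ C^k := by
  obtain ⟨c, hc0, hD⟩ := lemD hl hφ h0 h1 hc
  obtain ⟨c', hc', hH⟩ := harnack (half_pos hc0)
  have hl0 : l ≠ 0 := by rintro rfl; simp at hl
  refine ⟨max 1 (21/10/c'), le_max_left _ _, fun a ha k => ?_⟩
  set b := Polynomial.C (1/2) * a with hb
  have key : ∀ t : ℝ, 1/2 < t → t < 1 →
      ‖PowerSeries.coeff k (lin (t*l) (hq (t*l) b))‖ ≤ (max 1 (21/10/c'))^k := by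
    intro t ht ht1
    have ht0 : (0:ℝ) < t := by linarith
    have htc : (t:ℂ) ≠ 0 := by exact_mod_cast ht0.ne'
    set μ : ℂ := t * l with hμ
    have hμn : ‖μ‖ = t := by
      rw [hμ, norm_mul, hl, Complex.norm_real, Real.norm_eq_abs, abs_of_pos ht0, mul_one]
    have hμ0 : μ ≠ 0 := mul_ne_zero htc hl0
    have hμ1 : ‖μ‖ < 1 := by rw [hμn]; exact ht1
    obtain ⟨u0, ρ0, a1, a2, a3, a4, a5, a6, a7⟩ := orbit hμ0 hμ1 Good_zero
    have hcu : c ≤ ‖u0‖ := hD t ht ht1 u0 ρ0 a1 a2 a3 (by rw [a4]; simp [hμ])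
    have hbG : Good b := ha.smul (by norm_num)
    obtain ⟨u, ρ, b1, b2, b3, b4, b5, b6, b7⟩ := orbit hμ0 hμ1 hbG
    have hcu' : c' ≤ ‖u‖ := by
      refine ge_of_tendsto b7.norm ?_
      have : ∀ᶠ n in atTop, c/2 < ‖xs μ 0 n / μ^(n+1)‖ :=
        a7.norm.eventually_const_lt (by linarith)
      filter_upwards [this] with n hn
      refine hH (fun s => xs μ (Polynomial.C s * a) n / μ^(n+1))
        ((xs_diff μ a n).div_const _).differentiableOn ?_ ?_ ?_
      · intro s hs
        have hs1 : ‖s‖ < 1 := by simpa using hs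
        obtain ⟨_, _, _, _, _, _, d5, d6, _⟩ := orbit hμ0 hμ1 (ha.smul hs1.le)
        exact div_ne_zero (d5 n) (pow_ne_zero _ hμ0)
      · intro s hs
        have hs1 : ‖s‖ < 1 := by simpa using hs
        obtain ⟨_, _, _, _, _, _, d5, d6, _⟩ := orbit hμ0 hμ1 (ha.smul hs1.le)
        exact d6 n
      · simp only [map_zero, zero_mul]
        exact hn.le
    have hρ : c' ≤ ρ := hcu'.trans b2
    have hρ0 : 0 < ρ := hc'.trans_le hρ
    rcases Nat.eq_zero_or_pos k with rfl | hk
    · rw [lin_zero]; simp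
    have hht := b3 (ρ/2) (by linarith) (by linarith)
    have := tc_norm_le' hρ0 (ev_differentiableOn b3) (C := 21/10) (fun z hz =>
      psi_bound hμ0 hμ1 hbG b3 (by simpa using hz)) k
    rw [(hht.ht (half_pos hρ0)).tc_eq] at this
    refine this.trans ?_
    calc 21/10/ρ^k ≤ (21/10)^k/c'^k := by
          gcongr
          exact le_self_pow₀ (by norm_num) hk.ne'
      _ = (21/10/c')^k := by rw [div_pow (21/10:ℝ) c']
      _ ≤ _ := by gcongr; exact le_max_right _ _
  have hcont : ContinuousAt (fun t : ℝ => PowerSeries.coeff k (lin (t*l) (hq (t*l) b))) 1 := by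
    refine CF.lin (A := contAlg 1) (fun t : ℝ => (t:ℂ)*l) ?_ (fun t : ℝ => hq (t*l) b) ?_ k
    · intro m
      show ContinuousAt (fun t : ℝ => (((t:ℂ)*l)^(m+2) - (t:ℂ)*l)⁻¹) 1
      apply ContinuousAt.inv₀
      · apply Continuous.continuousAt; fun_prop
      · simpa using hNR m
    · intro j
      show ContinuousAt (fun t : ℝ => (hq (t*l) b).coeff j) 1
      have := (CP_hq b j).continuous.comp (f := fun t : ℝ => (t:ℂ)*l) (by fun_prop)
      exact this.continuousAt
  have hT : Tendsto (fun t : ℝ => PowerSeries.coeff k (lin (t*l) (hq (t*l) b))) (nhdsWithin 1 (Set.Iio 1))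
      (nhds (PowerSeries.coeff k (lin l (hq l b)))) := by
    have := hcont.tendsto.mono_left (nhdsWithin_le_nhds (s := Set.Iio 1))
    simpa using this
  refine le_of_tendsto hT.norm ?_
  filter_upwards [Ioo_mem_nhdsLT (show (1/2:ℝ) < 1 by norm_num)] with t ht
  exact key t ht.1 ht.2

noncomputable def hb (l : ℂ) (b : Polynomial ℂ) (β : ℂ) : Polynomial ℂ :=
  Polynomial.C β * Polynomial.X^2 + b.comp (Polynomial.C l * Polynomial.X + Polynomial.C β * Polynomial.X^2)

lemma X2_hb (l : ℂ) {b : Polynomial ℂ} (h : Polynomial.X^2 ∣ b) (β : ℂ) : Polynomial.X^2 ∣ hb l b β :=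
  dvd_add (Dvd.intro_left _ rfl) (X2_comp' h
    ⟨Polynomial.C l + Polynomial.C β * Polynomial.X, by ring⟩)

lemma remove {l : ℂ} (hNR : NR l) {C : ℝ}
    (H : ∀ a : Polynomial ℂ, Good a → ∀ k,
      ‖PowerSeries.coeff k (lin l (hq l (Polynomial.C (1/2) * a)))‖ ≤ C^k)
    {a : Polynomial ℂ} (ha : Good a) (k : ℕ) :
    ‖PowerSeries.coeff k (lin l ((Polynomial.C (1/2) * a).comp (Polynomial.C l * Polynomial.X)))‖ ≤ C^k := by
  set b := Polynomial.C (1/2) * a with hbdef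
  have hX : Polynomial.X^2 ∣ b := ha.1.mul_left _
  have hcirc : ∀ β : ℂ, ‖β‖ = 1 → ‖PowerSeries.coeff k (lin l (hb l b β))‖ ≤ C^k := by
    intro β hβ
    have hβ0 : β ≠ 0 := by rintro rfl; simp at hβ
    set a' := Polynomial.C β * a.comp (Polynomial.C β⁻¹ * Polynomial.X) with ha'
    have hG : Good a' := by
      refine ⟨(X2_comp' ha.1 (Dvd.intro_left _ rfl)).mul_left _, fun w w' hw hw' => ?_⟩
      have hn : ∀ x : ℂ, ‖β⁻¹ * x‖ = ‖x‖ := by intro x; rw [norm_mul, norm_inv, hβ]; simp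
      have := ha.2 (β⁻¹ * w) (β⁻¹ * w') (by rw [hn]; exact hw) (by rw [hn]; exact hw')
      rw [← mul_sub, hn] at this
      simp only [ha', Polynomial.eval_mul, Polynomial.eval_C, Polynomial.eval_comp, Polynomial.eval_X]
      rw [← mul_sub, norm_mul, hβ, one_mul]
      exact this
    have h2 := H a' hG k
    have hpoly : Polynomial.C β * hb l b β =
        (hq l (Polynomial.C (1/2) * a')).comp (Polynomial.C β * Polynomial.X) := by
      have e0 : Polynomial.C β⁻¹ * Polynomial.C β = 1 := by
        rw [← Polynomial.C_mul, inv_mul_cancel₀ hβ0, Polynomial.C_1]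
      simp only [hb, hq, qq, ha', hbdef, Polynomial.add_comp, Polynomial.mul_comp, Polynomial.comp_assoc,
        Polynomial.C_comp, Polynomial.X_comp, Polynomial.X_pow_comp]
      have e1 : Polynomial.C β⁻¹ * (Polynomial.C l * (Polynomial.C β * Polynomial.X) +
          (Polynomial.C β * Polynomial.X)^2) =
          Polynomial.C l * Polynomial.X + Polynomial.C β * Polynomial.X^2 := by
        linear_combination (Polynomial.C l * Polynomial.X + Polynomial.C β * Polynomial.X^2) * e0
      rw [e1]; ring
    have h3 := lin_scale l hNR (X2_hq (μ := l) (hG.1.mul_left (Polynomial.C (1/2)))) (X2_hb l hX β) hβ0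
      (fun j => by
        have := congrArg (fun p => Polynomial.coeff p j) hpoly
        simp only [Polynomial.coeff_C_mul, Polynomial.comp_C_mul_X_coeff] at this
        rw [this, mul_comm]) k
    have h4 := congrArg norm h3
    rw [norm_mul, norm_mul, norm_pow, hβ, one_pow, one_mul, one_mul] at h4
    rw [h4]; exact h2
  have hdiff : Differentiable ℂ (fun β => PowerSeries.coeff k (lin l (hb l b β))) := by
    refine CF.lin (A := diffAlg) (fun _ => l) ?_ (fun β => hb l b β) ?_ k
    · intro m; exact differentiable_const _
    · exact CP.add (CP.mul CP.C (CP.const _)) (CP.comp (CP.add (CP.const _) (CP.mul CP.C (CP.const _))) b)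
  have := Complex.norm_le_of_forall_mem_frontier_norm_le (f := fun β => PowerSeries.coeff k (lin l (hb l b β)))
    (U := Metric.ball (0:ℂ) 1) Metric.isBounded_ball hdiff.diffContOnCl (C := C^k) (by
      intro β hβ
      rw [frontier_ball (0:ℂ) one_ne_zero] at hβ
      exact hcirc β (by simpa using hβ)) (z := 0) (subset_closure (Metric.mem_ball_self one_pos))
  simpa [hb] using this

lemma norm_pow_sub {x y : ℂ} (hx : ‖x‖ ≤ 1) (hy : ‖y‖ ≤ 1) (k : ℕ) : ‖x^k - y^k‖ ≤ k * ‖x - y‖ := by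
  induction k with
  | zero => simp
  | succ k ih =>
    have e : x^(k+1) - y^(k+1) = x * (x^k - y^k) + (x-y) * y^k := by ring
    rw [e]
    refine (norm_add_le _ _).trans ?_
    rw [norm_mul, norm_mul, norm_pow]
    have h1 : ‖x‖ * ‖x^k-y^k‖ ≤ ‖x^k-y^k‖ := mul_le_of_le_one_left (norm_nonneg _) hx
    have h2 : ‖x-y‖ * ‖y‖^k ≤ ‖x-y‖ :=
      mul_le_of_le_one_right (norm_nonneg _) (pow_le_one₀ (norm_nonneg _) hy)
    push_cast
    linarith

lemma nu_lip (h : Polynomial ℂ) {x y : ℂ} (hx : ‖x‖ ≤ 1) (hy : ‖y‖ ≤ 1) :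
    ‖h.eval x - h.eval y‖ ≤ nu h * ‖x - y‖ := by
  rw [Polynomial.eval_eq_sum_range, Polynomial.eval_eq_sum_range, ← Finset.sum_sub_distrib, nu, Finset.sum_mul]
  refine (norm_sum_le _ _).trans (Finset.sum_le_sum fun k _ => ?_)
  rw [← mul_sub, norm_mul]
  calc ‖h.coeff k‖ * ‖x^k-y^k‖ ≤ ‖h.coeff k‖ * (k * ‖x-y‖) := by
        gcongr; exact norm_pow_sub hx hy k
    _ = _ := by ring

lemma final_class {l : ℂ} (hl : ‖l‖ = 1) (hNR : NR l) {C : ℝ} (hC : 1 ≤ C)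
    (H : ∀ a : Polynomial ℂ, Good a → ∀ k,
      ‖PowerSeries.coeff k (lin l (hq l (Polynomial.C (1/2) * a)))‖ ≤ C^k)
    (h : Polynomial ℂ) (hX : Polynomial.X^2 ∣ h) (hn : nu h ≤ 1/100) (k : ℕ) :
    ‖PowerSeries.coeff k (lin l h)‖ ≤ (7*C)^k := by
  have hl0 : l ≠ 0 := by rintro rfl; simp at hl
  set a := Polynomial.C 14 * h.comp (Polynomial.C (7*l)⁻¹ * Polynomial.X) with ha
  have hG : Good a := by
    refine ⟨(X2_comp' hX (Dvd.intro_left _ rfl)).mul_left _, fun w w' hw hw' => ?_⟩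
    have hnn : ∀ x : ℂ, ‖(7*l)⁻¹ * x‖ = 1/7*‖x‖ := by
      intro x; rw [norm_mul, norm_inv, norm_mul, hl]; norm_num
    have := nu_lip h (x := (7*l)⁻¹ * w) (y := (7*l)⁻¹ * w') (by rw [hnn]; linarith) (by rw [hnn]; linarith)
    rw [← mul_sub, hnn] at this
    simp only [ha, Polynomial.eval_mul, Polynomial.eval_C, Polynomial.eval_comp, Polynomial.eval_X]
    rw [← mul_sub, norm_mul]
    have h14 : ‖(14:ℂ)‖ = 14 := by norm_num
    rw [h14]
    have h5 : nu h * (1/7*‖w-w'‖) ≤ 1/100 * (1/7*‖w-w'‖) := by gcongr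
    linarith
  have h2 := remove hNR H hG k
  set g := (Polynomial.C (1/2) * a).comp (Polynomial.C l * Polynomial.X) with hg
  have hgX : Polynomial.X^2 ∣ g := X2_comp' (hG.1.mul_left _) (Dvd.intro_left _ rfl)
  have hgk : ∀ j, (1/7:ℂ) * g.coeff j = (1/7:ℂ)^j * h.coeff j := by
    intro j
    simp only [hg, ha, Polynomial.comp_C_mul_X_coeff, Polynomial.coeff_C_mul]
    have : (7*l)⁻¹^j * l^j = (1/7:ℂ)^j := by
      rw [← mul_pow]; congr 1; field_simp
    linear_combination h.coeff j * this
  have h3 := congrArg norm (lin_scale l hNR hX hgX (σ := 1/7) (by norm_num) hgk k)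
  rw [norm_mul, norm_mul, norm_pow] at h3
  have h7 : ‖(1/7:ℂ)‖ = 1/7 := by norm_num
  rw [h7] at h3
  have h4 : ‖PowerSeries.coeff k (lin l h)‖ = 7^k * (1/7 * ‖PowerSeries.coeff k (lin l g)‖) := by
    rw [h3, ← mul_assoc, ← mul_pow]; norm_num
  rw [h4, mul_pow]
  gcongr
  have := norm_nonneg (PowerSeries.coeff k (lin l g))
  linarith

lemma lin_to_H {l : ℂ} (hNR : NR l) {r : ℝ} (hr : 0 < r) {ψ : ℂ → ℂ}
    (hd : DifferentiableOn ℂ ψ (Metric.ball 0 r)) (hinj : Set.InjOn ψ (Metric.ball 0 r)) (h0 : ψ 0 = 0)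
    (hc : ∀ z ∈ Metric.ball (0:ℂ) r, l * ψ z + ψ z^2 = ψ (l * z)) :
    ∃ φ : ℂ → ℂ, AnalyticAt ℂ φ 0 ∧ φ 0 = 0 ∧ deriv φ 0 = 1 ∧
      ∀ᶠ y in nhds (0:ℂ), φ (l*y+y^2) = l * φ y := by
  have hball : Metric.ball (0:ℂ) r ∈ nhds (0:ℂ) := Metric.ball_mem_nhds _ hr
  have han : AnalyticAt ℂ ψ 0 := hd.analyticAt hball
  have hlt : Tendsto (fun z : ℂ => l * z) (nhds 0) (nhds 0) := by
    have : Continuous (fun z : ℂ => l * z) := by fun_prop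
    simpa using this.tendsto 0
  have hder : deriv ψ 0 ≠ 0 := by
    have hnz : ¬ ∀ᶠ z in nhds (0:ℂ), ψ z = 0 := by
      intro h
      obtain ⟨z, ⟨hz1, hz2⟩, hz3⟩ :=
        (((h.and hball).filter_mono nhdsWithin_le_nhds).and
          (self_mem_nhdsWithin (s := {(0:ℂ)}ᶜ))).exists
      exact hz3 (hinj hz2 (Metric.mem_ball_self hr) (hz1.trans h0.symm))
    obtain ⟨m, g, hg, hg0, hge⟩ := han.exists_eventuallyEq_pow_smul_nonzero_iff.mpr hnz
    simp only [sub_zero, smul_eq_mul] at hge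
    have hm0 : m ≠ 0 := by
      rintro rfl
      have := hge.self_of_nhds
      rw [h0, pow_zero, one_mul] at this
      exact hg0 this.symm
    have hlm : l^m = l := by
      have e : ∀ᶠ z in nhdsWithin (0:ℂ) {0}ᶜ, l^m * g (l*z) = g z * (l + ψ z) := by
        filter_upwards [hge.filter_mono nhdsWithin_le_nhds,
          (hlt.eventually hge).filter_mono nhdsWithin_le_nhds,
          (show ∀ᶠ z in nhds (0:ℂ), z ∈ Metric.ball (0:ℂ) r from hball).filter_mono nhdsWithin_le_nhds,
          self_mem_nhdsWithin] with z a1 a2 a3 a4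
        have a5 := hc z a3
        have hz : z^m ≠ 0 := pow_ne_zero _ a4
        apply mul_left_cancel₀ hz
        rw [a2] at a5
        rw [mul_pow] at a5
        linear_combination -a5 + (l + ψ z) * a1
      have t1 : Tendsto (fun z => l^m * g (l*z)) (nhdsWithin (0:ℂ) {0}ᶜ) (nhds (l^m * g 0)) :=
        ((hg.continuousAt.tendsto.comp hlt).const_mul _).mono_left nhdsWithin_le_nhds
      have t2 : Tendsto (fun z => g z * (l + ψ z)) (nhdsWithin (0:ℂ) {0}ᶜ) (nhds (g 0 * (l + ψ 0))) :=
        (hg.continuousAt.tendsto.mul (han.continuousAt.tendsto.const_add _)).mono_left nhdsWithin_le_nhds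
      have := tendsto_nhds_unique_of_eventuallyEq t1 t2 e
      rw [h0, add_zero, mul_comm] at this
      exact mul_left_cancel₀ hg0 this
    have hm1 : m = 1 := by
      by_contra hm
      obtain ⟨j, rfl⟩ := Nat.exists_eq_add_of_le (show 2 ≤ m by omega)
      apply hNR j
      rw [add_comm, hlm, sub_self]
    rw [hm1] at hge
    have := (EventuallyEq.deriv_eq (f := fun z => z^1 * g z) (by exact hge) : deriv ψ 0 = _)
    rw [this]
    have h5 : HasDerivAt (fun z => z^1 * g z) (1 * g 0 + 0 * deriv g 0) 0 := by
      simp only [pow_one]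
      exact (hasDerivAt_id (0:ℂ)).mul hg.differentiableAt.hasDerivAt
    rw [h5.deriv]; simpa using hg0
  set φ := han.hasStrictDerivAt.localInverse _ _ _ hder with hφ
  have hφa : AnalyticAt ℂ φ (ψ 0) := han.analyticAt_localInverse hder
  have hφd : HasStrictDerivAt φ (deriv ψ 0)⁻¹ (ψ 0) := HasStrictDerivAt.to_localInverse ..
  have hL : ∀ᶠ z in nhds (0:ℂ), φ (ψ z) = z := HasStrictDerivAt.eventually_left_inverse ..
  have hR : ∀ᶠ y in nhds (ψ 0), ψ (φ y) = y := HasStrictDerivAt.eventually_right_inverse ..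
  have hφ0 : φ (ψ 0) = 0 := hL.self_of_nhds
  rw [h0] at hφa hφd hR hφ0
  have hφt : Tendsto φ (nhds 0) (nhds 0) := by
    have := hφa.continuousAt.tendsto
    rwa [hφ0] at this
  refine ⟨fun y => deriv ψ 0 * φ y, analyticAt_const.mul hφa, by simp [hφ0], ?_, ?_⟩
  · rw [(hφd.hasDerivAt.const_mul (deriv ψ 0)).deriv, mul_inv_cancel₀ hder]
  · filter_upwards [hR, hφt.eventually hball, (hlt.comp hφt).eventually hL] with y b1 b2 b3
    have := hc _ b2
    rw [b1] at this
    simp only [Function.comp_apply] at b3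
    rw [this, b3]; ring

end QL

/-- For some `N`, every non-Brjuno `α ∈ Irr_N` gives a quadratic polynomial `P_α`
that is not linearizable at its fixed point `0`. -/
theorem quadratic_not_linearizable :
    ∃ N : ℕ, 0 < N ∧ ∀ α : ℝ, α ∈ IrrN N → ¬ IsBrjuno α →
      ¬ LinearizableAt (Pa α) Set.univ α := by
  refine ⟨2, by norm_num, fun α hα hB hL => hB ?_⟩
  obtain ⟨r, hr, ψ, hd, hinj, h0, -, hc⟩ := hL
  have hNR : QL.NR (QL.lam α) := QL.lam_NR hα.2.1
  obtain ⟨φ, h1, h2, h3, h4⟩ := QL.lin_to_H (l := QL.lam α) hNR hr hd hinj h0 (fun z hz => hc z hz)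
  obtain ⟨C, hC, hbd⟩ := QL.combine (QL.lam_norm α) hNR h1 h2 h3 h4
  exact QL.brjuno_of_class hα (κ := 1/100) (C := 7*C) (by norm_num) (by norm_num) (by linarith)
    (QL.final_class (QL.lam_norm α) hNR hC hbd)
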